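/- arXiv:1809.03417 — 3 statements merged into one kernel-verified Lean document; each statement's English description precedes it below -/
import Mathlib

section
/- For every integer e ≥ 2, there exists a strictly Neumaier graph with parameters (2^{2e}, (2^{e−1} + 1)(2^e − 1), 2(2^{e−2} + 1)(2^{e−1} − 1); 2^{e−1}, 2^e); that is, there exists a non-complete, non-strongly-regular, edge-regular graph with parameters (2^{2e}, (2^{e−1} + 1)(2^e − 1), 2(2^{e−2} + 1)(2^{e−1} − 1)) containing a 2^{e−1}-regular clique of size 2^e. -/
/-- `G` is edge-regular with parameters `(v, k, lam)`: it has `v` vertices, at least one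
edge, is `k`-regular, and every pair of adjacent vertices has exactly `lam` common
neighbours. -/
def IsEdgeRegular {V : Type*} [Fintype V] (G : SimpleGraph V) (v k lam : ℕ) : Prop :=
  Fintype.card V = v ∧ G ≠ ⊥ ∧ (∀ u : V, (G.neighborSet u).ncard = k) ∧
    ∀ u w : V, G.Adj u w → (G.commonNeighbors u w).ncard = lam

/-- `G` is strongly regular with parameters `(v, k, lam, mu)`: it has `v` vertices, is
neither empty nor complete, is `k`-regular, every pair of adjacent vertices has exactly
`lam` common neighbours and every pair of distinct non-adjacent vertices has exactly
`mu` common neighbours. -/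
def IsStronglyRegular {V : Type*} [Fintype V] (G : SimpleGraph V) (v k lam mu : ℕ) : Prop :=
  Fintype.card V = v ∧ G ≠ ⊥ ∧ G ≠ ⊤ ∧ (∀ u : V, (G.neighborSet u).ncard = k) ∧
    (∀ u w : V, G.Adj u w → (G.commonNeighbors u w).ncard = lam) ∧
    ∀ u w : V, u ≠ w → ¬ G.Adj u w → (G.commonNeighbors u w).ncard = mu

/-- The clique `S` in `G` is `m`-regular (with `m > 0`): every vertex of `G` not in `S`
is adjacent to exactly `m` vertices of `S`. -/
def IsRegularClique {V : Type*} (G : SimpleGraph V) (S : Finset V) (m : ℕ) : Prop :=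
  0 < m ∧ ∀ u : V, u ∉ S → (G.neighborSet u ∩ ↑S).ncard = m

/-- `G` is a Neumaier graph with parameters `(v, k, lam; m, s)`: a non-complete
edge-regular graph with parameters `(v, k, lam)` containing an `m`-regular `s`-clique,
where `s ≥ 2`. -/
def IsNeumaier {V : Type*} [Fintype V] (G : SimpleGraph V) (v k lam m s : ℕ) : Prop :=
  IsEdgeRegular G v k lam ∧ G ≠ ⊤ ∧ 2 ≤ s ∧
    ∃ S : Finset V, G.IsClique ↑S ∧ S.card = s ∧ IsRegularClique G S m

/-- `G` is a strongly regular graph (with some parameters). -/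
def IsStronglyRegularGraph {V : Type*} [Fintype V] (G : SimpleGraph V) : Prop :=
  ∃ v k lam mu : ℕ, IsStronglyRegular G v k lam mu

/-- `G` is a strictly Neumaier graph with parameters `(v, k, lam; m, s)`: a Neumaier
graph which is not strongly regular. -/
def IsStrictlyNeumaier {V : Type*} [Fintype V] (G : SimpleGraph V) (v k lam m s : ℕ) : Prop :=
  IsNeumaier G v k lam m s ∧ ¬ IsStronglyRegularGraph G

/-- `R` is the closed adjacency relation of a strictly Neumaier graph with parameters
`(4a², 2a² + a - 1, a² + a - 2; a, 2a)`, with regular clique `S`, and the rows of the symmetric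
matrix `f` differ pairwise in exactly half of the positions (`f` is a Hadamard matrix). -/
structure IsHadamardNeumaier {T : Type} [Fintype T] (a : ℕ) (R f : T → T → Bool)
    (S : T → Bool) : Prop where
  card : Fintype.card T = 4 * a ^ 2
  refl : ∀ t, R t t = true
  symm : ∀ t u, R t u = R u t
  degree : ∀ t, ∑ s, (R t s).toNat = 2 * a ^ 2 + a
  common : ∀ t u, t ≠ u → R t u = true → ∑ s, (R t s && R u s).toNat = a ^ 2 + a
  symm_form : ∀ t u, f t u = f u t
  balanced : ∀ t u, t ≠ u → ∀ c, ∑ s, (f t s ^^ f u s ^^ c).toNat = 2 * a ^ 2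
  clique : ∀ t u, S t = true → S u = true → R t u = true
  clique_card : ∑ s, (S s).toNat = 2 * a
  clique_regular : ∀ t, S t = false → ∑ s, (R t s && S s).toNat = a
  not_srg : ∃ t u t' u', R t u = false ∧ R t' u' = false ∧
    ∑ s, (R t s && R u s).toNat ≠ ∑ s, (R t' s && R u' s).toNat

/-- The doubled closed adjacency relation: two copies of the `2`-clique blow-up of `R`, joined
according to `f`. -/
def doubleRel {T : Type} (R f : T → T → Bool) (p q : T × Bool × Bool) : Bool :=
  bif p.2.2 ^^ q.2.2 then p.2.1 ^^ q.2.1 ^^ f p.1 q.1 else R p.1 q.1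

/-- The doubled Hadamard matrix. -/
def doubleForm {T : Type} (f : T → T → Bool) (p q : T × Bool × Bool) : Bool :=
  f p.1 q.1 ^^ (p.2.1 && q.2.1) ^^ (p.2.2 && q.2.2)

/-- The doubled clique. -/
def doubleClique {T : Type} (S : T → Bool) (p : T × Bool × Bool) : Bool :=
  S p.1 && !p.2.2

section Double

variable {T : Type} [Fintype T] {a : ℕ} {R f : T → T → Bool} {S : T → Bool}

theorem IsHadamardNeumaier.ne_of_rel_eq_false (h : IsHadamardNeumaier a R f S) {t u : T}
    (htu : R t u = false) : t ≠ u := by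
  rintro rfl
  simp [h.refl] at htu

theorem sum_doubleRel_and_of_same (R f : T → T → Bool) (t u : T) (x x' y : Bool) :
    ∑ s, (doubleRel R f (t, x, y) s && doubleRel R f (u, x', y) s).toNat =
      2 * ∑ s, (R t s && R u s).toNat + ∑ s, (f t s ^^ f u s ^^ !(x ^^ x')).toNat := by
  rw [Fintype.sum_prod_type, Finset.mul_sum, ← Finset.sum_add_distrib]
  refine Finset.sum_congr rfl fun s _ => ?_
  simp only [Fintype.sum_prod_type, Fintype.sum_bool, doubleRel]
  generalize R t s = b₁, R u s = b₂, f t s = b₃, f u s = b₄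
  revert x x' y b₁ b₂ b₃ b₄
  decide

theorem sum_doubleRel_and_of_ne (R f : T → T → Bool) (t u : T) (x x' y : Bool) :
    ∑ s, (doubleRel R f (t, x, y) s && doubleRel R f (u, x', !y) s).toNat =
      ∑ s, (R t s).toNat + ∑ s, (R u s).toNat := by
  rw [Fintype.sum_prod_type, ← Finset.sum_add_distrib]
  refine Finset.sum_congr rfl fun s _ => ?_
  simp only [Fintype.sum_prod_type, Fintype.sum_bool, doubleRel]
  generalize R t s = b₁, R u s = b₂, f t s = b₃, f u s = b₄
  revert x x' y b₁ b₂ b₃ b₄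
  decide

theorem IsHadamardNeumaier.double (h : IsHadamardNeumaier a R f S) :
    IsHadamardNeumaier (2 * a) (doubleRel R f) (doubleForm f) (doubleClique S) where
  card := by
    simp only [Fintype.card_prod, h.card, Fintype.card_bool]
    ring
  refl := by
    rintro ⟨t, x, y⟩
    simp [doubleRel, h.refl]
  symm := by
    rintro ⟨t, x, y⟩ ⟨u, x', y'⟩
    simp only [doubleRel, h.symm t u, h.symm_form t u, Bool.xor_comm y y', Bool.xor_comm x x']
  degree := by
    rintro ⟨t, x, y⟩
    have key : ∑ s, (doubleRel R f (t, x, y) s).toNat =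
        2 * ∑ s, (R t s).toNat + Fintype.card T := by
      rw [Fintype.sum_prod_type, Finset.mul_sum, Fintype.card_eq_sum_ones,
        ← Finset.sum_add_distrib]
      refine Finset.sum_congr rfl fun s _ => ?_
      simp only [Fintype.sum_prod_type, Fintype.sum_bool, doubleRel]
      generalize R t s = b₁, f t s = b₂
      revert x y b₁ b₂
      decide
    rw [key, h.degree, h.card]
    ring
  common := by
    rintro ⟨t, x, y⟩ ⟨u, x', y'⟩ hne hR
    by_cases hy : y = y'
    · subst hy
      rw [sum_doubleRel_and_of_same]
      by_cases ht : t = u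
      · subst ht
        have hx : (x ^^ x') = true := by
          cases x <;> cases x' <;> simp_all
        simp only [hx, Bool.and_self, h.degree, Bool.xor_self, Bool.not_true, Bool.toNat_false,
          Finset.sum_const_zero]
        ring
      · have hR' : R t u = true := by simpa [doubleRel] using hR
        rw [h.common t u ht hR', h.balanced t u ht]
        ring
    · obtain rfl : y' = !y := by
        cases y <;> cases y' <;> simp_all
      rw [sum_doubleRel_and_of_ne, h.degree, h.degree]
      ring
  symm_form := by
    rintro ⟨t, x, y⟩ ⟨u, x', y'⟩
    simp only [doubleForm, h.symm_form t u, Bool.and_comm y y', Bool.and_comm x x']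
  balanced := by
    rintro ⟨t, x, y⟩ ⟨u, x', y'⟩ hne c
    by_cases ht : t = u
    · subst ht
      have key : ∑ s, (doubleForm f (t, x, y) s ^^ doubleForm f (t, x', y') s ^^ c).toNat =
          2 * Fintype.card T := by
        rw [Fintype.sum_prod_type, Fintype.card_eq_sum_ones, Finset.mul_sum]
        refine Finset.sum_congr rfl fun s _ => ?_
        have hxy : (x, y) ≠ (x', y') := fun H => hne (by rw [H])
        simp only [Fintype.sum_prod_type, Fintype.sum_bool, doubleForm]
        generalize f t s = b
        clear hne
        revert x y x' y' c b
        decide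
      rw [key, h.card]
      ring
    · rw [Fintype.sum_prod_type, Finset.sum_comm]
      have key : ∀ z : Bool × Bool,
          ∑ s, (doubleForm f (t, x, y) (s, z) ^^ doubleForm f (u, x', y') (s, z) ^^ c).toNat =
            2 * a ^ 2 := by
        rintro ⟨w, z⟩
        rw [← h.balanced t u ht
          ((x && w) ^^ (y && z) ^^ (x' && w) ^^ (y' && z) ^^ c)]
        refine Finset.sum_congr rfl fun s _ => ?_
        simp only [doubleForm]
        generalize f t s = b₁, f u s = b₂, (x && w) = b₃, (y && z) = b₄, (x' && w) = b₅,
          (y' && z) = b₆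
        revert b₁ b₂ b₃ b₄ b₅ b₆ c
        decide
      simp only [key, Finset.sum_const, Finset.card_univ, Fintype.card_prod, Fintype.card_bool,
        smul_eq_mul]
      ring
  clique := by
    rintro ⟨t, x, y⟩ ⟨u, x', y'⟩ hp hq
    simp only [doubleClique, Bool.and_eq_true, Bool.not_eq_true'] at hp hq
    simp [doubleRel, hp.2, hq.2, h.clique t u hp.1 hq.1]
  clique_card := by
    rw [← h.clique_card, Fintype.sum_prod_type, Finset.mul_sum]
    refine Finset.sum_congr rfl fun s _ => ?_
    simp only [Fintype.sum_prod_type, Fintype.sum_bool, doubleClique]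
    generalize S s = b
    revert b
    decide
  clique_regular := by
    rintro ⟨t, x, y⟩ hp
    cases y
    · have ht : S t = false := by simpa [doubleClique] using hp
      rw [← h.clique_regular t ht, Fintype.sum_prod_type, Finset.mul_sum]
      refine Finset.sum_congr rfl fun s _ => ?_
      simp only [Fintype.sum_prod_type, Fintype.sum_bool, doubleRel, doubleClique]
      generalize S s = b, R t s = b₁, f t s = b₂
      clear hp
      revert x b b₁ b₂
      decide
    · rw [← h.clique_card, Fintype.sum_prod_type]
      refine Finset.sum_congr rfl fun s _ => ?_
      simp only [Fintype.sum_prod_type, Fintype.sum_bool, doubleRel, doubleClique]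
      generalize S s = b, R t s = b₁, f t s = b₂
      clear hp
      revert x b b₁ b₂
      decide
  not_srg := by
    obtain ⟨t, u, t', u', h₁, h₂, hne⟩ := h.not_srg
    refine ⟨(t, false, false), (u, false, false), (t', false, false), (u', false, false),
      by simpa [doubleRel] using h₁, by simpa [doubleRel] using h₂, ?_⟩
    rw [sum_doubleRel_and_of_same, sum_doubleRel_and_of_same,
      h.balanced t u (h.ne_of_rel_eq_false h₁), h.balanced t' u' (h.ne_of_rel_eq_false h₂)]
    omega

end Double

/-- The closed adjacency relation of a Cayley graph on `ℤ/2 × ℤ/8`, the smallest strictly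
Neumaier graph. -/
def seedRel (p q : Bool × Fin 8) : Bool :=
  bif p.1 ^^ q.1 then decide (q.2 - p.2 ∈ [1, 2, 6, 7])
  else decide (q.2 - p.2 ∈ [0, 1, 2, 4, 6, 7])

/-- A nondegenerate symmetric bilinear form over the field with two elements. -/
def seedForm (p q : Bool × Fin 8) : Bool :=
  (p.1 && q.1) ^^ (p.2.val.testBit 0 && q.2.val.testBit 0) ^^
    (p.2.val.testBit 1 && q.2.val.testBit 1) ^^ (p.2.val.testBit 2 && q.2.val.testBit 2)

/-- A regular clique of the smallest strictly Neumaier graph. -/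
def seedClique (p : Bool × Fin 8) : Bool :=
  !p.1 && !p.2.val.testBit 0

theorem isHadamardNeumaier_seed : IsHadamardNeumaier 2 seedRel seedForm seedClique where
  card := by decide
  refl := by decide +kernel
  symm := by decide +kernel
  degree := by decide +kernel
  common := by decide +kernel
  symm_form := by decide +kernel
  balanced := by decide +kernel
  clique := by decide +kernel
  clique_card := by decide +kernel
  clique_regular := by decide +kernel
  not_srg := ⟨(false, 0), (true, 0), (false, 0), (true, 4), by decide +kernel⟩

theorem exists_isHadamardNeumaier (n : ℕ) :
    ∃ (T : Type) (_ : Fintype T) (R f : T → T → Bool) (S : T → Bool),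
      IsHadamardNeumaier (2 ^ (n + 1)) R f S := by
  induction n with
  | zero => exact ⟨_, _, _, _, _, isHadamardNeumaier_seed⟩
  | succ n ih =>
    obtain ⟨T, _, R, f, S, h⟩ := ih
    exact ⟨_, _, _, _, _, (pow_succ' 2 (n + 1)).symm ▸ h.double⟩

theorem sum_toNat_eq_ncard {T : Type} [Fintype T] (g : T → Bool) :
    ∑ s, (g s).toNat = {s | g s = true}.ncard := by
  rw [Set.ncard_eq_toFinset_card', Set.toFinset_ofPred, Finset.card_filter]
  exact Finset.sum_congr rfl fun s _ => by cases g s <;> rfl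

namespace IsHadamardNeumaier

variable {T : Type} [Fintype T] {a : ℕ} {R f : T → T → Bool} {S : T → Bool}

/-- The graph with closed adjacency relation `R`. -/
def graph (h : IsHadamardNeumaier a R f S) : SimpleGraph T where
  Adj t u := t ≠ u ∧ R t u = true
  symm := ⟨fun t u H => ⟨H.1.symm, h.symm t u ▸ H.2⟩⟩
  loopless := ⟨fun _ H => H.1 rfl⟩

theorem ncard_neighborSet (h : IsHadamardNeumaier a R f S) (t : T) :
    (h.graph.neighborSet t).ncard + 1 = 2 * a ^ 2 + a := by
  have ht : t ∉ h.graph.neighborSet t := fun H => H.1 rfl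
  rw [← h.degree t, sum_toNat_eq_ncard, ← Set.ncard_insert_of_notMem ht]
  congr 1
  ext s
  by_cases hs : s = t
  · simp [hs, h.refl]
  · simp [hs, graph, Ne.symm hs]

theorem ncard_commonNeighbors_of_adj (h : IsHadamardNeumaier a R f S) {t u : T}
    (htu : h.graph.Adj t u) : (h.graph.commonNeighbors t u).ncard + 2 = a ^ 2 + a := by
  have hu : u ∉ h.graph.commonNeighbors t u := fun H => H.2.1 rfl
  have ht : t ∉ insert u (h.graph.commonNeighbors t u) := by
    rintro (H | H)
    · exact htu.1 H
    · exact H.1.1 rfl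
  rw [← h.common t u htu.1 htu.2, sum_toNat_eq_ncard, ← Nat.add_assoc _ 1 1,
    ← Set.ncard_insert_of_notMem hu, ← Set.ncard_insert_of_notMem ht]
  congr 1
  ext s
  by_cases hs : s = t
  · simp [hs, h.refl, h.symm u t, htu.2]
  · by_cases hs' : s = u
    · simp [hs', h.refl, htu.2]
    · simp [hs, hs', SimpleGraph.commonNeighbors, graph, Ne.symm hs, Ne.symm hs']

theorem ncard_commonNeighbors_of_not_adj (h : IsHadamardNeumaier a R f S) {t u : T}
    (htu : R t u = false) :
    (h.graph.commonNeighbors t u).ncard = ∑ s, (R t s && R u s).toNat := by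
  rw [sum_toNat_eq_ncard]
  congr 1
  ext s
  by_cases hs : s = t
  · simp [hs, h.symm u t, htu, SimpleGraph.commonNeighbors, graph]
  · by_cases hs' : s = u
    · simp [hs', htu, SimpleGraph.commonNeighbors, graph]
    · simp [SimpleGraph.commonNeighbors, graph, Ne.symm hs, Ne.symm hs']

theorem not_isStronglyRegularGraph (h : IsHadamardNeumaier a R f S) :
    ¬ IsStronglyRegularGraph h.graph := by
  rintro ⟨v, k, lam, mu, -, -, -, -, -, hmu⟩
  obtain ⟨t, u, t', u', h₁, h₂, hne⟩ := h.not_srg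
  apply hne
  rw [← h.ncard_commonNeighbors_of_not_adj h₁, ← h.ncard_commonNeighbors_of_not_adj h₂,
    hmu t u (h.ne_of_rel_eq_false h₁) (by simp [graph, h₁]),
    hmu t' u' (h.ne_of_rel_eq_false h₂) (by simp [graph, h₂])]

theorem isStrictlyNeumaier (h : IsHadamardNeumaier a R f S) (ha : 0 < a) :
    IsStrictlyNeumaier h.graph (4 * a ^ 2) (2 * a ^ 2 + a - 1) (a ^ 2 + a - 2) a (2 * a) := by
  obtain ⟨t, u, -, -, htu, -⟩ := h.not_srg
  have hne := h.ne_of_rel_eq_false htu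
  refine ⟨⟨⟨h.card, ?_, fun t => ?_, fun t u H => ?_⟩, ?_, by omega, ?_⟩,
    h.not_isStronglyRegularGraph⟩
  · intro hbot
    have := h.ncard_neighborSet t
    have hpos : 0 < a ^ 2 := by positivity
    simp only [hbot, SimpleGraph.neighborSet_bot, Set.ncard_empty] at this
    omega
  · have := h.ncard_neighborSet t
    omega
  · have := h.ncard_commonNeighbors_of_adj H
    omega
  · intro htop
    have H : h.graph.Adj t u := by rw [htop]; exact hne
    simp [graph, htu] at H
  · refine ⟨Finset.univ.filter fun s => S s = true, ?_, ?_, ha, fun t ht => ?_⟩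
    · intro t ht u hu hne
      exact ⟨hne, h.clique t u (by simpa using ht) (by simpa using hu)⟩
    · rw [← h.clique_card, sum_toNat_eq_ncard, Set.ncard_eq_toFinset_card', Set.toFinset_ofPred]
    · have ht : S t = false := by simpa using ht
      refine Eq.trans ?_ (h.clique_regular t ht)
      rw [sum_toNat_eq_ncard]
      congr 1
      ext s
      by_cases hs : s = t
      · simp [hs, ht]
      · simp [graph, Ne.symm hs]

end IsHadamardNeumaier

/-- For every integer `e ≥ 2` there exists a strictly Neumaier graph with parameters
`(2^(2e), (2^(e−1) + 1)(2^e − 1), 2(2^(e−2) + 1)(2^(e−1) − 1); 2^(e−1), 2^e)`. -/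
theorem exists_strictlyNeumaier_family (e : ℕ) (he : 2 ≤ e) :
    ∃ (V : Type) (_ : Fintype V) (G : SimpleGraph V),
      IsStrictlyNeumaier G (2 ^ (2 * e)) ((2 ^ (e - 1) + 1) * (2 ^ e - 1))
        (2 * (2 ^ (e - 2) + 1) * (2 ^ (e - 1) - 1)) (2 ^ (e - 1)) (2 ^ e) := by
  obtain ⟨n, rfl⟩ : ∃ n, e = n + 2 := ⟨e - 2, by omega⟩
  obtain ⟨T, hT, R, f, S, h⟩ := exists_isHadamardNeumaier n
  refine ⟨T, hT, h.graph, ?_⟩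
  have key := h.isStrictlyNeumaier (by positivity)
  obtain ⟨b, hb⟩ : ∃ b, 2 ^ n = b + 1 := ⟨2 ^ n - 1, by have := Nat.two_pow_pos n; omega⟩
  have h₁ : 2 ^ (n + 1) = 2 * b + 2 := by rw [pow_succ, hb]; ring
  have h₂ : 2 ^ (n + 2) = 4 * b + 4 := by rw [pow_succ, h₁]; ring
  convert key using 1
  · ring
  · rw [show n + 2 - 1 = n + 1 from rfl, h₁, h₂, show 4 * b + 4 - 1 = 4 * b + 3 from rfl]
    refine (Nat.sub_eq_of_eq_add ?_).symm
    ring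
  · rw [show n + 2 - 1 = n + 1 from rfl, show n + 2 - 2 = n from rfl, hb, h₁,
      show 2 * b + 2 - 1 = 2 * b + 1 from rfl]
    refine (Nat.sub_eq_of_eq_add ?_).symm
    ring
  · rfl
  · ring
end

section
/- Every strictly Neumaier graph has at least 16 vertices, and there exists a strictly Neumaier graph on exactly 16 vertices; moreover, every strictly Neumaier graph on 16 vertices has parameters (16, 9, 4; 2, 4), i.e. it is edge-regular with parameters (16, 9, 4) and contains a 2-regular 4-clique. -/
open Finset

section Counting

variable {V : Type*} [Fintype V] [DecidableEq V] {G : SimpleGraph V} [DecidableRel G.Adj]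
  {k l m s : ℕ}

/-- Double counting of the incidences of a relation between two finite sets. -/
theorem sum_card_filter_comm {α β : Type*} (r : α → β → Prop) [∀ a b, Decidable (r a b)]
    (A : Finset α) (B : Finset β) :
    ∑ a ∈ A, #{b ∈ B | r a b} = ∑ b ∈ B, #{a ∈ A | r a b} :=
  sum_card_bipartiteAbove_eq_sum_card_bipartiteBelow r

theorem ncard_neighborSet_eq (u : V) : (G.neighborSet u).ncard = #{x | G.Adj u x} := by
  rw [← Set.ncard_coe_finset]
  congr 1
  ext x
  simp

theorem ncard_commonNeighbors_eq (u w : V) :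
    (G.commonNeighbors u w).ncard = #{x | G.Adj u x ∧ G.Adj w x} := by
  rw [← Set.ncard_coe_finset]
  congr 1
  ext x
  simp [SimpleGraph.mem_commonNeighbors]

theorem ncard_neighborSet_inter_eq (S : Finset V) (u : V) :
    (G.neighborSet u ∩ ↑S).ncard = #{x ∈ S | G.Adj u x} := by
  rw [← Set.ncard_coe_finset]
  congr 1
  ext x
  simp [and_comm]

/-- In a `k`-regular graph the numbers of common neighbours of `x` with all vertices
add up to `k * k`. -/
theorem sum_card_common (hk : ∀ u, #{x | G.Adj u x} = k) (x : V) :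
    ∑ y, #{z | G.Adj x z ∧ G.Adj y z} = k * k := by
  have h := sum_card_filter_comm (fun y z => G.Adj y z) univ ({z | G.Adj x z} : Finset V)
  simp only [filter_filter] at h
  rw [h]
  have : ∀ z ∈ ({z | G.Adj x z} : Finset V), #{a | G.Adj a z} = k := by
    intro z _
    rw [← hk z]
    simp only [G.adj_comm]
  rw [sum_congr rfl this, sum_const, hk, smul_eq_mul]

theorem filter_not_adj (x : V) :
    ({y | ¬ G.Adj x y} : Finset V) = insert x ({y | y ≠ x ∧ ¬ G.Adj x y} : Finset V) := by
  ext y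
  by_cases h : y = x <;> simp [h]

/-- The numbers of common neighbours of `x` with its non-neighbours add up to `k (k - l - 1)`. -/
theorem sum_card_common_compl (hk : ∀ u, #{x | G.Adj u x} = k)
    (hl : ∀ u w, G.Adj u w → #{x | G.Adj u x ∧ G.Adj w x} = l) (x : V) :
    ∑ y with y ≠ x ∧ ¬ G.Adj x y, #{z | G.Adj x z ∧ G.Adj y z} + k * l + k = k * k := by
  rw [← sum_card_common hk x, ← sum_filter_add_sum_filter_not univ (fun y => G.Adj x y)
    (fun y => #{z | G.Adj x z ∧ G.Adj y z})]
  rw [sum_congr rfl (fun y hy => hl x y (mem_filter.1 hy).2), sum_const, hk, smul_eq_mul]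
  rw [filter_not_adj, sum_insert (by simp)]
  simp only [and_self, hk]
  ring

theorem card_nonadj (hk : ∀ u, #{x | G.Adj u x} = k) (x : V) :
    #{y | y ≠ x ∧ ¬ G.Adj x y} + k + 1 = Fintype.card V := by
  have h := card_filter_add_card_filter_not (s := (univ : Finset V)) (fun y => G.Adj x y)
  rw [filter_not_adj, card_insert_of_notMem (by simp), hk, card_univ] at h
  omega

/-- The vertices adjacent to neither end of an edge. -/
theorem card_nonadj_of_adj (hk : ∀ u, #{x | G.Adj u x} = k)
    (hl : ∀ u w, G.Adj u w → #{x | G.Adj u x ∧ G.Adj w x} = l) {u w : V} (h : G.Adj u w) :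
    #{x | ¬ G.Adj u x ∧ ¬ G.Adj w x} + 2 * k = Fintype.card V + l := by
  have h1 := card_filter_add_card_filter_not (s := (univ : Finset V))
    (fun x => G.Adj u x ∨ G.Adj w x)
  have h2 := card_union_add_card_inter ({x | G.Adj u x} : Finset V) {x | G.Adj w x}
  rw [← filter_or, ← filter_and, hk, hk, hl u w h] at h2
  simp only [not_or, card_univ] at h1
  omega

section Clique

variable {S : Finset V}

theorem card_clique_nbrs (hS : G.IsClique ↑S) {w : V} (hw : w ∈ S) :
    #{x ∈ S | G.Adj w x} + 1 = #S := by
  have : ({x ∈ S | G.Adj w x} : Finset V) = S.erase w := by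
    ext x
    simp only [mem_filter, mem_erase]
    exact ⟨fun h => ⟨h.2.ne', h.1⟩, fun h => ⟨h.2, hS hw h.2 (Ne.symm h.1)⟩⟩
  rw [this, card_erase_add_one hw]

theorem card_filter_mem_add (p : V → Prop) [DecidablePred p] :
    #{x ∈ S | p x} + #{x ∈ Sᶜ | p x} = #{x | p x} := by
  rw [← card_union_of_disjoint (disjoint_filter_filter disjoint_compl_right), ← filter_union,
    union_compl]

theorem card_outer_nbrs (hk : ∀ u, #{x | G.Adj u x} = k) (hS : G.IsClique ↑S)
    {w : V} (hw : w ∈ S) : #{x ∈ Sᶜ | G.Adj w x} + #S = k + 1 := by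
  have h1 := card_clique_nbrs hS hw
  have h2 := card_filter_mem_add (S := S) (fun x => G.Adj w x)
  rw [hk] at h2
  omega

theorem card_outer_common (hl : ∀ u w, G.Adj u w → #{x | G.Adj u x ∧ G.Adj w x} = l)
    (hS : G.IsClique ↑S) {u w : V} (hu : u ∈ S) (hw : w ∈ S) (h : u ≠ w) :
    #{x ∈ Sᶜ | G.Adj u x ∧ G.Adj w x} + #S = l + 2 := by
  have h2 := card_filter_mem_add (S := S) (fun x => G.Adj u x ∧ G.Adj w x)
  rw [hl u w (hS hu hw h)] at h2
  have : ({x ∈ S | G.Adj u x ∧ G.Adj w x} : Finset V) = (S.erase u).erase w := by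
    ext x
    simp only [mem_filter, mem_erase]
    exact ⟨fun h => ⟨h.2.2.ne', h.2.1.ne', h.1⟩,
      fun h => ⟨h.2.2, hS hu h.2.2 (Ne.symm h.2.1), hS hw h.2.2 (Ne.symm h.1)⟩⟩
  rw [this] at h2
  have h3 := card_erase_add_one (s := S.erase u) (a := w) (by simp [h.symm, hw])
  have h4 := card_erase_add_one hu
  omega

/-- Counting the edges leaving a clique. -/
theorem sum_outer_deg (hk : ∀ u, #{x | G.Adj u x} = k) (hS : G.IsClique ↑S) {a : ℕ}
    (ha : k + 1 = #S + a) : ∑ u ∈ Sᶜ, #{w ∈ S | G.Adj u w} = #S * a := by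
  rw [sum_card_filter_comm]
  rw [sum_congr rfl (g := fun _ => a), sum_const, smul_eq_mul]
  intro w hw
  have := card_outer_nbrs hk hS hw
  simp only [G.adj_comm _ w]
  omega

/-- Counting the paths of length two whose ends lie in a clique and whose middle does not. -/
theorem sum_outer_deg_sq (hl : ∀ u w, G.Adj u w → #{x | G.Adj u x ∧ G.Adj w x} = l)
    (hS : G.IsClique ↑S) {b : ℕ} (hb : l + 2 = #S + b) :
    ∑ u ∈ Sᶜ, (#{w ∈ S | G.Adj u w} * #{w ∈ S | G.Adj u w} - #{w ∈ S | G.Adj u w}) =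
      (#S * #S - #S) * b := by
  have h := sum_card_filter_comm (fun u (p : V × V) => G.Adj u p.1 ∧ G.Adj u p.2) Sᶜ S.offDiag
  have h1 : ∀ u ∈ Sᶜ, #{p ∈ S.offDiag | G.Adj u p.1 ∧ G.Adj u p.2} =
      #{w ∈ S | G.Adj u w} * #{w ∈ S | G.Adj u w} - #{w ∈ S | G.Adj u w} := by
    intro u _
    rw [← offDiag_card]
    congr 1
    ext p
    simp only [mem_filter, mem_offDiag]
    tauto
  rw [sum_congr rfl h1] at h
  rw [h, ← offDiag_card, sum_congr rfl (g := fun _ => b), sum_const, smul_eq_mul]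
  rintro ⟨u, w⟩ hp
  obtain ⟨hu, hw, huw⟩ := mem_offDiag.1 hp
  have := card_outer_common hl hS hu hw huw
  simp only [G.adj_comm _ u, G.adj_comm _ w] at this ⊢
  omega

theorem neumaier_eqs (hk : ∀ u, #{x | G.Adj u x} = k)
    (hl : ∀ u w, G.Adj u w → #{x | G.Adj u x ∧ G.Adj w x} = l) (hS : G.IsClique ↑S)
    (hm : ∀ u ∉ S, #{w ∈ S | G.Adj u w} = m) (h2 : 2 ≤ #S) :
    ∃ a b n, k + 1 = #S + a ∧ l + 2 = #S + b ∧ Fintype.card V = #S + n ∧ #Sᶜ = n ∧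
      #S * a = n * m ∧ a * (m - 1) = (#S - 1) * b := by
  obtain ⟨u, hu, w, hw, huw⟩ := one_lt_card.1 h2
  have ha := card_outer_nbrs hk hS hu
  have hb := card_outer_common hl hS hu hw huw
  have hn := card_add_card_compl S
  generalize hA : #{x ∈ Sᶜ | G.Adj u x} = a at ha
  generalize hB : #{x ∈ Sᶜ | G.Adj u x ∧ G.Adj w x} = b at hb
  have e1 := sum_outer_deg hk hS (a := a) (by omega)
  have e2 := sum_outer_deg_sq hl hS (b := b) (by omega)
  rw [sum_congr rfl (fun u hu => hm u (mem_compl.1 hu)), sum_const, smul_eq_mul] at e1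
  rw [sum_congr rfl (g := fun _ => m * m - m)
    (fun u hu => by rw [hm u (mem_compl.1 hu)]), sum_const, smul_eq_mul] at e2
  refine ⟨a, b, #Sᶜ, by omega, by omega, by omega, rfl, e1.symm, ?_⟩
  have e3 : #S * (a * (m - 1)) = #S * ((#S - 1) * b) := by
    rw [← mul_assoc, ← e1, ← mul_assoc, Nat.mul_sub_one #S, ← e2, mul_assoc, Nat.mul_sub_one m]
  exact Nat.eq_of_mul_eq_mul_left (by omega) e3

/-- In a Neumaier graph, every clique of the same size as a regular clique is itself regular
with the same nexus. -/
theorem clique_regular_of_card_eq (hk : ∀ u, #{x | G.Adj u x} = k)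
    (hl : ∀ u w, G.Adj u w → #{x | G.Adj u x ∧ G.Adj w x} = l) (hS : G.IsClique ↑S)
    (hm : ∀ u ∉ S, #{w ∈ S | G.Adj u w} = m) (h2 : 2 ≤ #S) {K : Finset V}
    (hK : G.IsClique ↑K) (hc : #K = #S) : ∀ u ∉ K, #{w ∈ K | G.Adj u w} = m := by
  obtain ⟨a, b, n, ha, hb, -, hn, -, -⟩ := neumaier_eqs hk hl hS hm h2
  have s1 := sum_outer_deg hk hS ha
  have s2 := sum_outer_deg_sq hl hS hb
  have k1 := sum_outer_deg hk hK (a := a) (by omega)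
  have k2 := sum_outer_deg_sq hl hK (b := b) (by omega)
  have hn' : #Kᶜ = n := by rw [← hn, card_compl, card_compl, hc]
  rw [sum_congr rfl (fun u hu => hm u (mem_compl.1 hu)), sum_const, smul_eq_mul, hn] at s1
  rw [sum_congr rfl (g := fun _ => m * m - m)
    (fun u hu => by rw [hm u (mem_compl.1 hu)]), sum_const, smul_eq_mul, hn] at s2
  rw [hc, ← s1] at k1
  rw [hc, ← s2] at k2
  have k2' : ∑ u ∈ Kᶜ, ((#{w ∈ K | G.Adj u w} : ℤ) * #{w ∈ K | G.Adj u w} -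
      #{w ∈ K | G.Adj u w}) = n * (m * m - m) := by
    have := congrArg (Nat.cast : ℕ → ℤ) k2
    rw [Nat.cast_sum, Nat.cast_mul, Nat.cast_sub (Nat.le_mul_self m)] at this
    rw [← Nat.cast_mul m m] at *
    rw [← this]
    refine sum_congr rfl fun u _ => ?_
    rw [Nat.cast_sub (Nat.le_mul_self _), Nat.cast_mul]
  have k1' : ∑ u ∈ Kᶜ, (#{w ∈ K | G.Adj u w} : ℤ) = n * m := by exact_mod_cast k1
  have k0 : ∑ u ∈ Kᶜ, ((#{w ∈ K | G.Adj u w} : ℤ) - m) ^ 2 = 0 := by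
    have : ∀ u ∈ Kᶜ, ((#{w ∈ K | G.Adj u w} : ℤ) - m) ^ 2 =
        ((#{w ∈ K | G.Adj u w} : ℤ) * #{w ∈ K | G.Adj u w} - #{w ∈ K | G.Adj u w}) +
          (1 - 2 * m) * #{w ∈ K | G.Adj u w} + m * m := fun u _ => by ring
    rw [sum_congr rfl this, sum_add_distrib, sum_add_distrib, ← mul_sum, k1', k2', sum_const,
      hn', nsmul_eq_mul]
    ring
  intro u hu
  have := (sum_eq_zero_iff_of_nonneg (fun u _ => sq_nonneg _)).1 k0 u (mem_compl.2 hu)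
  have := pow_eq_zero_iff (two_ne_zero) |>.1 this
  omega

/-- The neighbourhood of a vertex of a regular clique induces a regular graph outside the
clique. -/
theorem card_outer_local (hl : ∀ u w, G.Adj u w → #{x | G.Adj u x ∧ G.Adj w x} = l)
    (hS : G.IsClique ↑S) (hm : ∀ u ∉ S, #{w ∈ S | G.Adj u w} = m)
    {w u : V} (hw : w ∈ S) (hu : u ∉ S) (h : G.Adj w u) :
    #{x ∈ Sᶜ | G.Adj w x ∧ G.Adj u x} + m = l + 1 := by
  have h2 := card_filter_mem_add (S := S) (fun x => G.Adj w x ∧ G.Adj u x)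
  rw [hl w u h] at h2
  have : ({x ∈ S | G.Adj w x ∧ G.Adj u x} : Finset V) = ({x ∈ S | G.Adj u x} : Finset V).erase w := by
    ext x
    simp only [mem_filter, mem_erase]
    exact ⟨fun h => ⟨h.2.1.ne', h.1, h.2.2⟩, fun h => ⟨h.2.1, hS hw h.2.1 (Ne.symm h.1), h.2.2⟩⟩
  have h3 := card_erase_add_one (s := ({x ∈ S | G.Adj u x} : Finset V)) (a := w)
    (by simp [hw, h.symm])
  rw [hm u hu] at h3
  rw [this] at h2
  omega

theorem outer_local_subset (w u : V) :
    ({x ∈ Sᶜ | G.Adj w x ∧ G.Adj u x} : Finset V) ⊆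
      ({x ∈ Sᶜ | G.Adj w x} : Finset V).erase u := by
  intro x
  simp only [mem_filter, mem_erase]
  exact fun h => ⟨h.2.2.ne', h.1, h.2.1⟩

theorem clique_bound (hk : ∀ u, #{x | G.Adj u x} = k)
    (hl : ∀ u w, G.Adj u w → #{x | G.Adj u x ∧ G.Adj w x} = l) (hS : G.IsClique ↑S)
    (hm : ∀ u ∉ S, #{w ∈ S | G.Adj u w} = m) {w u : V} (hw : w ∈ S) (hu : u ∉ S)
    (h : G.Adj w u) : l + #S + 1 ≤ k + m := by
  have h1 := card_le_card (outer_local_subset (G := G) (S := S) w u)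
  have h2 := card_erase_add_one (s := ({x ∈ Sᶜ | G.Adj w x} : Finset V)) (a := u) (by simp [hu, h])
  have h3 := card_outer_local hl hS hm hw hu h
  have h4 := card_outer_nbrs hk hS hw
  omega

/-- In the case of equality in `clique_bound`, the neighbours outside the clique of each vertex
of the clique form a clique. -/
theorem outer_clique (hk : ∀ u, #{x | G.Adj u x} = k)
    (hl : ∀ u w, G.Adj u w → #{x | G.Adj u x ∧ G.Adj w x} = l) (hS : G.IsClique ↑S)
    (hm : ∀ u ∉ S, #{w ∈ S | G.Adj u w} = m) (he : k + m = l + #S + 1) {w : V} (hw : w ∈ S) :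
    G.IsClique ↑(insert w ({x ∈ Sᶜ | G.Adj w x} : Finset V)) := by
  rw [coe_insert, SimpleGraph.isClique_insert]
  refine ⟨?_, fun b hb _ => by simpa using (mem_filter.1 (mem_coe.1 hb)).2⟩
  intro u hu x hx hux
  simp only [coe_filter, mem_compl, Set.mem_ofPred_eq] at hu hx
  have h2 := card_erase_add_one (s := ({x ∈ Sᶜ | G.Adj w x} : Finset V)) (a := u) (by simp [hu])
  have h3 := card_outer_local hl hS hm hw hu.1 hu.2
  have h4 := card_outer_nbrs hk hS hw
  have h1 := eq_of_subset_of_card_le (outer_local_subset (G := G) (S := S) w u) (by omega)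
  have : x ∈ ({x ∈ Sᶜ | G.Adj w x ∧ G.Adj u x} : Finset V) := by
    rw [h1]
    simp [hux.symm, hx]
  exact (mem_filter.1 this).2.2

theorem card_insert_outer (hk : ∀ u, #{x | G.Adj u x} = k) (hS : G.IsClique ↑S) {w : V}
    (hw : w ∈ S) : #(insert w ({x ∈ Sᶜ | G.Adj w x} : Finset V)) + #S = k + 2 := by
  have h4 := card_outer_nbrs hk hS hw
  rw [card_insert_of_notMem (by simp)]
  omega

/-- If equality holds in `clique_bound` and `k = 2 (s - 1)`, then non-adjacent vertices have
exactly `2 * m` common neighbours. -/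
theorem common_of_clique_eq (hk : ∀ u, #{x | G.Adj u x} = k)
    (hl : ∀ u w, G.Adj u w → #{x | G.Adj u x ∧ G.Adj w x} = l) (hS : G.IsClique ↑S)
    (hm : ∀ u ∉ S, #{w ∈ S | G.Adj u w} = m) (h0 : 0 < m) (h2 : 2 ≤ #S)
    (he : k + m = l + #S + 1) (hks : k + 2 = 2 * #S) {x y : V} (hxy : x ≠ y)
    (hn : ¬ G.Adj x y) : #{z | G.Adj x z ∧ G.Adj y z} = 2 * m := by
  have main : ∃ K : Finset V, G.IsClique ↑K ∧ #K = #S ∧ x ∈ K := by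
    by_cases hx : x ∈ S
    · exact ⟨S, hS, rfl, hx⟩
    · have := hm x hx
      obtain ⟨w, hw⟩ : ({w ∈ S | G.Adj x w} : Finset V).Nonempty := by
        rw [← card_pos]; omega
      obtain ⟨hw, hxw⟩ := mem_filter.1 hw
      refine ⟨_, outer_clique hk hl hS hm he hw, ?_, ?_⟩
      · have := card_insert_outer hk hS hw
        omega
      · simp [hx, hxw.symm]
  obtain ⟨K, hK, hKc, hxK⟩ := main
  have hmK := clique_regular_of_card_eq hk hl hS hm h2 hK hKc
  have hL := outer_clique hk hl hK hmK (by omega) hxK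
  have hLc := card_insert_outer hk hK hxK
  set L := insert x ({z ∈ Kᶜ | G.Adj x z} : Finset V) with hLdef
  have hmL := clique_regular_of_card_eq hk hl hS hm h2 hL (by omega)
  have hyK : y ∉ K := fun h => hn (hK hxK h hxy)
  have hyL : y ∉ L := fun h => hn (hL (by simp [hLdef]) h hxy)
  have hyx : ¬ G.Adj y x := fun h => hn h.symm
  rw [two_mul, ← card_filter_mem_add (S := K)]
  congr 1
  · rw [← hmK y hyK]
    congr 1
    ext z
    simp only [mem_filter]
    refine ⟨fun h => ⟨h.1, h.2.2⟩, fun h => ⟨h.1, hK hxK h.1 ?_, h.2⟩⟩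
    rintro rfl
    exact hyx h.2
  · rw [← hmL y hyL, hLdef, filter_insert, if_neg hyx, filter_filter]

end Clique

/-- If `v = 2 k - l` then non-adjacent vertices have the same neighbours. -/
theorem common_of_multipartite (hk : ∀ u, #{x | G.Adj u x} = k)
    (hl : ∀ u w, G.Adj u w → #{x | G.Adj u x ∧ G.Adj w x} = l)
    (hv : Fintype.card V + l = 2 * k) {x y : V} (hn : ¬ G.Adj x y) :
    #{z | G.Adj x z ∧ G.Adj y z} = k := by
  rw [← hk x]
  congr 1
  ext z
  simp only [mem_filter, mem_univ, true_and, and_iff_left_iff_imp]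
  intro hz
  have h := card_nonadj_of_adj hk hl hz
  have h0 : #{t | ¬ G.Adj x t ∧ ¬ G.Adj z t} = 0 := by omega
  rw [card_eq_zero, filter_eq_empty_iff] at h0
  have := h0 (mem_univ y)
  rw [G.adj_comm y z]
  tauto

/-- In an edge-regular graph with `l = 1`, non-adjacent vertices have at most `k / 2` common
neighbours. -/
theorem two_mul_common_le (hk : ∀ u, #{x | G.Adj u x} = k)
    (hl : ∀ u w, G.Adj u w → #{x | G.Adj u x ∧ G.Adj w x} = 1) {p y : V} (hpy : p ≠ y) :
    2 * #{z | G.Adj p z ∧ G.Adj y z} ≤ k := by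
  set C : Finset V := {z | G.Adj p z ∧ G.Adj y z} with hC
  set D : Finset V := {z | G.Adj y z ∧ ¬ G.Adj p z} with hD
  have hCD : #C + #D = k := by
    rw [← hk y, ← card_filter_add_card_filter_not (s := ({x | G.Adj y x} : Finset V))
      (fun z => G.Adj p z), filter_filter, filter_filter, hC, hD]
    simp only [and_comm]
  have h := sum_card_filter_comm (fun x z => G.Adj x z) C D
  have h1 : ∀ x ∈ C, #{z ∈ D | G.Adj x z} = 1 := by
    intro x hx
    obtain ⟨hpx, hyx⟩ := (mem_filter.1 hx).2
    rw [← hl y x hyx, hD, filter_filter]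
    congr 1
    ext z
    simp only [mem_filter, mem_univ, true_and]
    refine ⟨fun h => ⟨h.1.1, h.2⟩, fun h => ⟨⟨h.1, fun hpz => ?_⟩, h.2⟩⟩
    obtain ⟨t, ht⟩ := card_eq_one.1 (hl x z h.2)
    have a1 : p ∈ ({t} : Finset V) := by rw [← ht]; simp [hpx.symm, hpz.symm]
    have a2 : y ∈ ({t} : Finset V) := by rw [← ht]; simp [hyx.symm, h.1.symm]
    rw [mem_singleton] at a1 a2
    exact hpy (a1.trans a2.symm)
  have h2 : ∀ z ∈ D, #{x ∈ C | G.Adj x z} ≤ 1 := by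
    intro z hz
    rw [← hl y z (mem_filter.1 hz).2.1]
    refine card_le_card fun x => ?_
    simp only [hC, mem_filter, mem_univ, true_and]
    exact fun h => ⟨h.1.2, h.2.symm⟩
  rw [sum_congr rfl h1, sum_const, smul_eq_mul] at h
  have := sum_le_card_nsmul D _ 1 h2
  rw [smul_eq_mul] at this
  omega

theorem common_of_fifteen_six (hV : Fintype.card V = 15) (hk : ∀ u, #{x | G.Adj u x} = 6)
    (hl : ∀ u w, G.Adj u w → #{x | G.Adj u x ∧ G.Adj w x} = 1) {x y : V} (hxy : x ≠ y)
    (hn : ¬ G.Adj x y) : #{z | G.Adj x z ∧ G.Adj y z} = 3 := by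
  have h1 := sum_card_common_compl hk hl x
  have h2 := card_nonadj hk x
  have h3 : ∀ z ∈ ({z | z ≠ x ∧ ¬ G.Adj x z} : Finset V), #{t | G.Adj x t ∧ G.Adj z t} ≤ 3 := by
    intro z hz
    have := two_mul_common_le hk hl (mem_filter.1 hz).2.1.symm
    omega
  refine (sum_eq_sum_iff_of_le h3).1 ?_ y (by simp [hxy.symm, hn])
  rw [sum_const, smul_eq_mul]
  omega

theorem not_twelve_five [Nonempty V] (hV : Fintype.card V = 12) (hk : ∀ u, #{x | G.Adj u x} = 5)
    (hl : ∀ u w, G.Adj u w → #{x | G.Adj u x ∧ G.Adj w x} = 1) : False := by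
  obtain ⟨x⟩ := ‹Nonempty V›
  have h1 := sum_card_common_compl hk hl x
  have h2 := card_nonadj hk x
  have h3 : ∀ z ∈ ({z | z ≠ x ∧ ¬ G.Adj x z} : Finset V), #{t | G.Adj x t ∧ G.Adj z t} ≤ 2 := by
    intro z hz
    have := two_mul_common_le hk hl (mem_filter.1 hz).2.1.symm
    omega
  have := sum_le_card_nsmul _ _ _ h3
  rw [smul_eq_mul] at this
  omega

/-- There is no `4`-regular graph on `15` vertices in which distinct non-adjacent vertices have
exactly one common neighbour. -/
theorem not_fifteen_four [Nonempty V] (hV : Fintype.card V = 15)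
    (hk : ∀ u, #{x | G.Adj u x} = 4)
    (hn : ∀ u w, u ≠ w → ¬ G.Adj u w → #{x | G.Adj u x ∧ G.Adj w x} = 1) : False := by
  have uniq : ∀ {u w a b : V}, u ≠ w → ¬ G.Adj u w → G.Adj u a → G.Adj w a → G.Adj u b →
      G.Adj w b → a = b := by
    intro u w a b huw h h1 h2 h3 h4
    exact card_le_one.1 (hn u w huw h).le a (by simp [h1, h2]) b (by simp [h3, h4])
  obtain ⟨x⟩ := ‹Nonempty V›
  have hsum : ∑ y with G.Adj x y, #{z | G.Adj x z ∧ G.Adj y z} = 2 := by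
    have h1 := sum_card_common hk x
    rw [← sum_filter_add_sum_filter_not univ (fun y => G.Adj x y)] at h1
    have h3 : ∀ y ∈ ({y | y ≠ x ∧ ¬ G.Adj x y} : Finset V), #{z | G.Adj x z ∧ G.Adj y z} = 1 :=
      fun y hy => hn x y (mem_filter.1 hy).2.1.symm (mem_filter.1 hy).2.2
    rw [filter_not_adj, sum_insert (by simp), sum_congr rfl h3, sum_const, smul_eq_mul] at h1
    have h2 := card_nonadj hk x
    simp only [and_self, hk] at h1
    omega
  obtain ⟨x', hx', hpos⟩ : ∃ y ∈ ({y | G.Adj x y} : Finset V),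
      #{z | G.Adj x z ∧ G.Adj y z} ≠ 0 := by
    apply exists_ne_zero_of_sum_ne_zero
    omega
  replace hx' := (mem_filter.1 hx').2
  obtain ⟨x'', hx''⟩ := card_ne_zero.1 hpos
  obtain ⟨hx'', hxx⟩ := (mem_filter.1 hx'').2
  have hle : ∀ p, G.Adj x p → p ≠ x' → p ≠ x'' → ∀ z, G.Adj x z → ¬ G.Adj p z := by
    intro p hp h1 h2 z hz hpz
    have hs : ({x', x'', p} : Finset V) ⊆ ({y | G.Adj x y} : Finset V) := by
      intro t
      simp only [mem_insert, mem_singleton, mem_filter, mem_univ, true_and]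
      rintro (rfl | rfl | rfl) <;> assumption
    have h3 := sum_le_sum_of_subset (f := fun y => #{z | G.Adj x z ∧ G.Adj y z}) hs
    rw [hsum, sum_insert (by simp [hxx.ne, h1.symm]), sum_insert (by simp [h2.symm]),
      sum_singleton] at h3
    have c1 : 0 < #{z | G.Adj x z ∧ G.Adj x' z} := card_pos.2 ⟨x'', by simp [hx'', hxx]⟩
    have c2 : 0 < #{z | G.Adj x z ∧ G.Adj x'' z} := card_pos.2 ⟨x', by simp [hx', hxx.symm]⟩
    have c3 : 0 < #{z | G.Adj x z ∧ G.Adj p z} := card_pos.2 ⟨z, by simp [hz, hpz]⟩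
    omega
  obtain ⟨p, hp, hpn⟩ : ∃ p ∈ ({y | G.Adj x y} : Finset V), p ∉ ({x', x''} : Finset V) := by
    apply exists_mem_notMem_of_card_lt_card
    rw [hk]
    exact card_le_two.trans_lt (by norm_num)
  replace hp := (mem_filter.1 hp).2
  simp only [mem_insert, mem_singleton, not_or] at hpn
  have hpx := hle p hp hpn.1 hpn.2
  have hpx' : ¬ G.Adj p x' := hpx x' hx'
  have hpx'' : ¬ G.Adj p x'' := hpx x'' hx''
  set Z : Finset V := ({z | G.Adj p z} : Finset V).erase x with hZ
  set T : Finset V := (({z | G.Adj x' z} : Finset V).erase x).erase x'' with hT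
  have hZc : #Z = 3 := by
    have := card_erase_add_one (s := ({z | G.Adj p z} : Finset V)) (a := x) (by simp [hp.symm])
    rw [hk, ← hZ] at this
    omega
  have hTc : #T = 2 := by
    have h1 := card_erase_add_one (s := ({z | G.Adj x' z} : Finset V)) (a := x)
      (by simp [hx'.symm])
    have h2 := card_erase_add_one (s := ({z | G.Adj x' z} : Finset V).erase x) (a := x'')
      (by simp [hxx, hx''.ne'])
    rw [← hT] at h2
    rw [hk] at h1
    omega
  have hZT := sum_card_filter_comm (fun z t => G.Adj z t) Z T
  have h1 : ∀ z ∈ Z, #{t ∈ T | G.Adj z t} = 1 := by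
    intro z hz
    simp only [hZ, mem_erase, mem_filter, mem_univ, true_and] at hz
    have hzx : ¬ G.Adj x z := fun h => hpx z h hz.2
    have hzx' : ¬ G.Adj z x' := fun h =>
      hz.1 (uniq hpn.1 hpx' hz.2 h.symm hp.symm hx'.symm)
    have hzx'' : ¬ G.Adj z x'' := fun h =>
      hz.1 (uniq hpn.2 hpx'' hz.2 h.symm hp.symm hx''.symm)
    have hne : z ≠ x' := by
      rintro rfl
      exact hzx hx'
    rw [← hn z x' hne hzx']
    congr 1
    ext t
    simp only [hT, mem_erase, mem_filter, mem_univ, true_and]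
    refine ⟨fun h => ⟨h.2, h.1.2.2⟩, fun h => ⟨⟨?_, ?_, h.2⟩, h.1⟩⟩
    · rintro rfl
      exact hzx'' h.1
    · rintro rfl
      exact hzx h.1.symm
  have h2 : ∀ t ∈ T, #{z ∈ Z | G.Adj z t} = 1 := by
    intro t ht
    simp only [hT, mem_erase, mem_filter, mem_univ, true_and] at ht
    have htx : ¬ G.Adj x t := fun h => by
      by_cases h' : t = x'
      · subst h'
        exact G.irrefl ht.2.2
      · exact hle t h h' ht.1 x' hx' ht.2.2.symm
    have htp : ¬ G.Adj p t := fun h =>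
      ht.2.1 (uniq hpn.1 hpx' h ht.2.2 hp.symm hx'.symm)
    have hne : p ≠ t := by
      rintro rfl
      exact htx hp
    rw [← hn p t hne htp]
    congr 1
    ext z
    simp only [hZ, mem_erase, mem_filter, mem_univ, true_and]
    refine ⟨fun h => ⟨h.1.2, h.2.symm⟩, fun h => ⟨⟨?_, h.1⟩, h.2.symm⟩⟩
    rintro rfl
    exact htx h.2.symm
  rw [sum_congr rfl h1, sum_congr rfl h2, sum_const, sum_const, hZc, hTc, smul_eq_mul,
    smul_eq_mul] at hZT
  omega

theorem not_fifteen_ten [Nonempty V] (hV : Fintype.card V = 15)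
    (hk : ∀ u, #{x | G.Adj u x} = 10)
    (hl : ∀ u w, G.Adj u w → #{x | G.Adj u x ∧ G.Adj w x} = 6) : False := by
  refine not_fifteen_four (G := Gᶜ) hV (fun u => ?_) (fun u w huw h => ?_)
  · have h1 := card_nonadj hk u
    simp only [SimpleGraph.compl_adj, ne_comm (a := u)]
    omega
  · have h' : G.Adj u w := by
      by_contra h'
      exact h ⟨huw, h'⟩
    have h1 := card_nonadj_of_adj hk hl h'
    have : ({x | Gᶜ.Adj u x ∧ Gᶜ.Adj w x} : Finset V) =
        ({x | ¬ G.Adj u x ∧ ¬ G.Adj w x} : Finset V) := by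
      ext x
      simp only [SimpleGraph.compl_adj, mem_filter, mem_univ, true_and]
      refine ⟨fun h => ⟨h.1.2, h.2.2⟩, fun h => ⟨⟨?_, h.1⟩, ?_, h.2⟩⟩
      · rintro rfl
        exact h.2 h'.symm
      · rintro rfl
        exact h.1 h'
    rw [this]
    omega

end Counting

/-- The conclusion of the arithmetic classification of small parameters. -/
def IsSmallCase (v k l m s : ℕ) : Prop :=
  v + l = 2 * k ∨ (k + m = l + s + 1 ∧ k + 2 = 2 * s) ∨ (v = 12 ∧ k = 5 ∧ l = 1) ∨
    (v = 15 ∧ k = 6 ∧ l = 1) ∨ (v = 15 ∧ k = 10 ∧ l = 6) ∨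
    (v = 16 ∧ k = 9 ∧ l = 4 ∧ m = 2 ∧ s = 4)

instance (v k l m s : ℕ) : Decidable (IsSmallCase v k l m s) := by
  unfold IsSmallCase; infer_instance

/-- The classification for fixed `v`, `s`, `m`, `k`. -/
def SmallInner (v s m k : ℕ) : Prop :=
  ∀ l < 17, (l < k ∧ s ≤ l + 2 ∧ (k + 1 - s) * (m - 1) = (s - 1) * (l + 2 - s) ∧
    l + s + 1 ≤ k + m ∧ 2 * k ≤ v + l) → IsSmallCase v k l m s

instance (v s m k : ℕ) : Decidable (SmallInner v s m k) := by
  unfold SmallInner; infer_instance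

/-- The classification for fixed `v`, `s`, `m`. -/
def SmallOuter (v s m : ℕ) : Prop :=
  (m ≤ s ∧ 2 ≤ s ∧ 0 < m) → ∀ k < 17, (k + 2 ≤ v ∧ s ≤ k + 1 ∧ s ≤ v ∧
    s * (k + 1 - s) = (v - s) * m) → SmallInner v s m k

instance (v s m : ℕ) : Decidable (SmallOuter v s m) := by
  unfold SmallOuter; infer_instance

/-- The arithmetic classification of the parameters with at most `16` vertices. -/
theorem small_parameters : ∀ v < 17, ∀ s < 17, ∀ m < 17, SmallOuter v s m := by
  decide +kernel

theorem strictlyNeumaier_parameters {V : Type*} [Fintype V] {G : SimpleGraph V}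
    {v k l m s : ℕ} (h : IsStrictlyNeumaier G v k l m s) (hv : Fintype.card V ≤ 16) :
    v = 16 ∧ k = 9 ∧ l = 4 ∧ m = 2 ∧ s = 4 := by
  classical
  obtain ⟨⟨⟨hV, hbot, hk', hl'⟩, htop, hs2, S, hS, rfl, hm0, hm'⟩, hsrg⟩ := h
  have mkSRG : ∀ mu, (∀ x y, x ≠ y → ¬ G.Adj x y → #{z | G.Adj x z ∧ G.Adj y z} = mu) →
      False := fun mu hmu => hsrg ⟨v, k, l, mu, hV, hbot, htop, hk', hl', fun x y h1 h2 => by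
    rw [ncard_commonNeighbors_eq]
    exact hmu x y h1 h2⟩
  simp only [ncard_neighborSet_eq] at hk'
  simp only [ncard_commonNeighbors_eq] at hl'
  simp only [ncard_neighborSet_inter_eq] at hm'
  have hne : Nonempty V := by
    obtain ⟨x, -⟩ : S.Nonempty := by rw [← card_pos]; omega
    exact ⟨x⟩
  obtain ⟨x, y, hxy, hadj⟩ : ∃ x y, x ≠ y ∧ ¬ G.Adj x y := by
    by_contra! hc
    apply htop
    ext x y
    simpa using ⟨fun h => h.ne, hc x y⟩
  have hkv : k + 2 ≤ v := by
    have h1 := card_nonadj hk' x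
    have : 0 < #{z | z ≠ x ∧ ¬ G.Adj x z} := card_pos.2 ⟨y, by simp [hxy.symm, hadj]⟩
    omega
  obtain ⟨u, hu⟩ : ∃ u, u ∉ S := by
    by_contra! hc
    exact hadj (hS (hc x) (hc y) hxy)
  obtain ⟨w, hw⟩ : ({w ∈ S | G.Adj u w} : Finset V).Nonempty := by
    rw [← card_pos, hm' u hu]
    exact hm0
  obtain ⟨hw, huw⟩ := mem_filter.1 hw
  have hms : m ≤ #S := by
    rw [← hm' u hu]
    exact card_filter_le _ _
  have hlk : l < k := by
    rw [← hl' u w huw, ← hk' u]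
    refine card_lt_card (ssubset_iff_of_subset (fun z => ?_) |>.2 ⟨w, by simp [huw], by simp⟩)
    simp only [mem_filter, mem_univ, true_and]
    exact fun h => h.1
  obtain ⟨a, b, n, ha, hb, hn, -, e1, e2⟩ := neumaier_eqs hk' hl' hS hm' hs2
  have hbd := clique_bound hk' hl' hS hm' hw hu huw.symm
  have hbd2 := card_nonadj_of_adj hk' hl' huw
  obtain rfl : a = k + 1 - #S := by omega
  obtain rfl : b = l + 2 - #S := by omega
  obtain rfl : n = v - #S := by omega
  rcases small_parameters v (by omega) #S (by omega) m (by omega) ⟨hms, hs2, hm0⟩ k (by omega)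
    ⟨hkv, by omega, by omega, e1⟩ l (by omega) ⟨hlk, by omega, e2, hbd, by omega⟩ with h | h | h | h | h | h
  · exact (mkSRG k fun x y _ h2 => common_of_multipartite hk' hl' (by omega) h2).elim
  · exact (mkSRG (2 * m) fun x y h1 h2 =>
      common_of_clique_eq hk' hl' hS hm' hm0 hs2 h.1 h.2 h1 h2).elim
  · obtain ⟨rfl, rfl, rfl⟩ := h
    exact (not_twelve_five hV hk' hl').elim
  · obtain ⟨rfl, rfl, rfl⟩ := h
    exact (mkSRG 3 fun x y h1 h2 => common_of_fifteen_six hV hk' hl' h1 h2).elim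
  · obtain ⟨rfl, rfl, rfl⟩ := h
    exact (not_fifteen_ten hV hk' hl').elim
  · exact h

/-- A strictly Neumaier graph on `16` vertices, as a Cayley graph of `ℤ/8 × ℤ/2`. -/
def cayleySixteen : SimpleGraph (Fin 8 × Fin 2) where
  Adj x y := x - y ∈ ({(0, 1), (1, 0), (2, 0), (2, 1), (3, 1), (5, 1), (6, 0), (6, 1), (7, 0)} :
    Finset (Fin 8 × Fin 2))
  symm := ⟨by decide +kernel⟩
  loopless := ⟨by decide +kernel⟩

instance : DecidableRel cayleySixteen.Adj := fun x y => by
  unfold cayleySixteen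
  infer_instance

theorem cayleySixteen_strictlyNeumaier : IsStrictlyNeumaier cayleySixteen 16 9 4 2 4 := by
  refine ⟨⟨⟨by simp, ?_, ?_, ?_⟩, ?_, by norm_num,
    {(0, 0), (0, 1), (2, 0), (2, 1)}, ?_, by decide, by norm_num, ?_⟩, ?_⟩
  · intro h
    have : cayleySixteen.Adj (0, 0) (0, 1) := by decide
    simp [h] at this
  · simp only [ncard_neighborSet_eq]
    decide +kernel
  · simp only [ncard_commonNeighbors_eq]
    decide +kernel
  · intro h
    have : ¬ cayleySixteen.Adj (0, 0) (4, 0) := by decide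
    simp [h] at this
  · rw [SimpleGraph.isClique_iff]
    simp only [Set.Pairwise, mem_coe]
    decide +kernel
  · simp only [ncard_neighborSet_inter_eq]
    decide +kernel
  · rintro ⟨v, k, l, mu, -, -, -, -, -, h⟩
    simp only [ncard_commonNeighbors_eq] at h
    have h1 := h (0, 0) (4, 0) (by decide) (by decide)
    have h2 := h (0, 0) (4, 1) (by decide) (by decide)
    have : #{x | cayleySixteen.Adj (0, 0) x ∧ cayleySixteen.Adj (4, 0) x} ≠
        #{x | cayleySixteen.Adj (0, 0) x ∧ cayleySixteen.Adj (4, 1) x} := by decide +kernel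
    exact this (h1.trans h2.symm)

/-- Every strictly Neumaier graph has at least 16 vertices; there is a strictly
Neumaier graph on exactly 16 vertices; and every strictly Neumaier graph on 16
vertices has parameters `(16, 9, 4; 2, 4)`, i.e. it is edge-regular with parameters
`(16, 9, 4)` and contains a 2-regular 4-clique. -/
theorem smallest_strictlyNeumaier :
    (∀ (V : Type) [Fintype V] (G : SimpleGraph V),
      (∃ v k lam m s : ℕ, IsStrictlyNeumaier G v k lam m s) → 16 ≤ Fintype.card V) ∧
    (∃ (V : Type) (_ : Fintype V) (G : SimpleGraph V),
      (∃ v k lam m s : ℕ, IsStrictlyNeumaier G v k lam m s) ∧ Fintype.card V = 16) ∧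
    (∀ (V : Type) [Fintype V] (G : SimpleGraph V),
      (∃ v k lam m s : ℕ, IsStrictlyNeumaier G v k lam m s) → Fintype.card V = 16 →
        IsEdgeRegular G 16 9 4 ∧
          ∃ S : Finset V, G.IsClique ↑S ∧ S.card = 4 ∧ IsRegularClique G S 2) := by
  refine ⟨?_, ⟨Fin 8 × Fin 2, inferInstance, cayleySixteen, ⟨_, _, _, _, _,
    cayleySixteen_strictlyNeumaier⟩, by simp⟩, ?_⟩
  · rintro V _ G ⟨v, k, l, m, s, h⟩
    by_contra hc
    have := strictlyNeumaier_parameters h (by omega)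
    have := h.1.1.1
    omega
  · rintro V _ G ⟨v, k, l, m, s, h⟩ hV
    obtain ⟨rfl, rfl, rfl, rfl, rfl⟩ := strictlyNeumaier_parameters h hV.le
    exact ⟨h.1.1, h.1.2.2.2⟩
end

section
/- Every strictly Neumaier graph on at most 24 vertices has parameters (16, 9, 4; 2, 4) or (24, 8, 2; 1, 4); that is, it is either edge-regular with parameters (16, 9, 4) containing a 2-regular 4-clique, or edge-regular with parameters (24, 8, 2) containing a 1-regular 4-clique. -/
namespace PackedSearch

/-- `f n`, arranged so that kernel reduction evaluates `n` before passing it to `f`. -/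
noncomputable def force {α : Type} (n : Nat) (f : Nat → α) : α :=
  Nat.rec (f 0) (fun m _ => f (Nat.succ m)) n

/-- The sums of `k` of the entries of `l`. -/
def choose : Nat → List Nat → List Nat
  | 0, [] => [0]
  | _ + 1, [] => []
  | 0, _ :: l => choose 0 l
  | k + 1, a :: l => (choose k l).map (Nat.add a) ++ choose (k + 1) l

/-- The bit representing the vertex `j` in the code of a neighbourhood. -/
def weight (j : Nat) : Nat := Nat.pow 32 j

/-- The first of the two points of the clique labelling a cell. -/
def cellX : Nat → Nat
  | 0 => 0 | 1 => 2 | 2 => 0 | 3 => 1 | 4 => 0 | _ => 1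

/-- The second of the two points of the clique labelling a cell. -/
def cellY : Nat → Nat
  | 0 => 1 | 1 => 3 | 2 => 2 | 3 => 3 | 4 => 3 | _ => 2

/-- Adjacency inside a class of type `e` of the `k`-th and `l`-th vertices of its cells, which are
the same cell or opposite ones according to `same`. -/
def ownAdj (e same : Bool) (k l : Nat) : Bool :=
  bif same then e && !(Nat.beq k 2) && !(Nat.beq l 2) && !(Nat.beq k l)
  else bif e then !(Nat.beq k 2 && Nat.beq l 2) else !(Nat.beq k l)

/-- Whether the cell `c` lies over the point `x` of the clique. -/
def incident (c x : Nat) : Bool := Nat.beq (cellX c) x || Nat.beq (cellY c) x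

/-- Whether `b` is outside the class of `i` and adjacent to the point `x` of the clique. -/
def inBlock (i x b : Nat) : Bool := !(Nat.beq (b / 6) (i / 6)) && incident (b / 3) x

/-- Adjacency of `i` and `b` as forced by the type of their class; `false` in distinct classes. -/
def ownBit (e : Bool) (i b : Nat) : Bool :=
  Nat.beq (b / 6) (i / 6) && ownAdj e (Nat.beq (i / 3) (b / 3)) (i % 3) (b % 3)

/-- The type of the `n`-th class. -/
def classType (e₁ e₂ e₃ : Bool) (n : Nat) : Bool :=
  Nat.rec e₁ (fun m _ => Nat.rec e₂ (fun _ _ => e₃) m) n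

/-- The number of neighbours of `i` in each of its blocks. -/
def blockDegree (e : Bool) (i : Nat) : Nat := bif e && !(Nat.beq (i % 3) 2) then 3 else 4

/-- The codes of the possible neighbourhoods of `i`. -/
def rows (e : Bool) (i : Nat) : List Nat :=
  (choose (blockDegree e i) (((List.range 18).filter (inBlock i (cellX (i / 3)))).map weight)).flatMap
    fun x =>
      (choose (blockDegree e i) (((List.range 18).filter (inBlock i (cellY (i / 3)))).map weight)).map
        fun y => Nat.add ((((List.range 18).filter (ownBit e i)).map weight).foldr Nat.add 0)
          (Nat.add x y)

/-- The number of common neighbours outside the clique that `i` and `j` have when adjacent. -/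
def common (i j : Nat) : Nat :=
  bif Nat.beq (i / 3) (j / 3) then 3 else bif Nat.beq (i / 6) (j / 6) then 5 else 4

/-- The values of `f` on `l`, written into consecutive lanes of 192 bits. -/
noncomputable def pack (f : Nat → Nat) (l : List Nat) : Nat :=
  List.rec 0 (fun a _ ih => Nat.add (f a) (Nat.mul (Nat.pow 2 192) ih)) l

noncomputable def filterCore (r j c R D A : Nat) : Nat :=
  cond (Nat.beq (Nat.land (Nat.shiftRight r (Nat.mul 5 j)) 1) 0) (Nat.xor D A)
    (Nat.land A (Nat.shiftRight (Nat.sub (Nat.mul A 32)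
      (Nat.xor (Nat.mul A c) (Nat.land (Nat.mul A 31)
        (Nat.shiftRight (Nat.mul (Nat.land R (Nat.mul A r))
          (Nat.div (Nat.pow 2 90) 31)) 85)))) 5))

/-- Those of the lanes of `R` selected by `D` whose entry is compatible, as the neighbourhood of
`j`, with `r` being the neighbourhood of `i`. -/
noncomputable def filter (i r j R D : Nat) : Nat :=
  filterCore r j (common i j) R D (Nat.land D (Nat.shiftRight R (Nat.mul 5 i)))

/-- `D` with some extra low bits that keep the hash values of terms apart. -/
noncomputable def withHash (D : Nat) : Nat :=
  Nat.add (Nat.mul (Nat.pow 2 64) D) (Nat.mod D 18446744073709551557)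

noncomputable def dropHash (E : Nat) : Nat := Nat.shiftRight E 64

/-- The number of selected lanes. -/
noncomputable def size (E : Nat) : Nat := Nat.mod (dropHash E) (Nat.sub (Nat.pow 2 192) 1)

noncomputable def insert (j R E n : Nat) (l : List (Nat × Nat × Nat)) : List (Nat × Nat × Nat) :=
  List.rec [(j, R, E)]
    (fun b t ih => cond (Nat.ble n (size b.2.2)) ((j, R, E) :: b :: t) (b :: ih)) l

noncomputable def insertNonzero (E j R : Nat) (o : Option (List (Nat × Nat × Nat))) :
    Option (List (Nat × Nat × Nat)) :=
  Nat.rec none (fun E' _ => Option.rec none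
    (fun l => some (insert j R (Nat.succ E') (size (Nat.succ E')) l)) o) E

/-- Filter all domains by `r` being the neighbourhood of `i`; `none` if one of them gets empty. -/
noncomputable def filterAll (i r : Nat) (l : List (Nat × Nat × Nat)) :
    Option (List (Nat × Nat × Nat)) :=
  List.rec (some []) (fun d _ ih => Prod.rec (fun j d => Prod.rec
    (fun R E => insertNonzero (withHash (filter i r j R (dropHash E))) j R ih) d) d) l

noncomputable def loop (R D : Nat) (f : Nat → Bool) (n m : Nat) : Bool :=
  Nat.rec true (fun n ih =>
    cond (cond (Nat.beq (Nat.land (Nat.shiftRight D (Nat.mul 192 (Nat.add m n))) 1) 0) true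
      (force (Nat.mod (Nat.shiftRight R (Nat.mul 192 (Nat.add m n))) (Nat.pow 2 192)) f))
       ih false) n

/-- Whether `f` holds for the entries of the selected lanes among the first `20 * n` ones. -/
noncomputable def loops (R D : Nat) (f : Nat → Bool) (n : Nat) : Bool :=
  Nat.rec true (fun n ih =>
    cond (cond (Nat.beq (Nat.mod (Nat.shiftRight D (Nat.mul 3840 n)) (Nat.pow 2 3840)) 0) true
      (force (Nat.mul 20 n) (loop R D f 20)))
       ih false) n

/-- Backtracking search; `true` means that there is no solution. -/
noncomputable def refute (n : Nat) : List (Nat × Nat × Nat) → Bool :=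
  Nat.rec (fun _ => false) (fun _ ih l => List.rec false (fun d t _ => Prod.rec (fun j d => Prod.rec
    (fun R E => loops R (dropHash E)
      (fun r => Option.rec true (fun l' => ih l') (filterAll j r t)) 20) d) d) l) n

/-- The bit of the vertex `j` in `r`. -/
def bit (r j : Nat) : Bool := !(Nat.beq (Nat.land (Nat.shiftRight r (Nat.mul 5 j)) 1) 0)

def implies (r a b : Nat) : Bool := bit r a || !(bit r b)

/-- Whether a neighbourhood meets the class of type `e` starting at `b` in a normalised way. -/
def sorted (e : Bool) (b r : Nat) : Bool :=
  bif e then implies r b (b + 1) && implies r (b + 3) (b + 4)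
  else implies r b (b + 1) && implies r (b + 1) (b + 2)

noncomputable def addDomain (e : Bool) (i : Nat) (p : Nat → Bool)
    (f : List (Nat × Nat × Nat) → Bool) (l : List (Nat × Nat × Nat)) : Bool :=
  force (pack (fun r => r) (rows e i)) fun R =>
    force (pack (fun r => cond (p r) 1 0) (rows e i)) fun D => f ((i, R, withHash D) :: l)

/-- The search for a graph with classes of the given types. -/
noncomputable def search (e₁ e₂ e₃ : Bool) : Bool :=
  List.rec (fun l => addDomain e₁ 0 (fun r => sorted e₂ 6 r && sorted e₃ 12 r) (refute 19) l)
    (fun i _ ih => addDomain (classType e₁ e₂ e₃ (i / 6)) i (fun _ => true) ih)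
    [16, 15, 13, 12, 10, 9, 7, 6, 4, 3, 1, 17, 14, 11, 8, 5, 2] []

theorem force_eq {α : Type} (n : Nat) (f : Nat → α) : force n f = f n := by
  cases n <;> rfl

/-- The number with the first `n` values of `f` in consecutive lanes of `w` bits. -/
def lanes (w : ℕ) (f : ℕ → ℕ) : ℕ → ℕ
  | 0 => 0
  | n + 1 => lanes w f n + 2 ^ (w * n) * f n

theorem lanes_lt {w : ℕ} {f : ℕ → ℕ} (hf : ∀ k, f k < 2 ^ w) (n : ℕ) :
    lanes w f n < 2 ^ (w * n) := by
  induction n with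
  | zero => simp [lanes]
  | succ n ih =>
    have h := hf n
    calc lanes w f (n + 1) < 2 ^ (w * n) + 2 ^ (w * n) * f n := by simpa [lanes] using ih
      _ = 2 ^ (w * n) * (f n + 1) := by ring
      _ ≤ 2 ^ (w * n) * 2 ^ w := Nat.mul_le_mul_left _ h
      _ = 2 ^ (w * (n + 1)) := by rw [← pow_add]; rfl

theorem testBit_lanes {w : ℕ} (hw : 0 < w) {f : ℕ → ℕ} (hf : ∀ k, f k < 2 ^ w) (n k t : ℕ)
    (ht : t < w) :
    (lanes w f n).testBit (w * k + t) = (decide (k < n) && (f k).testBit t) := by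
  induction n with
  | zero => simp [lanes]
  | succ n ih =>
    rw [lanes, add_comm, Nat.testBit_two_pow_mul_add _ (lanes_lt hf n), ih]
    rcases lt_trichotomy k n with h | rfl | h
    · have : w * k + t < w * n := by nlinarith
      simp [this, h, h.trans (Nat.lt_succ_self n)]
    · simp
    · have : ¬ w * k + t < w * n := by nlinarith
      have h2 : w ≤ w * k + t - w * n := by
        have : w * (n + 1) ≤ w * k := Nat.mul_le_mul_left _ h
        rw [mul_add] at this; omega
      rw [if_neg this, Nat.testBit_lt_two_pow ((hf n).trans_le (Nat.pow_le_pow_right (by simp) h2))]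
      simp; omega

theorem lanes_ext {w : ℕ} (hw : 0 < w) {f : ℕ → ℕ} (hf : ∀ k, f k < 2 ^ w) {n x : ℕ}
    (h : ∀ k t, t < w → x.testBit (w * k + t) = (decide (k < n) && (f k).testBit t)) :
    x = lanes w f n := by
  refine Nat.eq_of_testBit_eq fun i => ?_
  rw [← Nat.div_add_mod i w, h _ _ (Nat.mod_lt _ hw), testBit_lanes hw hf _ _ _ (Nat.mod_lt _ hw)]

theorem lanes_mul (w : ℕ) (f : ℕ → ℕ) (n c : ℕ) :
    lanes w f n * c = lanes w (fun k => f k * c) n := by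
  induction n with
  | zero => simp [lanes]
  | succ n ih => simp only [lanes, ← ih]; ring

theorem lanes_sub (w : ℕ) {f g : ℕ → ℕ} (h : ∀ k, g k ≤ f k) (n : ℕ) :
    lanes w f n - lanes w g n = lanes w (fun k => f k - g k) n := by
  suffices lanes w (fun k => f k - g k) n + lanes w g n = lanes w f n by omega
  induction n with
  | zero => simp [lanes]
  | succ n ih =>
    simp only [lanes, ← ih]
    rw [add_add_add_comm, ← mul_add, Nat.sub_add_cancel (h n)]

section
variable {w : ℕ} (hw : 0 < w) {f g : ℕ → ℕ} (hf : ∀ k, f k < 2 ^ w) (hg : ∀ k, g k < 2 ^ w)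
include hw hf hg

theorem lanes_land (n : ℕ) : lanes w f n &&& lanes w g n = lanes w (fun k => f k &&& g k) n := by
  refine lanes_ext hw (fun k => Nat.and_lt_two_pow _ (hg k)) fun k t ht => ?_
  rw [Nat.testBit_and, testBit_lanes hw hf _ _ _ ht, testBit_lanes hw hg _ _ _ ht,
    Nat.testBit_and]
  cases decide (k < n) <;> rfl

theorem lanes_xor (n : ℕ) : lanes w f n ^^^ lanes w g n = lanes w (fun k => f k ^^^ g k) n := by
  refine lanes_ext hw (fun k => Nat.xor_lt_two_pow (hf k) (hg k)) fun k t ht => ?_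
  rw [Nat.testBit_xor, testBit_lanes hw hf _ _ _ ht, testBit_lanes hw hg _ _ _ ht,
    Nat.testBit_xor]
  cases decide (k < n) <;> simp

theorem lanes_land_shiftRight {s : ℕ} (hs : ∀ k, g k < 2 ^ (w - s)) (n : ℕ) :
    lanes w g n &&& (lanes w f n >>> s) = lanes w (fun k => g k &&& (f k >>> s)) n := by
  refine lanes_ext hw (fun k => Nat.and_lt_two_pow _ ?_) fun k t ht => ?_
  · exact (Nat.shiftRight_le _ _).trans_lt (hf k)
  rw [Nat.testBit_and, testBit_lanes hw hg _ _ _ ht, Nat.testBit_and]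
  by_cases h : s + t < w
  · rw [Nat.testBit_shiftRight, Nat.testBit_shiftRight, ← add_assoc, add_comm s, add_assoc,
      testBit_lanes hw hf _ _ _ h]
    cases decide (k < n) <;> simp
  · rw [Nat.testBit_lt_two_pow ((hs k).trans_le (Nat.pow_le_pow_right (by simp) (by omega)))]
    simp

end

theorem lanes_shiftRight_mod {w : ℕ} (hw : 0 < w) {f : ℕ → ℕ} (hf : ∀ k, f k < 2 ^ w) {n k : ℕ}
    (hk : k < n) : (lanes w f n >>> (w * k)) % 2 ^ w = f k := by
  refine Nat.eq_of_testBit_eq fun t => ?_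
  rw [Nat.testBit_mod_two_pow, Nat.testBit_shiftRight]
  by_cases ht : t < w
  · rw [testBit_lanes hw hf _ _ _ ht]; simp [ht, hk]
  · rw [Nat.testBit_lt_two_pow ((hf k).trans_le (Nat.pow_le_pow_right (by simp) (not_lt.1 ht)))]
    simp [ht]

theorem pack_eq_lanes (f : ℕ → ℕ) (l : List ℕ) :
    pack f l = lanes 192 (fun k => f (l.getD k 0)) l.length := by
  have key : ∀ (g : ℕ → ℕ) n, lanes 192 g (n + 1) =
      g 0 + 2 ^ 192 * lanes 192 (fun k => g (k + 1)) n := by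
    intro g n
    induction n with
    | zero => simp [lanes]
    | succ n ih => rw [lanes, ih, lanes]; ring
  induction l with
  | nil => rfl
  | cons a l ih =>
    rw [List.length_cons, key]
    change f a + 2 ^ 192 * pack f l = _
    rw [ih]; simp

/-- The product with the repunit has the digit sum in its eighteenth digit. -/
theorem shiftRight_repunit (x : ℕ → ℕ) (hx : ∀ b, x b < 2) :
    ((lanes 5 x 18 * (2 ^ 90 / 31)) >>> 85) % 32 = ∑ b ∈ Finset.range 18, x b := by
  have hle : ∀ n, ∑ b ∈ Finset.range n, x b ≤ n := fun n => by
    simpa using Finset.sum_le_card_nsmul (Finset.range n) x 1 fun b _ => Nat.le_of_lt_succ (hx b)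
  have key : lanes 5 x 18 * (2 ^ 90 / 31) =
      lanes 5 (fun c => ∑ b ∈ Finset.range (min (c + 1) 18), x b) 17 +
        2 ^ 85 * (∑ b ∈ Finset.range 18, x b +
          32 * lanes 5 (fun c => ∑ b ∈ Finset.Ico (c + 1) 18, x b) 17) := by
    simp only [lanes, Finset.sum_range_succ, Finset.sum_range_zero, Nat.reduceAdd, Nat.min_def,
      ↓reduceIte,
      Finset.sum_Ico_succ_top, Nat.reduceLeDiff, Finset.Ico_self, Finset.sum_empty, Nat.reduceMul,
      Nat.reducePow, Nat.reduceDiv]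
    ring
  have hlow : lanes 5 (fun c => ∑ b ∈ Finset.range (min (c + 1) 18), x b) 17 < 2 ^ 85 :=
    lanes_lt (fun c => ((hle _).trans (min_le_right _ _)).trans_lt (by norm_num)) 17
  have := hle 18
  rw [key, Nat.shiftRight_eq_div_pow, Nat.add_mul_div_left _ _ (by positivity),
    Nat.div_eq_of_lt hlow]
  omega

/-- The code of a set of vertices. -/
def code (x : ℕ → Bool) : ℕ := lanes 5 (fun b => (x b).toNat) 18

theorem toNat_lt (x : Bool) {n : ℕ} (hn : n ≠ 0) : x.toNat < 2 ^ n :=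
  (Bool.toNat_lt x).trans_le (Nat.le_self_pow hn 2)

theorem code_lt (x : ℕ → Bool) : code x < 2 ^ 90 := lanes_lt (fun _ => toNat_lt _ (by simp)) 18

theorem testBit_code (x : ℕ → Bool) {j : ℕ} (hj : j < 18) : (code x).testBit (5 * j) = x j := by
  have := testBit_lanes (w := 5) (by simp) (fun k => toNat_lt (x k) (n := 5) (by simp)) 18 j 0
    (by simp)
  rw [add_zero] at this
  rw [code, this]
  cases x j <;> simp [hj]

theorem code_land (x y : ℕ → Bool) :
    code x &&& code y = lanes 5 (fun b => (x b && y b).toNat) 18 := by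
  rw [code, code, lanes_land (by simp) (fun _ => toNat_lt _ (by simp))
    (fun _ => toNat_lt _ (by simp))]
  congr 1; ext k; cases x k <;> cases y k <;> rfl

theorem land_one_shiftRight (r s : ℕ) : (r >>> s) &&& 1 = (r.testBit s).toNat := by
  rw [Nat.and_one_is_mod, Nat.toNat_testBit, Nat.shiftRight_eq_div_pow]

theorem beq_land_one (r s : ℕ) :
    Nat.beq (Nat.land (Nat.shiftRight r s) 1) 0 = !(r.testBit s) := by
  change Nat.beq ((r >>> s) &&& 1) 0 = _
  rw [land_one_shiftRight]
  cases r.testBit s <;> rfl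

/-- `D` selects, among at most 400 lanes of `R`, one containing `r`. -/
def Selects (R D r : ℕ) : Prop :=
  ∃ (n : ℕ) (f : ℕ → ℕ) (d : ℕ → Bool), n ≤ 400 ∧ (∀ k, f k < 2 ^ 90) ∧ R = lanes 192 f n ∧
    D = lanes 192 (fun k => (d k).toNat) n ∧ ∃ k < n, f k = r ∧ d k = true

/-- The adjacencies of a graph on 18 vertices as the search looks for it. -/
structure Compatible (x : ℕ → ℕ → Bool) : Prop where
  symm : ∀ i < 18, ∀ j < 18, x i j = x j i
  common : ∀ i < 18, ∀ j < 18, x i j = true →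
    ∑ b ∈ Finset.range 18, (x j b && x i b).toNat = common i j

theorem common_lt (i j : ℕ) : common i j < 32 := by
  unfold PackedSearch.common
  cases Nat.beq (i / 3) (j / 3) <;> cases Nat.beq (i / 6) (j / 6) <;> simp

theorem Selects.filter {x : ℕ → ℕ → Bool} (hx : Compatible x) {i j R D : ℕ} (hi : i < 18)
    (hj : j < 18) (h : Selects R D (code (x j))) :
    Selects R (filter i (code (x i)) j R D) (code (x j)) := by
  obtain ⟨n, f, d, hn, hf, rfl, rfl, k, hk, hfk, hdk⟩ := h
  have hpow : ∀ {a b : ℕ}, a ≤ b → ∀ {z}, z < 2 ^ a → z < 2 ^ b := fun h _ hz =>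
    hz.trans_le (Nat.pow_le_pow_right (by simp) h)
  have hf' : ∀ k, f k < 2 ^ 192 := fun k => hpow (by norm_num) (hf k)
  set a : ℕ → Bool := fun k => d k && (f k).testBit (5 * i) with ha
  have hA : lanes 192 (fun k => (d k).toNat) n &&& lanes 192 f n >>> (5 * i) =
      lanes 192 (fun k => (a k).toNat) n := by
    rw [lanes_land_shiftRight (by simp) hf']
    · congr 1; funext k
      simp only [ha]
      cases d k
      · simp
      · rw [Bool.toNat_true, Nat.land_comm, land_one_shiftRight, Bool.true_and]
    · exact fun k => toNat_lt _ (by simp)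
    · exact fun k => toNat_lt _ (by omega)
  have hak : a k = x i j := by
    simp only [ha, hdk, hfk, Bool.true_and]
    rw [testBit_code _ hi, hx.symm i hi j hj]
  unfold PackedSearch.filter
  change Selects _ (filterCore _ _ _ _ _
    (lanes 192 (fun k => (d k).toNat) n &&& lanes 192 f n >>> (5 * i))) _
  rw [hA, filterCore]
  change Selects _ (cond (Nat.beq (Nat.land (Nat.shiftRight (code (x i)) (5 * j)) 1) 0) _ _) _
  rw [beq_land_one, testBit_code _ hj]
  cases hij : x i j
  · refine ⟨n, f, fun k => d k ^^ a k, hn, hf, rfl, ?_, k, hk, hfk, by simp [hdk, hak, hij]⟩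
    change lanes _ _ _ ^^^ lanes _ _ _ = _
    rw [lanes_xor (by simp) (fun k => toNat_lt _ (by simp)) (fun k => toNat_lt _ (by simp))]
    congr 1; funext k
    dsimp only
    cases d k <;> cases a k <;> rfl
  · set r := code (x i) with hr
    set c := PackedSearch.common i j with hc
    have hc32 : c < 32 := common_lt i j
    let w : ℕ → ℕ := fun k =>
      (a k).toNat * 31 &&& (((f k &&& (a k).toNat * r) * (2 ^ 90 / 31)) >>> 85)
    let y : ℕ → ℕ := fun k => (a k).toNat * c ^^^ w k
    have hw32 : ∀ k, w k < 2 ^ 5 := fun k =>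
      (Nat.and_le_left).trans_lt (by cases a k <;> simp)
    have hc5 : ∀ k, (a k).toNat * c < 2 ^ 5 := fun k => by cases a k <;> simp [hc32]
    have hy : ∀ k, y k ≤ (a k).toNat * 32 := by
      intro k
      rcases hak' : a k with _ | _
      · simp [y, w, hak']
      · simpa using (Nat.xor_lt_two_pow (hc5 k) (hw32 k)).le
    have hland : ∀ k, f k &&& (a k).toNat * r < 2 ^ 90 := fun k =>
      Nat.and_le_left.trans_lt (hf k)
    have har : ∀ k, (a k).toNat * r < 2 ^ 192 := fun k => by
      have := code_lt (x i)
      cases a k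
      · simp
      · rw [Bool.toNat_true, one_mul]; exact hpow (by norm_num) this
    have hmul : ∀ k, (f k &&& (a k).toNat * r) * (2 ^ 90 / 31) < 2 ^ 192 := fun k => by
      have := hland k
      calc _ ≤ 2 ^ 90 * (2 ^ 90 / 31) := Nat.mul_le_mul_right _ this.le
        _ < _ := by norm_num
    refine ⟨n, f, fun k => ((a k).toNat * 32 - y k).testBit 5 && a k, hn, hf, rfl, ?_, k, hk, hfk,
      ?_⟩
    · change lanes 192 (fun k => (a k).toNat) n &&& (lanes 192 (fun k => (a k).toNat) n * 32 -
        (lanes 192 (fun k => (a k).toNat) n * c ^^^ (lanes 192 (fun k => (a k).toNat) n * 31 &&&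
          (((lanes 192 f n &&& lanes 192 (fun k => (a k).toNat) n * r) * (2 ^ 90 / 31)) >>> 85)))) >>> 5 = _
      rw [lanes_mul, lanes_mul, lanes_mul, lanes_mul, lanes_land (by simp) hf' har, lanes_mul,
        lanes_land_shiftRight (by simp) hmul, lanes_xor (by simp), lanes_sub _ hy,
        lanes_land_shiftRight (by simp)]
      · congr 1; funext k
        dsimp only
        cases a k
        · simp
        · rw [Bool.toNat_true, Nat.land_comm, land_one_shiftRight, Bool.and_true]
      · exact fun k => hpow (show 6 ≤ 192 by norm_num) ((Nat.sub_le _ _).trans_lt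
          (by cases a k <;> simp : (a k).toNat * 32 < 2 ^ 6))
      · exact fun k => toNat_lt _ (by simp)
      · exact fun k => toNat_lt _ (by simp)
      · exact fun k => hpow (show 5 ≤ 192 by norm_num) (hc5 k)
      · exact fun k => hpow (show 5 ≤ 192 by norm_num) (hw32 k)
      · exact fun k => hpow (show 5 ≤ 192 by norm_num)
          (by cases a k <;> simp : (a k).toNat * 31 < 2 ^ 5)
      · exact fun k => hpow (show 5 ≤ 192 - 85 by norm_num)
          (by cases a k <;> simp : (a k).toNat * 31 < 2 ^ 5)
    · have hwk : w k = c := by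
        simp only [w, hak, hij, hfk, Bool.toNat_true, one_mul, hr]
        rw [Nat.land_comm, code_land, Nat.and_two_pow_sub_one_eq_mod _ 5]
        rw [show (2 : ℕ) ^ 5 = 32 from rfl,
          shiftRight_repunit _ (fun b => Bool.toNat_lt _), hx.common i hi j hj hij]
      have hyk : y k = 0 := by simp [y, hwk, hak, hij]
      dsimp only
      rw [hyk, hak, hij]
      decide

theorem dropHash_withHash (D : ℕ) : dropHash (withHash D) = D := by
  change (2 ^ 64 * D + D % 18446744073709551557) >>> 64 = D
  rw [Nat.shiftRight_eq_div_pow]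
  omega

theorem Selects.testBit {R D r : ℕ} (h : Selects R D r) :
    ∃ k < 400, (R >>> (192 * k)) % 2 ^ 192 = r ∧ D.testBit (192 * k) = true := by
  obtain ⟨n, f, d, hn, hf, rfl, rfl, k, hk, rfl, hdk⟩ := h
  refine ⟨k, hk.trans_le hn, lanes_shiftRight_mod (by simp)
    (fun k => (hf k).trans_le (Nat.pow_le_pow_right (by simp) (by simp))) hk, ?_⟩
  have := testBit_lanes (w := 192) (by simp) (fun k => toNat_lt (d k) (n := 192) (by simp)) n k 0
    (by simp)
  rw [add_zero] at this
  simp [this, hk, hdk]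

/-- All domains in the list select the neighbourhoods given by `x`. -/
def Good (x : ℕ → ℕ → Bool) (l : List (ℕ × ℕ × ℕ)) : Prop :=
  ∀ d ∈ l, d.1 < 18 ∧ Selects d.2.1 (dropHash d.2.2) (code (x d.1))

theorem mem_insert {j R E n : ℕ} {l : List (ℕ × ℕ × ℕ)} {d : ℕ × ℕ × ℕ}
    (h : d ∈ insert j R E n l) : d = (j, R, E) ∨ d ∈ l := by
  induction l with
  | nil => simpa [PackedSearch.insert] using h
  | cons b t ih =>
    change d ∈ cond (Nat.ble n (size b.2.2)) ((j, R, E) :: b :: t) (b :: insert j R E n t) at h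
    cases hb : Nat.ble n (size b.2.2) <;> rw [hb] at h
    · rcases List.mem_cons.1 h with h | h
      · simp [h]
      · rcases ih h with h | h <;> simp [h]
    · simpa using h

theorem insertNonzero_some {E j R : ℕ} (hE : E ≠ 0) (l : List (ℕ × ℕ × ℕ)) :
    insertNonzero E j R (some l) = some (insert j R E (size E) l) := by
  obtain ⟨E, rfl⟩ := Nat.exists_eq_succ_of_ne_zero hE
  rfl

theorem Good.filterAll {x : ℕ → ℕ → Bool} (hx : Compatible x) {i : ℕ} (hi : i < 18)
    {l : List (ℕ × ℕ × ℕ)} (h : Good x l) :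
    ∃ l', filterAll i (code (x i)) l = some l' ∧ Good x l' := by
  induction l with
  | nil => exact ⟨[], rfl, by simp [Good]⟩
  | cons d t ih =>
    obtain ⟨j, R, E⟩ := d
    obtain ⟨t', ht', hgood⟩ := ih fun d hd => h d (List.mem_cons_of_mem _ hd)
    obtain ⟨hj, hsel⟩ := h _ List.mem_cons_self
    have hsel' := Selects.filter hx hi hj hsel
    set D := PackedSearch.filter i (code (x i)) j R (dropHash E) with hD
    have hne : withHash D ≠ 0 := by
      intro h0
      obtain ⟨k, -, -, hk⟩ := hsel'.testBit
      rw [← dropHash_withHash D, h0] at hk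
      simp [dropHash] at hk
    refine ⟨insert j R (withHash D) (size (withHash D)) t', ?_, fun d hd => ?_⟩
    · change insertNonzero (withHash D) j R (PackedSearch.filterAll i (code (x i)) t) = _
      rw [ht', insertNonzero_some hne]
    · rcases mem_insert hd with rfl | hd
      · exact ⟨hj, by rwa [dropHash_withHash]⟩
      · exact hgood d hd

theorem loop_eq_false {R D n m t : ℕ} {f : ℕ → Bool} (ht : t < n)
    (hD : D.testBit (192 * (m + t)) = true)
    (hf : f ((R >>> (192 * (m + t))) % 2 ^ 192) = false) : loop R D f n m = false := by
  induction n with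
  | zero => omega
  | succ n ih =>
    change cond (cond (Nat.beq (Nat.land (Nat.shiftRight D (192 * (m + n))) 1) 0) true
      (force ((R >>> (192 * (m + n))) % 2 ^ 192) f)) (loop R D f n m) false = false
    rw [force_eq, beq_land_one]
    rcases Nat.lt_succ_iff_lt_or_eq.1 ht with h | rfl
    · rw [ih h]; simp
    · rw [hD, hf]; rfl

set_option exponentiation.threshold 4000 in
theorem loops_eq_false {R D n k : ℕ} {f : ℕ → Bool} (hk : k < 20 * n)
    (hD : D.testBit (192 * k) = true) (hf : f ((R >>> (192 * k)) % 2 ^ 192) = false) :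
    loops R D f n = false := by
  induction n with
  | zero => omega
  | succ n ih =>
    change cond (cond (Nat.beq ((D >>> (3840 * n)) % 2 ^ 3840) 0) true
      (force (20 * n) (loop R D f 20))) (loops R D f n) false = false
    by_cases h : k < 20 * n
    · rw [ih h]; simp
    · have hk' : 20 * n + (k - 20 * n) = k := by omega
      have hne : (D >>> (3840 * n)) % 2 ^ 3840 ≠ 0 := by
        intro h0
        have := congrArg (fun z => z.testBit (192 * (k - 20 * n))) h0
        simp only [Nat.testBit_mod_two_pow, Nat.testBit_shiftRight, Nat.zero_testBit,
          Bool.and_eq_false_iff, decide_eq_false_iff_not] at this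
        rcases this with h | h
        · omega
        · rw [show 3840 * n + 192 * (k - 20 * n) = 192 * k by omega, hD] at h
          simp at h
      rw [force_eq, loop_eq_false (t := k - 20 * n) (by omega) (by rwa [hk']) (by rwa [hk'])]
      cases hb : Nat.beq ((D >>> (3840 * n)) % 2 ^ 3840) 0
      · rfl
      · exact absurd (Nat.eq_of_beq_eq_true hb) hne

theorem Good.refute {x : ℕ → ℕ → Bool} (hx : Compatible x) (n : ℕ) {l : List (ℕ × ℕ × ℕ)}
    (h : Good x l) : refute n l = false := by
  induction n generalizing l with
  | zero => rfl
  | succ n ih =>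
    match l, h with
    | [], _ => rfl
    | (j, R, E) :: t, h =>
      obtain ⟨hj, hsel⟩ := h _ List.mem_cons_self
      obtain ⟨l', hl', hgood⟩ := Good.filterAll hx hj
        (show Good x t from fun d hd => h d (List.mem_cons_of_mem _ hd))
      obtain ⟨k, hk, hR, hD⟩ := hsel.testBit
      change loops R (dropHash E) (fun r => Option.rec true (fun l' => PackedSearch.refute n l')
        (PackedSearch.filterAll j r t)) 20 = false
      refine loops_eq_false (by omega) hD ?_
      rw [hR]
      dsimp only
      rw [hl']
      exact ih hgood

/-- The adjacencies of a graph on 18 vertices, in three classes of the given types. -/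
structure Solution (e₁ e₂ e₃ : Bool) (x : ℕ → ℕ → Bool) : Prop extends Compatible x where
  own : ∀ i < 18, ∀ b < 18, b / 6 = i / 6 → x i b = ownBit (classType e₁ e₂ e₃ (i / 6)) i b
  degreeX : ∀ i < 18,
    ((List.range 18).filter (fun b => inBlock i (cellX (i / 3)) b && x i b)).length =
    blockDegree (classType e₁ e₂ e₃ (i / 6)) i
  degreeY : ∀ i < 18,
    ((List.range 18).filter (fun b => inBlock i (cellY (i / 3)) b && x i b)).length =
    blockDegree (classType e₁ e₂ e₃ (i / 6)) i
  sorted₂ : sorted e₂ 6 (code (x 0)) = true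
  sorted₃ : sorted e₃ 12 (code (x 0)) = true

theorem sum_mem_choose {s l : List ℕ} (h : s.Sublist l) : s.sum ∈ choose s.length l := by
  induction h with
  | slnil => simp [choose]
  | @cons s l a h ih =>
    cases hs : s.length with
    | zero => rw [hs] at ih; exact ih
    | succ k => rw [hs] at ih; exact List.mem_append_right _ ih
  | @cons_cons s l a h ih =>
    rw [List.length_cons, List.sum_cons]
    exact List.mem_append_left _ (List.mem_map_of_mem ih)

theorem sum_map_weight (p : ℕ → Bool) (n : ℕ) :
    (((List.range n).filter p).map weight).sum =
      ∑ b ∈ Finset.range n, bif p b then weight b else 0 := by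
  induction n with
  | zero => simp
  | succ n ih =>
    rw [List.range_succ, List.filter_append, List.map_append, List.sum_append, ih,
      Finset.sum_range_succ]
    cases h : p n <;> simp [h]

theorem code_eq_sum (x : ℕ → Bool) :
    code x = ∑ b ∈ Finset.range 18, bif x b then weight b else 0 := by
  have (n : ℕ) : lanes 5 (fun b => (x b).toNat) n =
      ∑ b ∈ Finset.range n, bif x b then weight b else 0 := by
    induction n with
    | zero => rfl
    | succ n ih =>
      rw [lanes, ih, Finset.sum_range_succ]
      have : weight n = 2 ^ (5 * n) := by rw [pow_mul]; rfl
      cases x n <;> simp [this]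
  exact this 18

theorem sum_filter_mem_choose (p q : ℕ → Bool) (n : ℕ) :
    (∑ b ∈ Finset.range n, bif p b && q b then weight b else 0) ∈
      choose ((List.range n).filter fun b => p b && q b).length
        (((List.range n).filter p).map weight) := by
  have hq : (List.range n).filter (fun b => p b && q b) = ((List.range n).filter p).filter q := by
    simp_rw [List.filter_filter, Bool.and_comm]
  have := sum_mem_choose ((List.filter_sublist (l := (List.range n).filter p) (p := q)).map weight)
  rwa [List.length_map, ← hq, sum_map_weight] at this

theorem block_partition : ∀ i < 18, ∀ b < 18, b / 6 ≠ i / 6 →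
    ((inBlock i (cellX (i / 3)) b).xor (inBlock i (cellY (i / 3)) b)) = true := by decide

theorem mem_rows {e₁ e₂ e₃ : Bool} {x : ℕ → ℕ → Bool} (hx : Solution e₁ e₂ e₃ x) {i : ℕ}
    (hi : i < 18) : code (x i) ∈ rows (classType e₁ e₂ e₃ (i / 6)) i := by
  set e := classType e₁ e₂ e₃ (i / 6) with he
  have h₁ := sum_filter_mem_choose (inBlock i (cellX (i / 3))) (x i) 18
  have h₂ := sum_filter_mem_choose (inBlock i (cellY (i / 3))) (x i) 18
  rw [hx.degreeX i hi] at h₁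
  rw [hx.degreeY i hi] at h₂
  refine List.mem_flatMap.2 ⟨_, h₁, List.mem_map.2 ⟨_, h₂, ?_⟩⟩
  change (((List.range 18).filter (ownBit e i)).map weight).sum + (_ + _) = _
  rw [sum_map_weight, code_eq_sum, ← Finset.sum_add_distrib, ← Finset.sum_add_distrib]
  refine Finset.sum_congr rfl fun b hb => ?_
  have hb := Finset.mem_range.1 hb
  by_cases h : b / 6 = i / 6
  · rw [hx.own i hi b hb h]
    simp [inBlock, h, he]
  · have := block_partition i hi b hb h
    have hown : ownBit e i b = false := by
      have : Nat.beq (b / 6) (i / 6) = false := Bool.eq_false_iff.2 fun h' =>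
        h (Nat.eq_of_beq_eq_true h')
      simp [ownBit, this]
    rw [hown]
    revert this
    cases inBlock i (cellX (i / 3)) b <;> cases inBlock i (cellY (i / 3)) b <;> simp

theorem rows_bound : ∀ e, ∀ i < 18, (rows e i).length ≤ 400 ∧ ∀ r ∈ rows e i, r < 2 ^ 90 := by
  decide +kernel

theorem Good.addDomain {x : ℕ → ℕ → Bool} {e : Bool} {i : ℕ} {p : ℕ → Bool}
    {f : List (ℕ × ℕ × ℕ) → Bool} {l : List (ℕ × ℕ × ℕ)} (hi : i < 18)
    (hrow : code (x i) ∈ rows e i) (hp : p (code (x i)) = true)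
    (hf : ∀ l, Good x l → f l = false) (hl : Good x l) : addDomain e i p f l = false := by
  rw [PackedSearch.addDomain, force_eq, force_eq]
  refine hf _ fun d hd => ?_
  rcases List.mem_cons.1 hd with rfl | hd
  · refine ⟨hi, ?_⟩
    dsimp only
    rw [dropHash_withHash, pack_eq_lanes, pack_eq_lanes]
    obtain ⟨k, hk, hrk⟩ := List.mem_iff_getElem.1 hrow
    obtain ⟨hlen, hlt⟩ := rows_bound e i hi
    have hget : (rows e i).getD k 0 = code (x i) := by simp [hk, hrk]
    refine ⟨_, _, fun k => p ((rows e i).getD k 0), hlen, fun k => ?_, rfl, ?_, k, hk, hget,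
      (congrArg p hget).trans hp⟩
    · by_cases h : k < (rows e i).length
      · have := hlt _ (List.getElem_mem h)
        simpa [h] using this
      · simp [h]
    · rfl
  · exact hl d hd

theorem Solution.search_eq_false {e₁ e₂ e₃ : Bool} {x : ℕ → ℕ → Bool}
    (hx : Solution e₁ e₂ e₃ x) : search e₁ e₂ e₃ = false := by
  unfold search
  have key : ∀ L : List ℕ, (∀ i ∈ L, i < 18) → ∀ l, Good x l → List.rec (motive := fun _ =>
      List (ℕ × ℕ × ℕ) → Bool)
      (fun l => addDomain e₁ 0 (fun r => sorted e₂ 6 r && sorted e₃ 12 r) (refute 19) l)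
      (fun i _ ih => addDomain (classType e₁ e₂ e₃ (i / 6)) i (fun _ => true) ih) L l = false := by
    intro L
    induction L with
    | nil =>
      exact fun _ l hl => Good.addDomain (by simp) (mem_rows hx (i := 0) (by simp))
        (by simp [hx.sorted₂, hx.sorted₃]) (fun l hl => Good.refute hx.toCompatible 19 hl) hl
    | cons i L ih =>
      intro h l hl
      exact Good.addDomain (h i List.mem_cons_self) (mem_rows hx (h i List.mem_cons_self)) rfl
        (ih fun j hj => h j (List.mem_cons_of_mem _ hj)) hl
  exact key [16, 15, 13, 12, 10, 9, 7, 6, 4, 3, 1, 17, 14, 11, 8, 5, 2] (by decide) []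
    (by simp [Good])

theorem sorted_code {x : ℕ → Bool} {e : Bool} {b : ℕ} (hb : b + 5 < 18)
    (h : bif e then (x (b + 1) = true → x b = true) ∧ (x (b + 4) = true → x (b + 3) = true)
      else (x (b + 1) = true → x b = true) ∧ (x (b + 2) = true → x (b + 1) = true)) :
    sorted e b (code x) = true := by
  have hbit : ∀ j < 18, bit (code x) j = x j := fun j hj => by
    change (!(Nat.beq (Nat.land (Nat.shiftRight (code x) (5 * j)) 1) 0)) = _
    rw [beq_land_one, testBit_code _ hj, Bool.not_not]
  have himp : ∀ j < 18, ∀ k < 18, (x k = true → x j = true) → implies (code x) j k = true := by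
    intro j hj k hk h
    rw [implies, hbit j hj, hbit k hk]
    revert h
    cases x j <;> cases x k <;> simp
  cases e
  · exact (Bool.and_eq_true _ _).mpr
      ⟨himp _ (by omega) _ (by omega) h.1, himp _ (by omega) _ (by omega) h.2⟩
  · exact (Bool.and_eq_true _ _).mpr
      ⟨himp _ (by omega) _ (by omega) h.1, himp _ (by omega) _ (by omega) h.2⟩

theorem search_false_false_false : search false false false = true := by decide +kernel
theorem search_false_false_true : search false false true = true := by decide +kernel
theorem search_false_true_false : search false true false = true := by decide +kernel
theorem search_false_true_true : search false true true = true := by decide +kernel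
theorem search_true_false_false : search true false false = true := by decide +kernel
theorem search_true_false_true : search true false true = true := by decide +kernel
theorem search_true_true_false : search true true false = true := by decide +kernel
theorem search_true_true_true : search true true true = true := by decide +kernel

theorem search_eq_true (e₁ e₂ e₃ : Bool) : search e₁ e₂ e₃ = true := by
  cases e₁ <;> cases e₂ <;> cases e₃
  exacts [search_false_false_false, search_false_false_true, search_false_true_false,
    search_false_true_true, search_true_false_false, search_true_false_true,
    search_true_true_false, search_true_true_true]

theorem Solution.false {e₁ e₂ e₃ : Bool} {x : ℕ → ℕ → Bool} (hx : Solution e₁ e₂ e₃ x) : False :=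
  absurd hx.search_eq_false (by simp [search_eq_true])

end PackedSearch

namespace Neumaier

open Finset

variable {V : Type*} [Fintype V] [DecidableEq V] {G : SimpleGraph V} [DecidableRel G.Adj]

section Counting

variable (G) in
theorem sum_card_neighborFinset_inter (T U : Finset V) :
    ∑ x ∈ T, #(G.neighborFinset x ∩ U) = ∑ u ∈ U, #(G.neighborFinset u ∩ T) := by
  have := sum_card_bipartiteAbove_eq_sum_card_bipartiteBelow (s := T) (t := U) G.Adj
  convert this using 3 with x hx x hx
  · ext; simp [bipartiteAbove, and_comm]
  · ext; simp [bipartiteBelow, G.adj_comm, and_comm]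

variable {k : ℕ}

theorem sum_card_inter (hdeg : ∀ u, #(G.neighborFinset u) = k) (x : V) :
    ∑ y, #(G.neighborFinset x ∩ G.neighborFinset y) = k * k := by
  have := sum_card_neighborFinset_inter G univ (G.neighborFinset x)
  simp only [inter_univ, hdeg, sum_const, smul_eq_mul] at this
  simpa only [inter_comm] using this

/-- Walks of length two starting at `x`, sorted by the distance of their end from `x`. -/
theorem sum_neighbors_add_sum_compl (hdeg : ∀ u, #(G.neighborFinset u) = k) (x : V) :
    k + ∑ y ∈ G.neighborFinset x, #(G.neighborFinset x ∩ G.neighborFinset y) +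
      ∑ y ∈ Gᶜ.neighborFinset x, #(G.neighborFinset x ∩ G.neighborFinset y) = k * k := by
  rw [← sum_card_inter hdeg x, ← sum_erase_add univ _ (mem_univ x), inter_self, hdeg,
    show univ.erase x = G.neighborFinset x ∪ Gᶜ.neighborFinset x by
      ext y; simp only [mem_erase, mem_univ, mem_union, SimpleGraph.mem_neighborFinset,
        SimpleGraph.compl_adj]; by_cases h : x = y
      · simp [h]
      · simp [h, Ne.symm h, em],
    sum_union (disjoint_left.2 fun y hy hy' => by
      rw [SimpleGraph.mem_neighborFinset] at hy hy'; exact hy'.2 hy)]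
  ring

theorem card_compl_neighborFinset (hdeg : ∀ u, #(G.neighborFinset u) = k) (x : V) :
    #(Gᶜ.neighborFinset x) + k + 1 = Fintype.card V := by
  have := G.degree_compl x
  have h := G.degree_lt_card_verts x
  rw [← SimpleGraph.card_neighborFinset_eq_degree, ← SimpleGraph.card_neighborFinset_eq_degree,
    hdeg] at this
  rw [← SimpleGraph.card_neighborFinset_eq_degree, hdeg] at h
  omega

theorem IsClique.card_sdiff {T : Finset V} (hT : G.IsClique T)
    (hdeg : ∀ u, #(G.neighborFinset u) = k) {x : V} (hx : x ∈ T) :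
    #(G.neighborFinset x \ T) + #T = k + 1 := by
  have h : G.neighborFinset x ∩ T = T.erase x := by
    ext y
    simp only [mem_inter, SimpleGraph.mem_neighborFinset, mem_erase]
    exact ⟨fun h => ⟨h.1.ne', h.2⟩, fun h => ⟨hT hx h.2 h.1.symm, h.2⟩⟩
  have h₁ := card_sdiff_add_card_inter (G.neighborFinset x) T
  have h₂ := card_erase_add_one hx
  rw [h, hdeg] at h₁
  omega

theorem IsClique.sum_card_inter {T : Finset V} (hT : G.IsClique T)
    (hdeg : ∀ u, #(G.neighborFinset u) = k) {d : ℕ} (hd : #T + d = k + 1) :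
    ∑ z ∈ Tᶜ, #(G.neighborFinset z ∩ T) = #T * d := by
  rw [← sum_card_neighborFinset_inter, sum_const_nat (m := d)]
  intro x hx
  have := IsClique.card_sdiff hT hdeg hx
  rw [sdiff_eq_inter_compl] at this
  omega

theorem card_union_neighborFinset {x y : V} (hdeg : ∀ u, #(G.neighborFinset u) = k) :
    #(G.neighborFinset x ∪ G.neighborFinset y) +
      #(G.neighborFinset x ∩ G.neighborFinset y) = 2 * k := by
  rw [card_union_add_card_inter, hdeg, hdeg, two_mul]

/-- The common non-neighbours of `x` and `y`. -/
theorem card_inter_compl (hdeg : ∀ u, #(G.neighborFinset u) = k) {x y : V} (hxy : x ≠ y) :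
    #(Gᶜ.neighborFinset x ∩ Gᶜ.neighborFinset y) + 2 * k + (if G.Adj x y then 0 else 2) =
      Fintype.card V + #(G.neighborFinset x ∩ G.neighborFinset y) := by
  have h := card_union_neighborFinset (x := x) (y := y) hdeg
  have : Gᶜ.neighborFinset x ∩ Gᶜ.neighborFinset y =
      (G.neighborFinset x ∪ G.neighborFinset y ∪ if G.Adj x y then ∅ else {x, y})ᶜ := by
    ext z
    split_ifs with hadj
    · simp only [mem_inter, SimpleGraph.mem_neighborFinset, SimpleGraph.compl_adj, mem_compl,
        mem_union, notMem_empty]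
      constructor
      · rintro ⟨⟨-, h₁⟩, -, h₂⟩; tauto
      · intro h
        refine ⟨⟨?_, by tauto⟩, ?_, by tauto⟩
        · rintro rfl; exact h (Or.inl (Or.inr hadj.symm))
        · rintro rfl; exact h (Or.inl (Or.inl hadj))
    · simp only [mem_inter, SimpleGraph.mem_neighborFinset, SimpleGraph.compl_adj, mem_compl,
        mem_union, mem_insert, mem_singleton]
      constructor
      · rintro ⟨⟨h₁, h₂⟩, h₃, h₄⟩ h; grind
      · intro h; grind
  have hd : #(G.neighborFinset x ∪ G.neighborFinset y ∪ if G.Adj x y then ∅ else {x, y}) =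
      #(G.neighborFinset x ∪ G.neighborFinset y) + (if G.Adj x y then 0 else 2) := by
    split_ifs with hadj
    · simp
    · rw [card_union_of_disjoint, card_pair hxy]
      rw [disjoint_left]
      intro z hz hz'
      have := G.adj_comm x y
      simp only [mem_union, SimpleGraph.mem_neighborFinset, mem_insert, mem_singleton] at hz hz'
      rcases hz' with rfl | rfl <;> simp_all
  have h' := card_compl_add_card
    (G.neighborFinset x ∪ G.neighborFinset y ∪ if G.Adj x y then ∅ else {x, y})
  rw [← this, hd] at h'
  omega

end Counting

section EdgeRegular

variable {k l : ℕ}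

variable (G) in
/-- Distinct non-adjacent vertices have a constant number of common neighbours. -/
def ConstMu : Prop :=
  ∃ mu, ∀ x y, x ≠ y → ¬ G.Adj x y → #(G.neighborFinset x ∩ G.neighborFinset y) = mu

theorem mem_compl_neighborFinset {x y : V} :
    y ∈ Gᶜ.neighborFinset x ↔ x ≠ y ∧ ¬ G.Adj x y := by
  rw [SimpleGraph.mem_neighborFinset, SimpleGraph.compl_adj]

theorem sum_compl (hdeg : ∀ u, #(G.neighborFinset u) = k)
    (hlam : ∀ x y, G.Adj x y → #(G.neighborFinset x ∩ G.neighborFinset y) = l) (x : V) :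
    k + k * l + ∑ y ∈ Gᶜ.neighborFinset x, #(G.neighborFinset x ∩ G.neighborFinset y) = k * k := by
  rw [← sum_neighbors_add_sum_compl hdeg x, sum_const_nat (s := G.neighborFinset x) (m := l), hdeg]
  exact fun y hy => hlam x y (by simpa using hy)

theorem constMu_of_le (hdeg : ∀ u, #(G.neighborFinset u) = k)
    (hlam : ∀ x y, G.Adj x y → #(G.neighborFinset x ∩ G.neighborFinset y) = l) {t : ℕ}
    (ht : ∀ x y, x ≠ y → ¬ G.Adj x y → t ≤ #(G.neighborFinset x ∩ G.neighborFinset y))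
    (h : k * k ≤ k + k * l + (Fintype.card V - 1 - k) * t) : ConstMu G := by
  refine ⟨t, fun x y hxy hadj => ?_⟩
  have h₁ := sum_compl hdeg hlam x
  have h₂ := card_compl_neighborFinset hdeg x
  have h₃ : ∑ y ∈ Gᶜ.neighborFinset x, t = (Fintype.card V - 1 - k) * t := by
    rw [sum_const, smul_eq_mul]; congr 1; omega
  have hle : ∀ y ∈ Gᶜ.neighborFinset x, t ≤ #(G.neighborFinset x ∩ G.neighborFinset y) := by
    intro y hy
    rw [mem_compl_neighborFinset] at hy
    exact ht x y hy.1 hy.2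
  have h₄ := (sum_eq_sum_iff_of_le hle).1 (le_antisymm (sum_le_sum hle) (by omega))
  exact (h₄ y (mem_compl_neighborFinset.2 ⟨hxy, hadj⟩)).symm

theorem two_mul_le (hdeg : ∀ u, #(G.neighborFinset u) = k)
    (hlam : ∀ x y, G.Adj x y → #(G.neighborFinset x ∩ G.neighborFinset y) = l) {x y : V}
    (hxy : G.Adj x y) : 2 * k ≤ Fintype.card V + l := by
  have := card_inter_compl hdeg hxy.ne
  rw [hlam x y hxy] at this
  omega

theorem constMu_of_two_mul_eq (hdeg : ∀ u, #(G.neighborFinset u) = k)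
    (hlam : ∀ x y, G.Adj x y → #(G.neighborFinset x ∩ G.neighborFinset y) = l)
    (h : 2 * k = Fintype.card V + l) : ConstMu G := by
  refine ⟨k, fun x z hxz hadj => ?_⟩
  rw [← hdeg x]
  congr 1
  rw [inter_eq_left]
  intro y hy
  rw [SimpleGraph.mem_neighborFinset] at hy ⊢
  by_contra hzy
  have h₁ := card_inter_compl hdeg hy.ne
  rw [hlam x y hy, if_pos hy] at h₁
  have h₂ : Gᶜ.neighborFinset x ∩ Gᶜ.neighborFinset y = ∅ := by
    rw [← card_eq_zero]; omega
  have h₃ : z ∈ Gᶜ.neighborFinset x ∩ Gᶜ.neighborFinset y := by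
    rw [mem_inter, mem_compl_neighborFinset, mem_compl_neighborFinset]
    refine ⟨⟨hxz, hadj⟩, ?_, fun h => hzy h.symm⟩
    rintro rfl
    exact hadj hy
  simp [h₂] at h₃

theorem le_of_compl (hdeg : ∀ u, #(G.neighborFinset u) = k)
    (hlam : ∀ x y, G.Adj x y → #(G.neighborFinset x ∩ G.neighborFinset y) = l) (x : V)
    {t : ℕ} (ht : t = 2 * k + 2 - Fintype.card V) :
    k + k * l + (Fintype.card V - 1 - k) * t ≤ k * k := by
  rw [← sum_compl hdeg hlam x]
  have h₂ := card_compl_neighborFinset hdeg x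
  gcongr
  rw [show Fintype.card V - 1 - k = #(Gᶜ.neighborFinset x) by omega, ← smul_eq_mul, ← sum_const]
  refine sum_le_sum fun y hy => ?_
  rw [mem_compl_neighborFinset] at hy
  have := card_inter_compl hdeg hy.1
  rw [if_neg hy.2] at this
  omega

theorem constMu_of_compl (hdeg : ∀ u, #(G.neighborFinset u) = k)
    (hlam : ∀ x y, G.Adj x y → #(G.neighborFinset x ∩ G.neighborFinset y) = l)
    {t : ℕ} (ht : t = 2 * k + 2 - Fintype.card V)
    (h : k + k * l + (Fintype.card V - 1 - k) * t = k * k) : ConstMu G := by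
  refine constMu_of_le hdeg hlam (fun x y hxy hadj => ?_) h.ge
  have := card_inter_compl hdeg hxy
  rw [if_neg hadj] at this
  omega

/-- A vertex outside a clique of the maximal size `l + 2` has at most one neighbour in it. -/
theorem card_inter_le_one
    (hlam : ∀ x y, G.Adj x y → #(G.neighborFinset x ∩ G.neighborFinset y) = l) {T : Finset V}
    (hT : G.IsClique T) (hcard : #T = l + 2) {z : V} (hz : z ∉ T) :
    #(G.neighborFinset z ∩ T) ≤ 1 := by
  rw [card_le_one]
  intro p hp q hq
  rw [mem_inter, SimpleGraph.mem_neighborFinset] at hp hq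
  by_contra hpq
  have hsub : insert z ((T.erase p).erase q) ⊆ G.neighborFinset p ∩ G.neighborFinset q := by
    intro w hw
    rw [mem_insert, mem_erase, mem_erase] at hw
    rw [mem_inter, SimpleGraph.mem_neighborFinset, SimpleGraph.mem_neighborFinset]
    rcases hw with rfl | ⟨h₁, h₂, h₃⟩
    · exact ⟨hp.1.symm, hq.1.symm⟩
    · exact ⟨hT hp.2 h₃ h₂.symm, hT hq.2 h₃ h₁.symm⟩
  have := card_le_card hsub
  rw [hlam p q (hT hp.2 hq.2 hpq), card_insert_of_notMem (by simp [hz]),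
    card_erase_of_mem (by simp [hq.2, Ne.symm hpq]), card_erase_of_mem hp.2] at this
  omega

theorem card_inter_eq_one (hdeg : ∀ u, #(G.neighborFinset u) = k)
    (hlam : ∀ x y, G.Adj x y → #(G.neighborFinset x ∩ G.neighborFinset y) = l) {T : Finset V}
    (hT : G.IsClique T) (hcard : #T = l + 2) {d : ℕ} (hd : #T + d = k + 1)
    (hv : Fintype.card V = #T * d + #T) {z : V} (hz : z ∉ T) :
    #(G.neighborFinset z ∩ T) = 1 := by
  have hle : ∀ z ∈ Tᶜ, #(G.neighborFinset z ∩ T) ≤ 1 := fun z hz =>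
    card_inter_le_one hlam hT hcard (mem_compl.1 hz)
  refine (sum_eq_sum_iff_of_le hle).1 ?_ z (mem_compl.2 hz)
  rw [IsClique.sum_card_inter hT hdeg hd, sum_const, card_compl]
  simp [hv]

/-- If every triangle of a graph with `l = 1` is 1-regular, then the graph is strongly regular. -/
theorem constMu_of_triangles (hdeg : ∀ u, #(G.neighborFinset u) = k)
    (hlam : ∀ x y, G.Adj x y → #(G.neighborFinset x ∩ G.neighborFinset y) = 1)
    (hk : 2 ≤ k) (hv : Fintype.card V + 3 = 3 * k) : ConstMu G := by
  refine ⟨k / 2, fun x y hxy hadj => ?_⟩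
  set A := G.neighborFinset x ∩ G.neighborFinset y with hA
  set B := G.neighborFinset x \ G.neighborFinset y with hB
  have hsum : #B + #A = k := (card_sdiff_add_card_inter _ _).trans (hdeg x)
  have key : ∀ a, G.Adj x a → ∃ b, G.neighborFinset x ∩ G.neighborFinset a = {b} ∧
      (b ∈ A ↔ a ∈ B) ∧ (a ∈ A ↔ b ∈ B) := by
    intro a ha
    obtain ⟨b, hb⟩ := card_eq_one.1 (hlam x a ha)
    refine ⟨b, hb, ?_⟩
    have hb' : G.Adj x b ∧ G.Adj a b := by
      have : b ∈ G.neighborFinset x ∩ G.neighborFinset a := by simp [hb]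
      simpa using this
    have h3 : #{x, a, b} = 3 := card_eq_three.2 ⟨x, a, b, ha.ne, hb'.1.ne, hb'.2.ne, rfl⟩
    have hclique : G.IsClique ({x, a, b} : Finset V) := by
      have := SimpleGraph.is3Clique_triple_iff.2 ⟨ha, hb'.1, hb'.2⟩
      exact this.isClique
    have hy : y ∉ ({x, a, b} : Finset V) := by
      simp only [mem_insert, mem_singleton]
      rintro (rfl | rfl | rfl)
      · exact hxy rfl
      · exact hadj ha
      · exact hadj hb'.1
    have h1 := card_inter_eq_one hdeg hlam hclique h3 (d := k - 2) (by omega)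
      (by rw [h3]; omega) hy
    obtain ⟨c, hc⟩ := card_eq_one.1 h1
    have hmem : ∀ z, (G.Adj y z ∧ (z = x ∨ z = a ∨ z = b)) ↔ z = c := by
      intro z
      have := congrArg (fun s => z ∈ s) hc
      simpa using this
    have hca := hmem a
    have hcb := hmem b
    have hcc := (hmem c).2 rfl
    have hyx : ¬ G.Adj y x := fun h => hadj h.symm
    have hab := hb'.2.ne
    simp only [hA, hB, mem_inter, mem_sdiff, SimpleGraph.mem_neighborFinset]
    grind
  have hcard : #A * 1 = #B * 1 := by
    refine card_mul_eq_card_mul G.Adj (fun a ha => ?_) (fun a ha => ?_)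
    · obtain ⟨b, hb, -, hiff⟩ := key a (by simpa using (mem_inter.1 ha).1)
      rw [card_eq_one]
      refine ⟨b, ?_⟩
      ext z
      have hz : z ∈ G.neighborFinset x ∩ G.neighborFinset a ↔ z = b := by simp [hb]
      rw [mem_inter, SimpleGraph.mem_neighborFinset, SimpleGraph.mem_neighborFinset] at hz
      simp only [bipartiteAbove, mem_filter, mem_singleton]
      constructor
      · rintro ⟨h₁, h₂⟩
        exact hz.1 ⟨by simpa using (mem_sdiff.1 h₁).1, h₂⟩
      · rintro rfl
        exact ⟨hiff.1 ha, (hz.2 rfl).2⟩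
    · obtain ⟨b, hb, hiff, -⟩ := key a (by simpa using (mem_sdiff.1 ha).1)
      rw [card_eq_one]
      refine ⟨b, ?_⟩
      ext z
      have hz : z ∈ G.neighborFinset x ∩ G.neighborFinset a ↔ z = b := by simp [hb]
      rw [mem_inter, SimpleGraph.mem_neighborFinset, SimpleGraph.mem_neighborFinset] at hz
      simp only [bipartiteBelow, mem_filter, mem_singleton]
      constructor
      · rintro ⟨h₁, h₂⟩
        exact hz.1 ⟨by simpa using (mem_inter.1 h₁).1, h₂.symm⟩
      · rintro rfl
        exact ⟨hiff.2 ha, (hz.2 rfl).2.symm⟩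
  omega

end EdgeRegular

/-- `S` is an `m`-regular `s`-clique of the edge-regular graph `G`. -/
structure RegularCliqueIn (G : SimpleGraph V) [DecidableRel G.Adj] (S : Finset V)
    (k l m s : ℕ) : Prop where
  deg : ∀ u, #(G.neighborFinset u) = k
  lam : ∀ x y, G.Adj x y → #(G.neighborFinset x ∩ G.neighborFinset y) = l
  clique : G.IsClique S
  card : #S = s
  reg : ∀ u ∉ S, #(G.neighborFinset u ∩ S) = m
  pos : 0 < m
  two_le : 2 ≤ s
  lt_card : k + 2 ≤ Fintype.card V

namespace RegularCliqueIn

variable {S : Finset V} {k l m s : ℕ} (h : RegularCliqueIn G S k l m s)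

include h

theorem card_sdiff {x : V} (hx : x ∈ S) : #(G.neighborFinset x \ S) + s = k + 1 := by
  rw [← h.card]; exact IsClique.card_sdiff h.clique h.deg hx

theorem exists_mem : ∃ x, x ∈ S := by
  have := h.two_le
  exact card_pos.1 (by rw [h.card]; omega)

theorem le_succ : s ≤ k + 1 := by
  obtain ⟨x, hx⟩ := h.exists_mem
  have := h.card_sdiff hx
  omega

theorem edge_count : (Fintype.card V - s) * m = s * (k + 1 - s) := by
  have := IsClique.sum_card_inter h.clique h.deg (d := k + 1 - s)
    (by rw [h.card]; have := h.le_succ; omega)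
  rw [sum_const_nat (m := m) fun z hz => h.reg z (mem_compl.1 hz), card_compl, h.card] at this
  exact this

theorem card_inter_sdiff {x y : V} (hx : x ∈ S) (hy : y ∈ S) (hxy : x ≠ y) :
    #((G.neighborFinset x ∩ G.neighborFinset y) \ S) + s = l + 2 := by
  have h₁ := card_sdiff_add_card_inter (G.neighborFinset x ∩ G.neighborFinset y) S
  have h₂ : G.neighborFinset x ∩ G.neighborFinset y ∩ S = (S.erase x).erase y := by
    ext z
    simp only [mem_inter, SimpleGraph.mem_neighborFinset, mem_erase]
    exact ⟨fun h' => ⟨h'.1.2.ne', h'.1.1.ne', h'.2⟩, fun h' =>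
      ⟨⟨h.clique hx h'.2.2 h'.2.1.symm, h.clique hy h'.2.2 h'.1.symm⟩, h'.2.2⟩⟩
  rw [h₂, h.lam x y (h.clique hx hy hxy), card_erase_of_mem (by simp [hxy.symm, hy]),
    card_erase_of_mem hx, h.card] at h₁
  have := h.two_le
  omega

theorem exists_ne (x : V) : ∃ y ∈ S, x ≠ y := by
  obtain ⟨y, hy, hyx⟩ := exists_mem_ne (by rw [h.card]; exact h.two_le) x
  exact ⟨y, hy, hyx.symm⟩

theorem le_add_two : s ≤ l + 2 := by
  obtain ⟨x, hx⟩ := h.exists_mem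
  obtain ⟨y, hy, hxy⟩ := h.exists_ne x
  have := h.card_inter_sdiff hx hy hxy
  omega

theorem pair_count : (s - 1) * (l + 2 - s) = (k + 1 - s) * (m - 1) := by
  obtain ⟨x, hx⟩ := h.exists_mem
  have h₁ := sum_card_neighborFinset_inter G (S.erase x) (G.neighborFinset x \ S)
  rw [sum_const_nat (m := l + 2 - s), sum_const_nat (m := m - 1), card_erase_of_mem hx, h.card] at h₁
  · rw [h₁]; congr 1; have := h.card_sdiff hx; omega
  · intro u hu
    rw [mem_sdiff, SimpleGraph.mem_neighborFinset] at hu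
    rw [← h.reg u hu.2, ← card_erase_of_mem (a := x) (by simp [hx, hu.1.symm])]
    congr 1; ext z; simp only [mem_inter, mem_erase]; tauto
  · intro y hy
    rw [mem_erase] at hy
    have := h.card_inter_sdiff hy.2 hx hy.1
    rw [inter_sdiff_assoc] at this
    omega

theorem exists_notMem : ∃ u, u ∉ S := by
  by_contra! hall
  have h₁ : S = univ := eq_univ_of_forall hall
  have h₂ := h.card
  rw [h₁, card_univ] at h₂
  have := h.lt_card
  have := h.le_succ
  omega

theorem exists_adj {u : V} (hu : u ∉ S) : ∃ x ∈ S, G.Adj u x := by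
  obtain ⟨x, hx⟩ := card_pos.1 (by rw [h.reg u hu]; exact h.pos)
  rw [mem_inter, SimpleGraph.mem_neighborFinset] at hx
  exact ⟨x, hx.2, hx.1⟩

theorem card_sdiff_neighborFinset {x u : V} (hxu : G.Adj x u) :
    #(G.neighborFinset x \ G.neighborFinset u) + l = k := by
  rw [← h.lam x u hxu, card_sdiff_add_card_inter, h.deg]

theorem insert_subset {x u : V} (hx : x ∈ S) (hxu : G.Adj x u) :
    insert u (S \ G.neighborFinset u) ⊆ G.neighborFinset x \ G.neighborFinset u := by
  intro z hz
  rw [mem_insert, mem_sdiff, SimpleGraph.mem_neighborFinset] at hz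
  rw [mem_sdiff, SimpleGraph.mem_neighborFinset, SimpleGraph.mem_neighborFinset]
  rcases hz with rfl | ⟨hz, hzu⟩
  · exact ⟨hxu, G.irrefl⟩
  · refine ⟨h.clique hx hz ?_, hzu⟩
    rintro rfl
    exact hzu hxu.symm

theorem card_insert {u : V} (hu : u ∉ S) :
    #(insert u (S \ G.neighborFinset u)) + m = s + 1 := by
  rw [card_insert_of_notMem (by simp [hu]), ← h.reg u hu, ← h.card,
    ← card_sdiff_add_card_inter S (G.neighborFinset u), inter_comm S]
  omega

theorem add_le : l + 1 + s ≤ k + m := by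
  obtain ⟨u, hu⟩ := h.exists_notMem
  obtain ⟨x, hx, hux⟩ := h.exists_adj hu
  have h₁ := card_le_card (h.insert_subset hx hux.symm)
  have h₂ := h.card_insert hu
  have h₃ := h.card_sdiff_neighborFinset hux.symm
  omega

/-- In the extremal case, the neighbours outside the clique of a point of the clique are
adjacent. -/
theorem adj_of_add_eq (heq : l + 1 + s = k + m) {x u w : V} (hx : x ∈ S) (hu : u ∉ S)
    (hw : w ∉ S) (hxu : G.Adj x u) (hxw : G.Adj x w) (huw : u ≠ w) : G.Adj u w := by
  have h₂ := h.card_insert hu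
  have h₃ := h.card_sdiff_neighborFinset hxu
  have h₄ := eq_of_subset_of_card_le (h.insert_subset hx hxu) (by omega)
  by_contra hadj
  have : w ∈ insert u (S \ G.neighborFinset u) := by
    rw [h₄, mem_sdiff, SimpleGraph.mem_neighborFinset, SimpleGraph.mem_neighborFinset]
    exact ⟨hxw, hadj⟩
  simp [huw.symm, hw] at this

end RegularCliqueIn

theorem parameters : ∀ v ∈ List.range 25, ∀ k ∈ List.range (v - 1), ∀ s ∈ List.range (k + 2),
    ∀ m ∈ List.range (s + 1), (v - s) * m = s * (k + 1 - s) → ∀ l ∈ List.range k,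
     (s - 1) * (l + 2 - s) = (k + 1 - s) * (m - 1) → 2 ≤ s → 0 < m →
    s ≤ l + 2 → 2 * k < v + l → l + 1 + s ≤ k + m →
    k + k * l + (v - 1 - k) * (2 * k + 2 - v) < k * k →
    (l = 1 ∧ 2 ≤ k ∧ v + 3 = 3 * k) ∨
    (v, k, l, m, s) ∈ [(16, 6, 2, 1, 4), (15, 8, 4, 2, 5), (21, 10, 5, 2, 6), (21, 12, 7, 3, 7),
      (20, 7, 2, 1, 4), (21, 15, 10, 4, 6), (15, 10, 6, 3, 5), (21, 14, 9, 4, 7),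
      (22, 12, 5, 2, 4), (16, 9, 4, 2, 4), (24, 8, 2, 1, 4)] := by
  decide +kernel

namespace RegularCliqueIn

variable {S : Finset V} {k l m s : ℕ}

theorem parameters (h : RegularCliqueIn G S k l m s) (hG : ¬ ConstMu G)
    (hv : Fintype.card V ≤ 24) : (l = 1 ∧ 2 ≤ k ∧ Fintype.card V + 3 = 3 * k) ∨
    (Fintype.card V, k, l, m, s) ∈ [(16, 6, 2, 1, 4), (15, 8, 4, 2, 5), (21, 10, 5, 2, 6),
      (21, 12, 7, 3, 7), (20, 7, 2, 1, 4), (21, 15, 10, 4, 6), (15, 10, 6, 3, 5), (21, 14, 9, 4, 7),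
      (22, 12, 5, 2, 4), (16, 9, 4, 2, 4), (24, 8, 2, 1, 4)] := by
  obtain ⟨u, hu⟩ := h.exists_notMem
  obtain ⟨x, hx, hux⟩ := h.exists_adj hu
  have hm : m ≤ s := by
    rw [← h.reg u hu, ← h.card]; exact card_le_card inter_subset_right
  have h₁ := h.lt_card
  have h₂ := h.le_succ
  have h₃ := h.add_le
  refine Neumaier.parameters _ (List.mem_range.2 (by omega)) k (List.mem_range.2 (by omega)) s
    (List.mem_range.2 (by omega)) m (List.mem_range.2 (by omega)) h.edge_count l
    (List.mem_range.2 (by omega)) h.pair_count h.two_le h.pos h.le_add_two ?_ h₃ ?_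
  · exact (two_mul_le h.deg h.lam hux).lt_of_ne fun h' => hG (constMu_of_two_mul_eq h.deg h.lam h')
  · exact (le_of_compl h.deg h.lam x rfl).lt_of_ne fun h' =>
      hG (constMu_of_compl h.deg h.lam rfl h')

/-- The cliques formed by a point of `S` and its neighbours outside `S`. -/
theorem isClique_insert (h : RegularCliqueIn G S k l m s) (heq : l + 1 + s = k + m) {x : V}
    (hx : x ∈ S) : G.IsClique (insert x (G.neighborFinset x \ S) : Finset V) := by
  intro u hu w hw huw
  simp only [coe_insert, coe_sdiff, Set.mem_insert_iff, Set.mem_sdiff, mem_coe,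
    SimpleGraph.mem_neighborFinset] at hu hw
  rcases hu with rfl | hu <;> rcases hw with rfl | hw
  · exact absurd rfl huw
  · exact hw.1
  · exact hu.1.symm
  · exact h.adj_of_add_eq heq hx hu.2 hw.2 hu.1 hw.1 huw

theorem constMu_of_grid (h : RegularCliqueIn G S 6 2 1 4) (hv : Fintype.card V = 16) :
    ConstMu G := by
  refine constMu_of_le h.deg h.lam (t := 2) (fun y z hyz hadj => ?_) (by rw [hv])
  have hcard : ∀ a ∈ S, #(insert a (G.neighborFinset a \ S)) = 4 := fun a ha => by
    have := h.card_sdiff ha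
    rw [card_insert_of_notMem (by simp)]
    omega
  have hex : ∀ y, ∃ a ∈ S, y ∈ insert a (G.neighborFinset a \ S) := by
    intro y
    by_cases hy : y ∈ S
    · exact ⟨y, hy, mem_insert_self _ _⟩
    · obtain ⟨a, ha, hya⟩ := h.exists_adj hy
      exact ⟨a, ha, by simp [hy, hya.symm]⟩
  have hdisj : ∀ p, ∀ a ∈ S, ∀ b ∈ S, p ∈ insert a (G.neighborFinset a \ S) →
      p ∈ insert b (G.neighborFinset b \ S) → a = b := by
    intro p a ha b hb hpa hpb
    simp only [mem_insert, mem_sdiff, SimpleGraph.mem_neighborFinset] at hpa hpb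
    rcases hpa with rfl | hpa <;> rcases hpb with rfl | hpb
    · rfl
    · exact absurd ha hpb.2
    · exact absurd hb hpa.2
    · have := card_le_one.1 (h.reg p hpa.2).le a (by simp [ha, hpa.1.symm]) b
        (by simp [hb, hpb.1.symm])
      exact this
  have hone : ∀ a ∈ S, ∀ z ∉ insert a (G.neighborFinset a \ S),
      ∃ p ∈ insert a (G.neighborFinset a \ S), G.Adj z p := by
    intro a ha z hz
    have h₁ := hcard a ha
    have := card_inter_eq_one h.deg h.lam (h.isClique_insert rfl ha) h₁ (d := 3) (by rw [h₁])
      (by rw [h₁, hv]) hz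
    obtain ⟨p, hp⟩ := card_pos.1 (by rw [this]; exact one_pos)
    rw [mem_inter, SimpleGraph.mem_neighborFinset] at hp
    exact ⟨p, hp.2, hp.1⟩
  obtain ⟨a, ha, hya⟩ := hex y
  obtain ⟨b, hb, hzb⟩ := hex z
  have hza : z ∉ insert a (G.neighborFinset a \ S) := fun hza =>
    hadj (h.isClique_insert rfl ha hya hza hyz)
  have hyb : y ∉ insert b (G.neighborFinset b \ S) := fun hyb =>
    hadj (h.isClique_insert rfl hb hyb hzb hyz)
  obtain ⟨p, hpa, hzp⟩ := hone a ha z hza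
  obtain ⟨q, hqb, hyq⟩ := hone b hb y hyb
  have hpq : p ≠ q := by
    rintro rfl
    exact hza (hdisj p a ha b hb hpa hqb ▸ hzb)
  have hyp : G.Adj y p := h.isClique_insert rfl ha hya hpa fun e => hadj (e ▸ hzp).symm
  have hzq : G.Adj z q := h.isClique_insert rfl hb hzb hqb fun e => hadj (e ▸ hyq)
  rw [← card_pair hpq]
  refine card_le_card fun w hw => ?_
  simp only [mem_insert, mem_singleton] at hw
  rcases hw with rfl | rfl <;> simp [*]

theorem constMu_of_triangular (h : RegularCliqueIn G S k l 2 s) (hk : k + 2 = 2 * s)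
    (hl : l + 1 = s) (hmu : k * k ≤ k + k * l + (Fintype.card V - 1 - k) * 4) : ConstMu G := by
  refine constMu_of_le h.deg h.lam (t := 4) ?_ hmu
  have hpt : ∀ a ∈ S, ∀ b ∈ S, a ≠ b → ∃ w, w ∉ S ∧ G.Adj w a ∧ G.Adj w b := by
    intro a ha b hb hab
    have := h.card_inter_sdiff ha hb hab
    obtain ⟨w, hw⟩ := (card_pos (s := (G.neighborFinset a ∩ G.neighborFinset b) \ S)).1 (by omega)
    simp only [mem_sdiff, mem_inter, SimpleGraph.mem_neighborFinset] at hw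
    exact ⟨w, hw.2, hw.1.1.symm, hw.1.2.symm⟩
  have hpair : ∀ u ∉ S, ∃ a ∈ S, ∃ b ∈ S, a ≠ b ∧ ∀ c ∈ S, G.Adj u c ↔ c = a ∨ c = b := by
    intro u hu
    obtain ⟨a, b, hab, hset⟩ := card_eq_two.1 (h.reg u hu)
    have hmem : ∀ c, (G.Adj u c ∧ c ∈ S) ↔ c = a ∨ c = b := fun c => by
      have := congrArg (c ∈ ·) hset
      simpa using this
    exact ⟨a, ((hmem a).2 (Or.inl rfl)).2, b, ((hmem b).2 (Or.inr rfl)).2, hab, fun c hc =>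
      ⟨fun hc' => (hmem c).1 ⟨hc', hc⟩, fun hc' => ((hmem c).2 hc').1⟩⟩
  have hadj : ∀ a ∈ S, ∀ u ∉ S, ∀ w ∉ S, G.Adj u a → G.Adj w a → u ≠ w → G.Adj u w :=
    fun a ha u hu w hw hua hwa => h.adj_of_add_eq (by omega) ha hu hw hua.symm hwa.symm
  have four : ∀ {A : Finset V} {a b c d : V}, a ∈ A → b ∈ A → c ∈ A → d ∈ A → a ≠ b → a ≠ c →
      a ≠ d → b ≠ c → b ≠ d → c ≠ d → 4 ≤ #A := by
    intro A a b c d ha hb hc hd hab hac had hbc hbd hcd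
    have : #{a, b, c, d} = 4 := by
      rw [card_insert_of_notMem (by simp [*]), card_insert_of_notMem (by simp [*]), card_pair hcd]
    rw [← this]
    refine card_le_card fun w hw => ?_
    simp only [mem_insert, mem_singleton] at hw
    rcases hw with rfl | rfl | rfl | rfl <;> assumption
  have hin : ∀ y ∈ S, ∀ z ∉ S, ¬ G.Adj y z → 4 ≤ #(G.neighborFinset y ∩ G.neighborFinset z) := by
    intro y hy z hz hyz
    obtain ⟨c, hc, d, hd, hcd, hzS⟩ := hpair z hz
    have hyc : y ≠ c := fun e => hyz (((hzS y hy).2 (Or.inl e)).symm)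
    have hyd : y ≠ d := fun e => hyz (((hzS y hy).2 (Or.inr e)).symm)
    have hzc := (hzS c hc).2 (Or.inl rfl)
    have hzd := (hzS d hd).2 (Or.inr rfl)
    obtain ⟨p, hp, hpy, hpc⟩ := hpt y hy c hc hyc
    obtain ⟨q, hq, hqy, hqd⟩ := hpt y hy d hd hyd
    have hpz : p ≠ z := fun e => hyz (e ▸ hpy.symm)
    have hqz : q ≠ z := fun e => hyz (e ▸ hqy.symm)
    have hpq : p ≠ q := by
      rintro rfl
      obtain ⟨a, -, b, -, -, hpS⟩ := hpair p hp
      have h₁ := (hpS y hy).1 hpy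
      have h₂ := (hpS c hc).1 hpc
      have h₃ := (hpS d hd).1 hqd
      grind
    have hzp := hadj c hc p hp z hz hpc hzc hpz
    have hzq := hadj d hd q hq z hz hqd hzd hqz
    refine four (a := c) (b := d) (c := p) (d := q) ?_ ?_ ?_ ?_ hcd (fun e => hp (e ▸ hc))
      (fun e => hq (e ▸ hc)) (fun e => hp (e ▸ hd)) (fun e => hq (e ▸ hd)) hpq
    · simp [hzc, h.clique hy hc hyc]
    · simp [hzd, h.clique hy hd hyd]
    · simp [hpy.symm, hzp.symm]
    · simp [hqy.symm, hzq.symm]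
  intro y z hyz hnadj
  by_cases hy : y ∈ S <;> by_cases hz : z ∈ S
  · exact absurd (h.clique hy hz hyz) hnadj
  · exact hin y hy z hz hnadj
  · rw [inter_comm]
    exact hin z hz y hy fun e => hnadj e.symm
  obtain ⟨a, ha, b, hb, hab, hyS⟩ := hpair y hy
  obtain ⟨c, hc, d, hd, hcd, hzS⟩ := hpair z hz
  have hya := (hyS a ha).2 (Or.inl rfl)
  have hyb := (hyS b hb).2 (Or.inr rfl)
  have hzc := (hzS c hc).2 (Or.inl rfl)
  have hzd := (hzS d hd).2 (Or.inr rfl)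
  have hne : ∀ e ∈ S, G.Adj y e → ¬ G.Adj z e := fun e he hye hze =>
    hnadj (hadj e he y hy z hz hye hze hyz)
  have key : ∀ e ∈ S, ∀ f ∈ S, G.Adj y e → G.Adj z f → ∃ w, w ∉ S ∧
      (∀ g ∈ S, G.Adj w g ↔ g = e ∨ g = f) ∧ w ∈ G.neighborFinset y ∩ G.neighborFinset z := by
    intro e he f hf hye hzf
    have hef : e ≠ f := fun h' => hne e he hye (h' ▸ hzf)
    obtain ⟨w, hw, hwe, hwf⟩ := hpt e he f hf hef
    refine ⟨w, hw, ?_, ?_⟩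
    · obtain ⟨a', ha', b', hb', hab', hwS⟩ := hpair w hw
      have h₁ := (hwS e he).1 hwe
      have h₂ := (hwS f hf).1 hwf
      intro g hg
      rw [hwS g hg]
      grind
    · have hyw : y ≠ w := fun e' => hne f hf (e' ▸ hwf) hzf
      have hzw : z ≠ w := fun e' => hne e he hye (e' ▸ hwe)
      simp [hadj e he y hy w hw hye hwe hyw, hadj f hf z hz w hw hzf hwf hzw]
  obtain ⟨w₁, -, h₁, hm₁⟩ := key a ha c hc hya hzc
  obtain ⟨w₂, -, h₂, hm₂⟩ := key a ha d hd hya hzd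
  obtain ⟨w₃, -, h₃, hm₃⟩ := key b hb c hc hyb hzc
  obtain ⟨w₄, -, h₄, hm₄⟩ := key b hb d hd hyb hzd
  have hac : a ≠ c := fun e => hne a ha hya (e ▸ hzc)
  have had : a ≠ d := fun e => hne a ha hya (e ▸ hzd)
  have hbc : b ≠ c := fun e => hne b hb hyb (e ▸ hzc)
  have hbd : b ≠ d := fun e => hne b hb hyb (e ▸ hzd)
  refine four hm₁ hm₂ hm₃ hm₄ ?_ ?_ ?_ ?_ ?_ ?_
  · rintro rfl; have := (h₁ c hc).symm.trans (h₂ c hc); grind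
  · rintro rfl; have := (h₁ a ha).symm.trans (h₃ a ha); grind
  · rintro rfl; have := (h₁ a ha).symm.trans (h₄ a ha); grind
  · rintro rfl; have := (h₂ a ha).symm.trans (h₃ a ha); grind
  · rintro rfl; have := (h₂ a ha).symm.trans (h₄ a ha); grind
  · rintro rfl; have := (h₃ c hc).symm.trans (h₄ c hc); grind

theorem not_parameters_21_12_7 (h : RegularCliqueIn G S 12 7 3 7) : False := by
  obtain ⟨u, hu⟩ := h.exists_notMem
  obtain ⟨x, y, z, hxy, hxz, hyz, hset⟩ := card_eq_three.1 (h.reg u hu)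
  have hmem : ∀ c, c = x ∨ c = y ∨ c = z → G.Adj c u ∧ c ∈ S := fun c => by
    have := congrArg (c ∈ ·) hset
    simp only [mem_inter, SimpleGraph.mem_neighborFinset, mem_insert, mem_singleton] at this
    rw [← this, G.adj_comm]
    exact id
  obtain ⟨hxu, hx⟩ := hmem x (by simp)
  obtain ⟨hyu, hy⟩ := hmem y (by simp)
  obtain ⟨hzu, hz⟩ := hmem z (by simp)
  have hsub : ∀ c ∈ S, G.Adj c u → G.neighborFinset c \ S ⊆ insert u (G.neighborFinset u \ S) := by
    intro c hc hcu w hw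
    rw [mem_sdiff, SimpleGraph.mem_neighborFinset] at hw
    by_cases hwu : w = u
    · simp [hwu]
    · have := h.adj_of_add_eq rfl hc hu hw.2 hcu hw.1 (Ne.symm hwu)
      simp [this, hw.2]
  have hcard : #(insert u (G.neighborFinset u \ S)) = 10 := by
    have h₁ := card_sdiff_add_card_inter (G.neighborFinset u) S
    rw [h.reg u hu, h.deg] at h₁
    rw [card_insert_of_notMem (by simp)]
    omega
  have h₁ := card_le_card (union_subset (union_subset (hsub x hx hxu) (hsub y hy hyu))
    (hsub z hz hzu))
  have hx' := h.card_sdiff hx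
  have hy' := h.card_sdiff hy
  have hz' := h.card_sdiff hz
  have hxy' := h.card_inter_sdiff hx hy hxy
  have hxz' := h.card_inter_sdiff hx hz hxz
  have hyz' := h.card_inter_sdiff hy hz hyz
  have e : ∀ A B : Finset V, (A ∩ B) \ S = (A \ S) ∩ (B \ S) := fun A B => by
    ext; simp only [mem_inter, mem_sdiff]; tauto
  rw [e] at hxy' hxz' hyz'
  have h₂ := card_union_add_card_inter (G.neighborFinset x \ S) (G.neighborFinset y \ S)
  have h₃ := card_union_add_card_inter (G.neighborFinset x \ S ∪ G.neighborFinset y \ S)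
    (G.neighborFinset z \ S)
  rw [union_inter_distrib_right] at h₃
  have h₄ := card_union_le (G.neighborFinset x \ S ∩ (G.neighborFinset z \ S))
    (G.neighborFinset y \ S ∩ (G.neighborFinset z \ S))
  omega

end RegularCliqueIn

section UniqueTriangles

variable {k c : ℕ}

theorem sum_inter_comm (hdeg : ∀ u, #(G.neighborFinset u) = k)
    (hc : ∀ x y, x ≠ y → ¬ G.Adj x y → #(G.neighborFinset x ∩ G.neighborFinset y) = c) {x y : V}
    (hxy : ¬ G.Adj x y) :
    ∑ w ∈ G.neighborFinset x ∩ G.neighborFinset y, #(G.neighborFinset w ∩ G.neighborFinset y) =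
      ∑ w ∈ G.neighborFinset x ∩ G.neighborFinset y, #(G.neighborFinset w ∩ G.neighborFinset x) := by
  have key : ∀ x y, ¬ G.Adj x y →
      ∑ w ∈ G.neighborFinset x, #(G.neighborFinset w ∩ G.neighborFinset y) =
      ∑ w ∈ G.neighborFinset x ∩ G.neighborFinset y, #(G.neighborFinset w ∩ G.neighborFinset y) +
        (k - #(G.neighborFinset x ∩ G.neighborFinset y)) * c := by
    intro x y hxy
    rw [← sum_inter_add_sum_sdiff _ (G.neighborFinset y)]
    congr 1
    rw [sum_const_nat (m := c)]
    · congr 1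
      have := card_sdiff_add_card_inter (G.neighborFinset x) (G.neighborFinset y)
      rw [hdeg] at this
      omega
    · intro w hw
      rw [mem_sdiff, SimpleGraph.mem_neighborFinset, SimpleGraph.mem_neighborFinset] at hw
      refine hc w y ?_ fun h => hw.2 h.symm
      rintro rfl
      exact hxy hw.1
  have h₁ := key x y hxy
  have h₂ := key y x fun h => hxy h.symm
  rw [sum_card_neighborFinset_inter] at h₁
  rw [inter_comm (G.neighborFinset y)] at h₂
  omega

/-- When the neighbourhood of every vertex contains one edge, so that every vertex lies in just one
triangle, `p` and `q` complete the triangle of `x`. -/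
theorem exists_triangle (hdeg : ∀ u, #(G.neighborFinset u) = k)
    (hc : ∀ x y, x ≠ y → ¬ G.Adj x y → #(G.neighborFinset x ∩ G.neighborFinset y) = c)
    (hv : k + 2 + (Fintype.card V - 1 - k) * c = k * k) (x : V) :
    ∃ p q, p ≠ q ∧ G.neighborFinset x ∩ G.neighborFinset p = {q} ∧
      G.neighborFinset x ∩ G.neighborFinset q = {p} ∧ G.neighborFinset p ∩ G.neighborFinset q = {x} ∧
      ∀ y, G.Adj x y → y ≠ p → y ≠ q → G.neighborFinset x ∩ G.neighborFinset y = ∅ := by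
  have hsum : ∀ x, ∑ y ∈ G.neighborFinset x, #(G.neighborFinset x ∩ G.neighborFinset y) = 2 := by
    intro x
    have h₁ := sum_neighbors_add_sum_compl hdeg x
    have h₂ := card_compl_neighborFinset hdeg x
    rw [sum_const_nat (s := Gᶜ.neighborFinset x) (m := c),
      show #(Gᶜ.neighborFinset x) = Fintype.card V - 1 - k by omega] at h₁
    · omega
    · intro y hy
      rw [mem_compl_neighborFinset] at hy
      exact hc x y hy.1 hy.2
  have hpair : ∀ x p q, p ≠ q → G.Adj x p → G.Adj x q → G.Adj p q →
      #(G.neighborFinset x ∩ G.neighborFinset p) = 1 ∧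
      #(G.neighborFinset x ∩ G.neighborFinset q) = 1 ∧
      ∀ y, G.Adj x y → y ≠ p → y ≠ q → G.neighborFinset x ∩ G.neighborFinset y = ∅ := by
    intro x p q hpq hxp hxq hadj
    have h₁ := hsum x
    rw [← add_sum_erase _ _ (show p ∈ G.neighborFinset x by simpa),
      ← add_sum_erase _ _ (show q ∈ (G.neighborFinset x).erase p by simp [hxq, hpq.symm])] at h₁
    have h₂ : 0 < #(G.neighborFinset x ∩ G.neighborFinset p) := card_pos.2 ⟨q, by simp [*]⟩
    have h₃ : 0 < #(G.neighborFinset x ∩ G.neighborFinset q) :=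
      card_pos.2 ⟨p, by simp [hxp, hadj.symm]⟩
    refine ⟨by omega, by omega, fun y hxy hyp hyq => ?_⟩
    rw [← card_eq_zero]
    exact sum_eq_zero_iff.1 (show ∑ y ∈ ((G.neighborFinset x).erase p).erase q,
      #(G.neighborFinset x ∩ G.neighborFinset y) = 0 by omega) y (by simp [*])
  obtain ⟨p, hp, hp0⟩ := exists_ne_zero_of_sum_ne_zero (by rw [hsum x]; simp :
    ∑ y ∈ G.neighborFinset x, #(G.neighborFinset x ∩ G.neighborFinset y) ≠ 0)
  obtain ⟨q, hq⟩ := card_pos.1 (Nat.pos_of_ne_zero hp0)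
  simp only [mem_inter, SimpleGraph.mem_neighborFinset] at hp hq
  have hpq := hq.2.ne
  obtain ⟨h₁, h₂, h₃⟩ := hpair x p q hpq hp hq.1 hq.2
  obtain ⟨-, h₄, -⟩ := hpair p x q hq.1.ne hp.symm hq.2 hq.1
  refine ⟨p, q, hpq, ?_, ?_, ?_, h₃⟩ <;>
    refine (eq_of_subset_of_card_le (singleton_subset_iff.2 ?_) (by simp [*])).symm
  · simp [hq]
  · simp [hp, hq.2.symm]
  · simp [hp.symm, hq.1.symm]

theorem not_unique_triangles_of_one (hdeg : ∀ u, #(G.neighborFinset u) = 4)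
    (hc : ∀ x y, x ≠ y → ¬ G.Adj x y → #(G.neighborFinset x ∩ G.neighborFinset y) = 1)
    (hv : Fintype.card V = 15) : False := by
  have htri := exists_triangle hdeg hc (by rw [hv])
  obtain ⟨x⟩ : Nonempty V := Fintype.card_pos_iff.1 (by omega)
  obtain ⟨p, q, -, -, -, -, hzero⟩ := htri x
  obtain ⟨z, hz⟩ : ∃ z, z ∈ ((G.neighborFinset x).erase p).erase q := by
    refine card_pos.1 ?_
    have h₁ := pred_card_le_card_erase (s := G.neighborFinset x) (a := p)
    have h₂ := pred_card_le_card_erase (s := (G.neighborFinset x).erase p) (a := q)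
    have := hdeg x
    omega
  simp only [mem_erase, SimpleGraph.mem_neighborFinset] at hz
  have hxz := hzero z hz.2.2 hz.2.1 hz.1
  obtain ⟨z₁, z₂, hne, h₁, h₂, -, -⟩ := htri z
  have hzz₁ : G.Adj z z₁ := by
    have : z₁ ∈ G.neighborFinset z ∩ G.neighborFinset z₂ := by simp [h₂]
    simpa using (mem_inter.1 this).1
  have hxz₁ : x ≠ z₁ := by
    rintro rfl
    rw [inter_comm, hxz] at h₁
    simp at h₁
  have hnadj : ¬ G.Adj x z₁ := fun hadj => by
    have : z₁ ∈ G.neighborFinset x ∩ G.neighborFinset z := by simp [hadj, hzz₁]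
    simp [hxz] at this
  obtain ⟨w, hw⟩ := card_eq_one.1 (hc x z₁ hxz₁ hnadj)
  have hzw : z = w := by
    have : z ∈ G.neighborFinset x ∩ G.neighborFinset z₁ := by simp [hz, hzz₁.symm]
    simpa [hw] using this
  subst hzw
  have := sum_inter_comm hdeg hc hnadj
  rw [hw, sum_singleton, sum_singleton, h₁, inter_comm, hxz] at this
  simp at this

theorem not_unique_triangles_of_two (hdeg : ∀ u, #(G.neighborFinset u) = 6)
    (hc : ∀ x y, x ≠ y → ¬ G.Adj x y → #(G.neighborFinset x ∩ G.neighborFinset y) = 2)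
    (hv : Fintype.card V = 21) : False := by
  have htri := exists_triangle hdeg hc (by rw [hv])
  -- `x` and `z` are adjacent, in distinct triangles, and `z₁` is in the triangle of `z`
  have hmatch : ∀ x z z₁, G.Adj x z → G.neighborFinset x ∩ G.neighborFinset z = ∅ →
      #(G.neighborFinset z ∩ G.neighborFinset z₁) = 1 → G.Adj z z₁ →
      ∃ w, G.Adj w z₁ ∧ G.Adj x w ∧ #(G.neighborFinset x ∩ G.neighborFinset w) = 1 := by
    intro x z z₁ hxz hempty h₁ hzz₁
    have hxz₁ : x ≠ z₁ := by
      rintro rfl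
      rw [inter_comm, hempty] at h₁
      simp at h₁
    have hnadj : ¬ G.Adj x z₁ := fun hadj => by
      have : z₁ ∈ G.neighborFinset x ∩ G.neighborFinset z := by simp [hadj, hzz₁]
      simp [hempty] at this
    have hzmem : z ∈ G.neighborFinset x ∩ G.neighborFinset z₁ := by simp [hxz, hzz₁.symm]
    have hcard := card_erase_of_mem hzmem
    rw [hc x z₁ hxz₁ hnadj] at hcard
    obtain ⟨w, hw⟩ := card_eq_one.1 hcard
    have hwmem : w ∈ (G.neighborFinset x ∩ G.neighborFinset z₁).erase z := by simp [hw]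
    simp only [mem_erase, mem_inter, SimpleGraph.mem_neighborFinset] at hwmem
    have := sum_inter_comm hdeg hc hnadj
    rw [← add_sum_erase _ _ hzmem, ← add_sum_erase _ _ hzmem, hw, sum_singleton, sum_singleton, h₁,
      inter_comm (G.neighborFinset z), hempty, card_empty, zero_add] at this
    refine ⟨w, hwmem.2.2.symm, hwmem.2.1, ?_⟩
    obtain ⟨p, q, -, hp, hq, -, hzero⟩ := htri x
    rw [inter_comm (G.neighborFinset w) (G.neighborFinset x)] at this
    by_cases hwp : w = p
    · rw [hwp, hp, card_singleton]
    by_cases hwq : w = q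
    · rw [hwq, hq, card_singleton]
    rw [hzero w hwmem.2.1 hwp hwq] at this
    simp at this
  obtain ⟨x⟩ : Nonempty V := Fintype.card_pos_iff.1 (by omega)
  obtain ⟨p, q, hpq, hp, hq, hpq', -⟩ := htri x
  have hother : ∀ a b c, b ≠ c → G.neighborFinset a ∩ G.neighborFinset b = {c} →
      G.neighborFinset a ∩ G.neighborFinset c = {b} → G.Adj a b ∧ G.Adj a c ∧
      ∀ w, G.Adj a w → w ≠ b → w ≠ c → G.neighborFinset a ∩ G.neighborFinset w = ∅ := by
    intro a b c hbc hb hc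
    have hab : G.Adj a b := by
      have : b ∈ G.neighborFinset a ∩ G.neighborFinset c := by simp [hc]
      simpa using (mem_inter.1 this).1
    have hac : G.Adj a c := by
      have : c ∈ G.neighborFinset a ∩ G.neighborFinset b := by simp [hb]
      simpa using (mem_inter.1 this).1
    obtain ⟨p, q, -, -, -, -, hzero⟩ := htri a
    have hb' : b = p ∨ b = q := by
      by_contra! h
      simp [hzero b hab h.1 h.2] at hb
    have hc' : c = p ∨ c = q := by
      by_contra! h
      simp [hzero c hac h.1 h.2] at hc
    refine ⟨hab, hac, fun w hw h₁ h₂ => hzero w hw ?_ ?_⟩ <;> grind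
  have hx := hother x p q hpq hp hq
  have hp' := hother p x q hx.2.1.ne (by rw [inter_comm, hp]) hpq'
  have hq' := hother q x p hx.1.ne (by rw [inter_comm, hq]) (by rw [inter_comm, hpq'])
  set P : Finset V := {x, p, q} with hP
  have hPcard : #P ≤ 3 := card_le_three
  have hclosed : ∀ a ∈ P, ∀ w, G.Adj a w → G.neighborFinset a ∩ G.neighborFinset w = ∅ ∨ w ∈ P := by
    intro a ha w hw
    simp only [hP, mem_insert, mem_singleton] at ha ⊢
    grind
  obtain ⟨z, hz⟩ : ∃ z, z ∉ G.neighborFinset x ∪ G.neighborFinset p ∪ G.neighborFinset q := by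
    by_contra! hall
    have h₁ := eq_univ_of_forall hall
    have h₂ := card_union_le (G.neighborFinset x ∪ G.neighborFinset p) (G.neighborFinset q)
    have h₃ := card_union_le (G.neighborFinset x) (G.neighborFinset p)
    rw [h₁, card_univ, hdeg] at h₂
    rw [hdeg, hdeg] at h₃
    omega
  simp only [mem_union, SimpleGraph.mem_neighborFinset, not_or] at hz
  have hzP : ∀ a ∈ P, ¬ G.Adj a z := by
    intro a ha
    simp only [hP, mem_insert, mem_singleton] at ha
    rcases ha with rfl | rfl | rfl
    exacts [hz.1.1, hz.1.2, hz.2]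
  obtain ⟨z₁, z₂, hne, h₁, h₂, h₁₂, -⟩ := htri z
  obtain ⟨hz₁, hz₂, -⟩ := hother z z₁ z₂ hne h₁ h₂
  have hfar : ∀ z₁, #(G.neighborFinset z ∩ G.neighborFinset z₁) = 1 → G.Adj z z₁ →
      ∀ a ∈ P, ¬ G.Adj a z₁ := by
    intro z₁ h₁ hzz₁ a ha hadj
    rcases hclosed a ha z₁ hadj with h | h
    · obtain ⟨w, hw₁, hw₂, hw₃⟩ := hmatch a z₁ z hadj h (by rwa [inter_comm]) hzz₁.symm
      rcases hclosed a ha w hw₂ with h | h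
      · simp [h] at hw₃
      · exact hzP w h hw₁
    · exact hzP z₁ h hzz₁.symm
  have hfar₁ := hfar z₁ (by rw [h₁, card_singleton]) hz₁
  have hfar₂ := hfar z₂ (by rw [h₂, card_singleton]) hz₂
  have hxP : x ∈ P := by simp [hP]
  have hcount : ∀ w, G.Adj z w → (∀ a ∈ P, ¬ G.Adj a w) →
      #(G.neighborFinset x ∩ G.neighborFinset w) = 2 := by
    intro w hw hfar
    refine hc x w ?_ (hfar x hxP)
    rintro rfl
    exact hzP x hxP hw.symm
  have hsub : G.neighborFinset x ∩ G.neighborFinset z ∪ G.neighborFinset x ∩ G.neighborFinset z₁ ∪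
      G.neighborFinset x ∩ G.neighborFinset z₂ ⊆ ((G.neighborFinset x).erase p).erase q := by
    intro y hy
    have hpP : p ∈ P := by simp [hP]
    have hqP : q ∈ P := by simp [hP]
    simp only [mem_union, mem_inter, mem_erase, SimpleGraph.mem_neighborFinset] at hy ⊢
    grind [G.adj_comm]
  have hle := card_le_card hsub
  have hxz : x ≠ z := by
    rintro rfl
    exact hfar₁ x hxP hz₁
  have hdisj : ∀ a b c, G.neighborFinset a ∩ G.neighborFinset b = {c} → ¬ G.Adj x c →
      Disjoint (G.neighborFinset x ∩ G.neighborFinset a)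
        (G.neighborFinset x ∩ G.neighborFinset b) := by
    intro a b c hab hxc
    rw [disjoint_left]
    intro y hya hyb
    rw [mem_inter] at hya hyb
    have : y ∈ G.neighborFinset a ∩ G.neighborFinset b := mem_inter.2 ⟨hya.2, hyb.2⟩
    rw [hab, mem_singleton] at this
    subst this
    exact hxc (by simpa using hya.1)
  rw [card_union_of_disjoint (disjoint_union_left.2 ⟨hdisj z z₂ z₁ h₂ (hfar₁ x hxP),
      hdisj z₁ z₂ z h₁₂ hz.1.1⟩), card_union_of_disjoint (hdisj z z₁ z₂ h₁ (hfar₂ x hxP)),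
    hcount z₁ hz₁ hfar₁, hcount z₂ hz₂ hfar₂, hc x z hxz hz.1.1, card_erase_of_mem (by
      simp [hx.2.1, hpq.symm]), card_erase_of_mem (by simp [hx.1]), hdeg] at hle
  omega

end UniqueTriangles

section Exceptional

variable {k l : ℕ}

theorem card_compl_inter (hdeg : ∀ u, #(G.neighborFinset u) = k)
    (hlam : ∀ x y, G.Adj x y → #(G.neighborFinset x ∩ G.neighborFinset y) = l) {c : ℕ}
    (hc : c + 2 * k = Fintype.card V + l) {x y : V} (hxy : x ≠ y) (hadj : ¬ Gᶜ.Adj x y) :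
    #(Gᶜ.neighborFinset x ∩ Gᶜ.neighborFinset y) = c := by
  have h : G.Adj x y := by simpa [hxy] using hadj
  have := card_inter_compl hdeg hxy
  rw [if_pos h, hlam x y h] at this
  omega

theorem not_parameters_15_10_6 (hdeg : ∀ u, #(G.neighborFinset u) = 10)
    (hlam : ∀ x y, G.Adj x y → #(G.neighborFinset x ∩ G.neighborFinset y) = 6)
    (hv : Fintype.card V = 15) : False := by
  refine not_unique_triangles_of_one (G := Gᶜ) (fun u => ?_)
    (fun x y => card_compl_inter hdeg hlam (by omega)) hv
  have := card_compl_neighborFinset hdeg u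
  omega

theorem not_parameters_21_14_9 (hdeg : ∀ u, #(G.neighborFinset u) = 14)
    (hlam : ∀ x y, G.Adj x y → #(G.neighborFinset x ∩ G.neighborFinset y) = 9)
    (hv : Fintype.card V = 21) : False := by
  refine not_unique_triangles_of_two (G := Gᶜ) (fun u => ?_)
    (fun x y => card_compl_inter hdeg hlam (by omega)) hv
  have := card_compl_neighborFinset hdeg u
  omega

omit [DecidableEq V] in
/-- A form of the handshaking lemma. -/
theorem even_card_mul (hdeg : ∀ u, #(G.neighborFinset u) = k) : Even (Fintype.card V * k) := by
  have := G.sum_degrees_eq_twice_card_edges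
  simp only [← SimpleGraph.card_neighborFinset_eq_degree, hdeg, sum_const, card_univ,
    smul_eq_mul] at this
  exact this ▸ even_two_mul _

/-- Every triangle of an edge-regular graph can be ordered in six ways. -/
theorem three_dvd_card_mul (hdeg : ∀ u, #(G.neighborFinset u) = k)
    (hlam : ∀ x y, G.Adj x y → #(G.neighborFinset x ∩ G.neighborFinset y) = l) :
    3 ∣ Fintype.card V * (k * l) := by
  let T := (v : V) × (e : G.neighborFinset v) ×
    (G.neighborFinset v ∩ G.neighborFinset e.1 : Finset V)
  have hT : Fintype.card T = Fintype.card V * (k * l) := by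
    have : ∀ v, ∀ e ∈ G.neighborFinset v, #(G.neighborFinset v ∩ G.neighborFinset e) = l :=
      fun v e he => hlam v e (by simpa using he)
    simp only [T, Fintype.card_sigma, Fintype.card_coe]
    rw [sum_const_nat (m := k * l) fun v _ => ?_, card_univ]
    rw [sum_coe_sort (G.neighborFinset v) fun e => #(G.neighborFinset v ∩ G.neighborFinset e),
      sum_const_nat (this v), hdeg]
  have hmem : ∀ t : T, G.Adj t.1 t.2.1 ∧ G.Adj t.1 t.2.2 ∧ G.Adj t.2.1.1 t.2.2.1 := by
    rintro ⟨v, ⟨e, he⟩, ⟨w, hw⟩⟩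
    simpa using And.intro he hw
  let f : Function.End T := fun t => ⟨t.2.1, ⟨t.2.2, by simp [hmem]⟩, ⟨t.1, by
    simp [(hmem t).1.symm, (hmem t).2.1.symm]⟩⟩
  have hf : f ^ 3 ^ 1 = 1 := rfl
  have : Fact (Nat.Prime 3) := ⟨Nat.prime_three⟩
  have hmod := Equiv.Perm.card_fixedPoints_modEq hf
  have hempty : IsEmpty f.fixedPoints := ⟨fun ⟨t, ht⟩ =>
    (hmem t).1.ne (congrArg Sigma.fst ht).symm⟩
  have hzero : Fintype.card f.fixedPoints = 0 := Fintype.card_eq_zero_iff.2 hempty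
  rwa [hzero, hT, Nat.modEq_zero_iff_dvd] at hmod

end Exceptional

section Classes

open PackedSearch (ownAdj)

variable (G) in
/-- A labelling of two disjoint sets of three vertices in which the adjacencies follow `ownAdj`, and
which moves neighbours of `v` to the front as far as possible. -/
structure ClassLabelling (v : V) (P Q : Finset V) (e : Bool) (p q : Fin 3 → V) : Prop where
  injective_left : p.Injective
  injective_right : q.Injective
  mem_left : ∀ k, p k ∈ P
  mem_right : ∀ k, q k ∈ Q
  adj_left : ∀ k l, G.Adj (p k) (p l) ↔ ownAdj e true k l = true
  adj_right : ∀ k l, G.Adj (q k) (q l) ↔ ownAdj e true k l = true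
  adj_cross : ∀ k l, G.Adj (p k) (q l) ↔ ownAdj e false k l = true
  sorted : bif e then (G.Adj v (p 1) → G.Adj v (p 0)) ∧ (G.Adj v (q 1) → G.Adj v (q 0))
    else (G.Adj v (p 1) → G.Adj v (p 0)) ∧ (G.Adj v (p 2) → G.Adj v (p 1))

theorem beq_eq_decide (a b : ℕ) : Nat.beq a b = decide (a = b) := by
  rw [Bool.eq_iff_iff, decide_eq_true_iff, Nat.beq_eq]

variable {P Q : Finset V}

theorem card_inter_le_one_of_card (hQ : #Q = 3)
    (hPQ : ∀ u ∈ P, #(G.neighborFinset u ∩ Q) = 2 + #(G.neighborFinset u ∩ P)) {u : V}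
    (hu : u ∈ P) : #(G.neighborFinset u ∩ P) ≤ 1 := by
  have h₁ := hPQ u hu
  have h₂ := card_le_card (inter_subset_right : G.neighborFinset u ∩ Q ⊆ Q)
  omega

theorem adj_of_edge (hQ : #Q = 3)
    (hPQ : ∀ u ∈ P, #(G.neighborFinset u ∩ Q) = 2 + #(G.neighborFinset u ∩ P)) {u w : V}
    (hu : u ∈ P) (hw : w ∈ P) (huw : G.Adj u w) : (∀ z ∈ Q, G.Adj u z) ∧
      ∀ z ∈ P, z ≠ w → ¬ G.Adj u z := by
  have h₁ := card_inter_le_one_of_card hQ hPQ hu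
  have hw' : w ∈ G.neighborFinset u ∩ P := by simp [huw, hw]
  have h₂ : 0 < #(G.neighborFinset u ∩ P) := card_pos.2 ⟨w, hw'⟩
  constructor
  · intro z hz
    have h₃ := eq_of_subset_of_card_le (inter_subset_right : G.neighborFinset u ∩ Q ⊆ Q)
      (by have := hPQ u hu; omega)
    rw [← h₃] at hz
    simpa using (mem_inter.1 hz).1
  · intro z hz hzw huz
    exact hzw (card_le_one.1 h₁ z (by simp [huz, hz]) w hw')

omit [Fintype V] in
theorem exists_third (hP : #P = 3) {u w : V} (hu : u ∈ P) (hw : w ∈ P) (huw : u ≠ w) :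
    ∃ z ∈ P, z ≠ u ∧ z ≠ w ∧ ∀ y ∈ P, y = u ∨ y = w ∨ y = z := by
  obtain ⟨z, hz⟩ := card_eq_one.1 (show #((P.erase u).erase w) = 1 by
    rw [card_erase_of_mem (by simp [hw, huw.symm]), card_erase_of_mem hu, hP])
  have hmem : ∀ y, y ≠ w ∧ y ≠ u ∧ y ∈ P ↔ y = z := fun y => by
    simpa using congrArg (y ∈ ·) hz
  refine ⟨z, ?_⟩
  grind

theorem exists_classLabelling_of_edge (hP : #P = 3) (hQ : #Q = 3)
    (hPQ : ∀ u ∈ P, #(G.neighborFinset u ∩ Q) = 2 + #(G.neighborFinset u ∩ P))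
    (hQP : ∀ u ∈ Q, #(G.neighborFinset u ∩ P) = 2 + #(G.neighborFinset u ∩ Q)) (v : V)
    {u w : V} (hu : u ∈ P) (hw : w ∈ P) (huw : G.Adj u w) :
    ∃ p q, ClassLabelling G v P Q true p q := by
  wlog hv : G.Adj v w → G.Adj v u generalizing u w
  · exact this hw hu huw.symm fun _ => by by_contra h; exact hv fun h' => (h ‹_›).elim
  obtain ⟨z, hz, hzu, hzw, hPmem⟩ := exists_third hP hu hw huw.ne
  obtain ⟨huQ, huP⟩ := adj_of_edge hQ hPQ hu hw huw
  obtain ⟨hwQ, hwP⟩ := adj_of_edge hQ hPQ hw hu huw.symm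
  have hzP : G.neighborFinset z ∩ P = ∅ := by
    ext y
    simp only [mem_inter, SimpleGraph.mem_neighborFinset, notMem_empty, iff_false]
    rintro ⟨h₁, h₂⟩
    rcases hPmem y h₂ with rfl | rfl | rfl
    · exact huP z hz hzw h₁.symm
    · exact hwP z hz hzu h₁.symm
    · exact h₁.ne rfl
  obtain ⟨r, hr⟩ := card_eq_one.1 (show #(Q \ G.neighborFinset z) = 1 by
    have h₁ := hPQ z hz
    have h₂ := card_sdiff_add_card_inter Q (G.neighborFinset z)
    rw [hzP, inter_comm, card_empty] at h₁
    omega)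
  have hrmem : ∀ y, y ∈ Q ∧ ¬ G.Adj z y ↔ y = r := fun y => by
    simpa using congrArg (y ∈ ·) hr
  obtain ⟨hrQ, hzr⟩ := (hrmem r).2 rfl
  have hcase : ∀ y ∈ Q, G.Adj z y ↔ #(G.neighborFinset y ∩ Q) = 1 := by
    intro y hy
    have h₁ := hQP y hy
    have h₂ := card_inter_le_one_of_card hP hQP hy
    constructor
    · intro hzy
      have h₃ : P ⊆ G.neighborFinset y ∩ P := by
        intro t ht
        rw [mem_inter, SimpleGraph.mem_neighborFinset]
        refine ⟨?_, ht⟩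
        rcases hPmem t ht with rfl | rfl | rfl
        exacts [(huQ y hy).symm, (hwQ y hy).symm, hzy.symm]
      have := card_le_card h₃
      omega
    · intro h₃
      have h₄ := eq_of_subset_of_card_le (inter_subset_right : G.neighborFinset y ∩ P ⊆ P)
        (by omega)
      rw [← h₄] at hz
      simpa [G.adj_comm] using (mem_inter.1 hz).1
  obtain ⟨a, ha, har⟩ := exists_mem_ne (by omega : 1 < #Q) r
  obtain ⟨b, hb⟩ := card_eq_one.1 ((hcase a ha).1 (by by_contra h; exact har ((hrmem a).1 ⟨ha, h⟩)))
  have hb' : G.Adj a b ∧ b ∈ Q := by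
    have : b ∈ G.neighborFinset a ∩ Q := by simp [hb]
    simpa using this
  have hrN : ∀ y ∈ Q, ¬ G.Adj r y := by
    intro y hy hry
    have h₁ := card_inter_le_one_of_card hP hQP hrQ
    have h₂ : 0 < #(G.neighborFinset r ∩ Q) := card_pos.2 ⟨y, by simp [hry, hy]⟩
    exact hzr ((hcase r hrQ).2 (by omega))
  have hbr : b ≠ r := by
    rintro rfl
    exact hrN a ha hb'.1.symm
  obtain ⟨a, b, ha, hb, hab, har, hbr, hvab⟩ : ∃ a b, a ∈ Q ∧ b ∈ Q ∧ G.Adj a b ∧ a ≠ r ∧ b ≠ r ∧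
      (G.Adj v b → G.Adj v a) := by
    by_cases h : G.Adj v b → G.Adj v a
    · exact ⟨a, b, ha, hb'.2, hb'.1, har, hbr, h⟩
    · exact ⟨b, a, hb'.2, ha, hb'.1.symm, hbr, har, fun _ => by tauto⟩
  have hza : G.Adj z a := by by_contra h; exact har ((hrmem a).1 ⟨ha, h⟩)
  have hzb : G.Adj z b := by by_contra h; exact hbr ((hrmem b).1 ⟨hb, h⟩)
  have hra := hrN a ha
  have hrb := hrN b hb
  have hzu' := huP z hz hzw
  have hzw' := hwP z hz hzu
  refine ⟨![u, w, z], ![a, b, r], ?_, ?_, ?_, ?_, ?_, ?_, ?_, ?_⟩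
  · intro k l
    fin_cases k <;> fin_cases l <;> simp [huw.ne, huw.ne', hzu, hzw, hzu.symm, hzw.symm]
  · intro k l
    fin_cases k <;> fin_cases l <;> simp [hab.ne, hab.ne', har, hbr, har.symm, hbr.symm]
  · intro k; fin_cases k <;> simp [hu, hw, hz]
  · intro k; fin_cases k <;> simp [ha, hb, hrQ]
  · intro k l
    fin_cases k <;> fin_cases l <;> simp [ownAdj, beq_eq_decide, huw, huw.symm,
      hzu', hzw', G.adj_comm z]
  · intro k l
    fin_cases k <;> fin_cases l <;> simp [ownAdj, beq_eq_decide, hab, hab.symm,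
      hra, hrb, G.adj_comm _ r]
  · intro k l
    fin_cases k <;> fin_cases l <;> simp [ownAdj, beq_eq_decide, huQ, hwQ,
      ha, hb, hrQ, hza, hzb, hzr]
  · exact ⟨hv, hvab⟩

theorem exists_classLabelling (hP : #P = 3) (hQ : #Q = 3)
    (hPQ : ∀ u ∈ P, #(G.neighborFinset u ∩ Q) = 2 + #(G.neighborFinset u ∩ P))
    (hQP : ∀ u ∈ Q, #(G.neighborFinset u ∩ P) = 2 + #(G.neighborFinset u ∩ Q)) (v : V) :
    ∃ e p q, ClassLabelling G v P Q e p q := by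
  by_cases hE : ∃ u ∈ P, ∃ w ∈ P, G.Adj u w
  · obtain ⟨u, hu, w, hw, huw⟩ := hE
    exact ⟨true, exists_classLabelling_of_edge hP hQ hPQ hQP v hu hw huw⟩
  push Not at hE
  have hE' : ∀ u ∈ Q, ∀ w ∈ Q, ¬ G.Adj u w := by
    intro u hu w hw huw
    obtain ⟨p, q, h⟩ := exists_classLabelling_of_edge hQ hP hQP hPQ v hu hw huw
    exact hE (q 0) (h.mem_right 0) (q 1) (h.mem_right 1) ((h.adj_right 0 1).2 rfl)
  have hone : ∀ {P Q : Finset V}, #Q = 3 →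
      (∀ u ∈ P, #(G.neighborFinset u ∩ Q) = 2 + #(G.neighborFinset u ∩ P)) →
      (∀ u ∈ P, ∀ w ∈ P, ¬ G.Adj u w) → ∀ u ∈ P, #(Q \ G.neighborFinset u) = 1 := by
    intro P Q hQ hPQ hE u hu
    have h₁ := hPQ u hu
    have h₂ := card_sdiff_add_card_inter Q (G.neighborFinset u)
    have h₃ : G.neighborFinset u ∩ P = ∅ := by
      ext y
      simpa using fun h h' => hE u hu y h' h
    rw [h₃, card_empty, inter_comm] at h₁
    omega
  obtain ⟨e⟩ : Nonempty (Fin 3 ≃ P) := ⟨(P.equivFinOfCardEq hP).symm⟩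
  obtain ⟨σ, hσ⟩ : ∃ σ : Equiv.Perm (Fin 3), (G.Adj v (e (σ 1)) → G.Adj v (e (σ 0))) ∧
      (G.Adj v (e (σ 2)) → G.Adj v (e (σ 1))) := by
    have : ∀ T : Fin 3 → Bool, ∃ σ : Equiv.Perm (Fin 3), (T (σ 1) = true → T (σ 0) = true) ∧
        (T (σ 2) = true → T (σ 1) = true) := by decide
    simpa using this fun k => decide (G.Adj v (e k))
  have hq := fun k => card_eq_one.1 (hone hQ hPQ hE (e (σ k)) (e (σ k)).2)
  choose q hq using hq
  have hqmem : ∀ k y, y ∈ Q ∧ ¬ G.Adj (e (σ k)) y ↔ y = q k := fun k y => by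
    simpa using congrArg (y ∈ ·) (hq k)
  have hqQ := fun k => (hqmem k (q k)).2 rfl
  have hqinj : q.Injective := by
    intro k l hkl
    have h₁ := card_le_one.1 (hone hP hQP hE' (q k) (hqQ k).1).le (e (σ k))
      (by simpa [G.adj_comm] using (hqQ k).2) (e (σ l))
      (by simpa [G.adj_comm, hkl] using (hqQ l).2)
    simpa using h₁
  refine ⟨false, fun k => e (σ k), q, ?_, hqinj, ?_, fun k => (hqQ k).1, ?_, ?_, ?_, hσ⟩
  · intro k l hkl
    simpa using hkl
  · simp
  · intro k l
    simp [ownAdj, beq_eq_decide, hE]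
  · intro k l
    simp [ownAdj, beq_eq_decide, hE' _ (hqQ k).1 _ (hqQ l).1]
  · intro k l
    have h₁ := hqmem k (q l)
    rw [hqinj.eq_iff] at h₁
    simp only [ownAdj, cond_false, Bool.not_eq_true', beq_eq_decide, decide_eq_false_iff_not]
    have := (hqQ l).1
    rw [Fin.val_inj]
    tauto

end Classes

section Reduction

open PackedSearch (cellX cellY ownAdj ownBit)

variable {S : Finset V}

theorem RegularCliqueIn.inter_eq_pair {k l s : ℕ} (h : RegularCliqueIn G S k l 2 s) {u a b : V}
    (hu : u ∉ S) (ha : a ∈ S) (hb : b ∈ S) (hab : a ≠ b) (hua : G.Adj a u) (hub : G.Adj b u) :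
    G.neighborFinset u ∩ S = {a, b} := by
  refine (eq_of_subset_of_card_le (fun y hy => ?_) ?_).symm
  · rw [mem_insert, mem_singleton] at hy
    rcases hy with rfl | rfl
    · simp [ha, hua.symm]
    · simp [hb, hub.symm]
  · rw [h.reg u hu, card_pair hab]

variable (h : RegularCliqueIn G S 12 5 2 4)

include h

theorem card_common_sdiff {u a : V} (hu : u ∉ S) (ha : a ∈ S) (hua : G.Adj a u) :
    #((G.neighborFinset u ∩ G.neighborFinset a) \ S) = 4 := by
  have h₁ := card_sdiff_add_card_inter (G.neighborFinset u ∩ G.neighborFinset a) S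
  have h₂ : G.neighborFinset u ∩ G.neighborFinset a ∩ S = (G.neighborFinset u ∩ S).erase a := by
    ext y
    simp only [mem_inter, mem_erase, SimpleGraph.mem_neighborFinset]
    exact ⟨fun hy => ⟨hy.1.2.ne', hy.1.1, hy.2⟩,
      fun hy => ⟨⟨hy.2.1, h.clique ha hy.2.2 hy.1.symm⟩, hy.2.2⟩⟩
  rw [h₂, card_erase_of_mem (by simp [hua.symm, ha]), h.reg u hu, h.lam u a hua.symm] at h₁
  omega

theorem card_opposite {u a b : V} (hu : u ∉ S) (ha : a ∈ S) (hb : b ∈ S)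
    (hua : G.Adj a u) (hub : G.Adj b u) :
    #(G.neighborFinset u ∩ ((Sᶜ \ G.neighborFinset a) \ G.neighborFinset b)) =
      2 + #(G.neighborFinset u ∩ ((G.neighborFinset a ∩ G.neighborFinset b) \ S)) := by
  have h₁ := card_sdiff_add_card_inter (G.neighborFinset u) S
  rw [h.reg u hu, h.deg] at h₁
  have h₂ := card_sdiff_add_card_inter (G.neighborFinset u \ S)
    (G.neighborFinset a ∪ G.neighborFinset b)
  have h₃ := card_union_add_card_inter ((G.neighborFinset u ∩ G.neighborFinset a) \ S)
    ((G.neighborFinset u ∩ G.neighborFinset b) \ S)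
  rw [card_common_sdiff h hu ha hua, card_common_sdiff h hu hb hub] at h₃
  have h₄ : (G.neighborFinset u ∩ G.neighborFinset a) \ S ∪
      (G.neighborFinset u ∩ G.neighborFinset b) \ S =
      (G.neighborFinset u \ S) ∩ (G.neighborFinset a ∪ G.neighborFinset b) := by
    ext y; simp only [mem_union, mem_sdiff, mem_inter]; tauto
  have h₅ : (G.neighborFinset u ∩ G.neighborFinset a) \ S ∩
      ((G.neighborFinset u ∩ G.neighborFinset b) \ S) =
      G.neighborFinset u ∩ ((G.neighborFinset a ∩ G.neighborFinset b) \ S) := by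
    ext y; simp only [mem_sdiff, mem_inter]; tauto
  have h₆ : (G.neighborFinset u \ S) \ (G.neighborFinset a ∪ G.neighborFinset b) =
      G.neighborFinset u ∩ ((Sᶜ \ G.neighborFinset a) \ G.neighborFinset b) := by
    ext y; simp only [mem_union, mem_sdiff, mem_inter, mem_compl]; tauto
  rw [h₄, h₅] at h₃
  rw [h₆] at h₂
  omega

omit h

theorem cell_lt : ∀ X < 6, cellX X < 4 ∧ cellY X < 4 ∧ cellX X ≠ cellY X := by decide

variable (G S) in
/-- The vertices outside `S` over the points of `S` labelling the cell `X`. -/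
def cell (c : ℕ → V) (X : ℕ) : Finset V :=
  (G.neighborFinset (c (cellX X)) ∩ G.neighborFinset (c (cellY X))) \ S

/-- An enumeration of a set of four vertices. -/
structure Enumerates (S : Finset V) (c : ℕ → V) : Prop where
  mem : ∀ r < 4, c r ∈ S
  inj : ∀ r < 4, ∀ t < 4, c r = c t → r = t
  surj : ∀ x ∈ S, ∃ r < 4, c r = x

omit [Fintype V] [DecidableEq V] in
theorem exists_enumerates (hS : #S = 4) : ∃ c, Enumerates S c := by
  let e := S.equivFinOfCardEq hS
  refine ⟨fun r => e.symm (Fin.ofNat 4 r), fun r _ => by simp, fun r hr t ht hrt => ?_,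
    fun x hx => ⟨e ⟨x, hx⟩, (e ⟨x, hx⟩).2, by simp⟩⟩
  have := e.symm.injective (Subtype.val_injective hrt)
  simpa [Fin.ext_iff, Nat.mod_eq_of_lt hr, Nat.mod_eq_of_lt ht] using this

variable {c : ℕ → V} (hc : Enumerates S c)

include hc

omit [Fintype V] in
theorem card_inter_eq_card_filter (U : Finset V) : #(U ∩ S) = #{r ∈ range 4 | c r ∈ U} := by
  rw [← card_image_of_injOn (f := c) fun r hr t ht => hc.inj r (by simp at hr; omega) t
    (by simp at ht; omega)]
  congr 1
  ext y
  simp only [mem_inter, mem_image, mem_filter, mem_range]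
  constructor
  · rintro ⟨hy, hyS⟩
    obtain ⟨r, hr, rfl⟩ := hc.surj y hyS
    exact ⟨r, ⟨hr, hy⟩, rfl⟩
  · rintro ⟨r, ⟨hr, hrU⟩, rfl⟩
    exact ⟨hrU, hc.mem r hr⟩

include h

theorem adj_of_mem_cell {u : V} {X r : ℕ} (hX : X < 6) (hu : u ∈ cell G S c X) (hr : r < 4) :
    G.Adj (c r) u ↔ r = cellX X ∨ r = cellY X := by
  obtain ⟨hx, hy, hxy⟩ := cell_lt X hX
  simp only [cell, mem_sdiff, mem_inter, SimpleGraph.mem_neighborFinset] at hu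
  have h₁ := h.inter_eq_pair hu.2 (hc.mem _ hx) (hc.mem _ hy) (fun h => hxy (hc.inj _ hx _ hy h))
    hu.1.1 hu.1.2
  have h₂ := congrArg (c r ∈ ·) h₁
  simp only [mem_inter, SimpleGraph.mem_neighborFinset, hc.mem r hr, and_true, mem_insert,
    mem_singleton, eq_iff_iff] at h₂
  rw [G.adj_comm, h₂]
  exact or_congr ⟨hc.inj _ hr _ hx, congrArg c⟩ ⟨hc.inj _ hr _ hy, congrArg c⟩

theorem cell_opposite {X Y : ℕ} (hX : X < 6) (hY : Y < 6)
    (hXY : ∀ r < 4, (r = cellX X ∨ r = cellY X) ↔ ¬ (r = cellX Y ∨ r = cellY Y)) :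
    cell G S c Y = (Sᶜ \ G.neighborFinset (c (cellX X))) \ G.neighborFinset (c (cellY X)) := by
  obtain ⟨hx, hy, hxy⟩ := cell_lt X hX
  ext u
  constructor
  · intro hu
    have h₁ := adj_of_mem_cell h hc hY hu hx
    have h₂ := adj_of_mem_cell h hc hY hu hy
    have h₃ := hXY _ hx
    have h₄ := hXY _ hy
    have h₅ : u ∉ S := (mem_sdiff.1 hu).2
    simp only [mem_sdiff, mem_compl, SimpleGraph.mem_neighborFinset]
    tauto
  · intro hu
    simp only [mem_sdiff, mem_compl, SimpleGraph.mem_neighborFinset] at hu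
    have h₁ := card_inter_eq_card_filter hc (G.neighborFinset u)
    rw [h.reg u hu.1.1] at h₁
    obtain ⟨hx', hy', hxy'⟩ := cell_lt Y hY
    have h₂ : {r ∈ range 4 | c r ∈ G.neighborFinset u} = {cellX Y, cellY Y} := by
      refine eq_of_subset_of_card_le (fun r hr => ?_) ?_
      · simp only [mem_filter, mem_range, SimpleGraph.mem_neighborFinset] at hr
        rw [mem_insert, mem_singleton]
        by_contra hrY
        rcases (hXY r hr.1).2 hrY with rfl | rfl
        · exact hu.1.2 hr.2.symm
        · exact hu.2 hr.2.symm
      · rw [← h₁, card_pair hxy']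
    have h₃ : ∀ r, r = cellX Y ∨ r = cellY Y → G.Adj u (c r) := fun r hr => by
      have : r ∈ ({r ∈ range 4 | c r ∈ G.neighborFinset u} : Finset ℕ) := by
        rw [h₂]; simpa using hr
      simpa using (mem_filter.1 this).2
    simp only [cell, mem_sdiff, mem_inter, SimpleGraph.mem_neighborFinset]
    exact ⟨⟨(h₃ _ (Or.inl rfl)).symm, (h₃ _ (Or.inr rfl)).symm⟩, hu.1.1⟩

theorem card_inter_cell_opposite {X Y : ℕ} (hX : X < 6) (hY : Y < 6)
    (hXY : ∀ r < 4, (r = cellX X ∨ r = cellY X) ↔ ¬ (r = cellX Y ∨ r = cellY Y)) {u : V}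
    (hu : u ∈ cell G S c X) :
    #(G.neighborFinset u ∩ cell G S c Y) = 2 + #(G.neighborFinset u ∩ cell G S c X) := by
  obtain ⟨hx, hy, hxy⟩ := cell_lt X hX
  rw [cell_opposite h hc hX hY hXY]
  rw [cell, mem_sdiff, mem_inter, SimpleGraph.mem_neighborFinset,
    SimpleGraph.mem_neighborFinset] at hu
  exact card_opposite h hu.2 (hc.mem _ hx) (hc.mem _ hy) hu.1.1 hu.1.2

theorem card_cell {X : ℕ} (hX : X < 6) : #(cell G S c X) = 3 := by
  obtain ⟨hx, hy, hxy⟩ := cell_lt X hX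
  have := h.card_inter_sdiff (hc.mem _ hx) (hc.mem _ hy) fun h => hxy (hc.inj _ hx _ hy h)
  exact Nat.add_right_cancel this

theorem exists_classLabelling_cell (v : V) {t : ℕ} (ht : t < 3) :
    ∃ e p q, ClassLabelling G v (cell G S c (2 * t)) (cell G S c (2 * t + 1)) e p q := by
  have hopp : ∀ t < 3, ∀ r < 4, (r = cellX (2 * t) ∨ r = cellY (2 * t)) ↔
      ¬ (r = cellX (2 * t + 1) ∨ r = cellY (2 * t + 1)) := by decide
  exact exists_classLabelling (card_cell h hc (by omega)) (card_cell h hc (by omega))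
    (fun u => card_inter_cell_opposite h hc (by omega) (by omega) (hopp t ht))
    (fun u => card_inter_cell_opposite h hc (by omega) (by omega)
      fun r hr => by rw [hopp t ht r hr, not_not]) v

omit h hc

theorem ownAdj_comm (e same : Bool) (k l : ℕ) : ownAdj e same k l = ownAdj e same l k := by
  simp only [ownAdj, beq_eq_decide, Bool.and_comm (decide (k = 2)), eq_comm (a := k) (b := l)]
  cases e <;> cases same <;> simp [Bool.and_comm]

end Reduction

section Reduction

open PackedSearch (cellX cellY ownAdj ownBit inBlock blockDegree classType)

variable (G) in
/-- A labelling of the vertices outside the clique `S` enumerated by `c`, three in every cell, in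
which the adjacencies inside every class follow `ownBit`. -/
structure IsLabelling (S : Finset V) (c f : ℕ → V) (e : ℕ → Bool) : Prop where
  mem_cell : ∀ i < 18, f i ∈ cell G S c (i / 3)
  adj_own : ∀ i < 18, ∀ b < 18, b / 6 = i / 6 →
    (G.Adj (f i) (f b) ↔ ownBit (e (i / 6)) i b = true)
  inj : ∀ i < 18, ∀ b < 18, i / 3 = b / 3 → f i = f b → i = b

variable {S : Finset V} {c : ℕ → V}

theorem isLabelling_of_classLabelling {v : ℕ → V} {e : ℕ → Bool} {p q : ℕ → Fin 3 → V}
    (H : ∀ t < 3, ClassLabelling G (v t) (cell G S c (2 * t)) (cell G S c (2 * t + 1))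
      (e t) (p t) (q t)) :
    IsLabelling G S c (fun i => if i / 3 % 2 = 0 then p (i / 6) (Fin.ofNat 3 i)
      else q (i / 6) (Fin.ofNat 3 i)) e where
  mem_cell i hi := by
    have hH := H (i / 6) (by omega)
    split_ifs with h
    · rw [show i / 3 = 2 * (i / 6) by omega]
      exact hH.mem_left _
    · rw [show i / 3 = 2 * (i / 6) + 1 by omega]
      exact hH.mem_right _
  adj_own i hi b hb hib := by
    have hH := H (i / 6) (by omega)
    simp only [hib, ownBit, beq_eq_decide, decide_true, Bool.true_and]
    split_ifs with h₁ h₂ h₂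
    · rw [hH.adj_left, show i / 3 = b / 3 by omega, decide_eq_true rfl]
      rfl
    · rw [hH.adj_cross, decide_eq_false (show ¬ i / 3 = b / 3 by omega)]
      rfl
    · rw [G.adj_comm, hH.adj_cross, decide_eq_false (show ¬ i / 3 = b / 3 by omega), ownAdj_comm]
      rfl
    · rw [hH.adj_right, show i / 3 = b / 3 by omega, decide_eq_true rfl]
      rfl
  inj i hi b hb hib h := by
    have hH := H (i / 6) (by omega)
    rw [hib, show b / 6 = i / 6 by omega] at h
    have : Fin.ofNat 3 i = Fin.ofNat 3 b := by
      split_ifs at h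
      · exact hH.injective_left h
      · exact hH.injective_right h
    have : i % 3 = b % 3 := congrArg Fin.val this
    omega

variable (h : RegularCliqueIn G S 12 5 2 4) (hc : Enumerates S c) {f : ℕ → V} {e : ℕ → Bool}
  (hf : IsLabelling G S c f e)

include h hc hf

theorem adj_labelling {i r : ℕ} (hi : i < 18) (hr : r < 4) :
    G.Adj (c r) (f i) ↔ r = cellX (i / 3) ∨ r = cellY (i / 3) :=
  adj_of_mem_cell h hc (by omega) (hf.mem_cell i hi) hr

theorem labelling_injOn : Set.InjOn f (range 18) := by
  intro i hi b hb hib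
  simp only [coe_range, Set.mem_Iio] at hi hb
  refine hf.inj i hi b hb ?_ hib
  have : ∀ X < 6, ∀ Y < 6, (∀ r < 4, (r = cellX X ∨ r = cellY X) ↔
      (r = cellX Y ∨ r = cellY Y)) → X = Y := by decide
  refine this _ (by omega) _ (by omega) fun r hr => ?_
  rw [← adj_labelling h hc hf hi hr, ← adj_labelling h hc hf hb hr, hib]

theorem card_filter_labelling (hv : Fintype.card V = 22) (U : Finset V) :
    #{b ∈ range 18 | f b ∈ U} = #(U \ S) := by
  have hinj := labelling_injOn h hc hf
  have himage : (range 18).image f = Sᶜ := by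
    refine eq_of_subset_of_card_le (fun y hy => ?_) ?_
    · obtain ⟨i, hi, rfl⟩ := mem_image.1 hy
      exact mem_compl.2 (mem_sdiff.1 (hf.mem_cell i (mem_range.1 hi))).2
    · rw [card_image_of_injOn hinj, card_compl, h.card, hv, card_range]
  rw [sdiff_eq_inter_compl, inter_comm, ← himage, ← filter_mem_eq_inter, filter_image,
    card_image_of_injOn (hinj.mono (coe_subset.2 (filter_subset _ _)))]

theorem solution_of_labelling (hv : Fintype.card V = 22) (e₁ e₂ e₃ : Bool)
    (he : ∀ t < 3, e t = classType e₁ e₂ e₃ t)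
    (h₂ : PackedSearch.sorted e₂ 6 (PackedSearch.code fun b => decide (G.Adj (f 0) (f b))) = true)
    (h₃ : PackedSearch.sorted e₃ 12 (PackedSearch.code fun b => decide (G.Adj (f 0) (f b))) = true) :
    PackedSearch.Solution e₁ e₂ e₃ fun i b => decide (G.Adj (f i) (f b)) := by
  have hown : ∀ i < 18, ∀ b < 18, b / 6 = i / 6 →
      decide (G.Adj (f i) (f b)) = ownBit (classType e₁ e₂ e₃ (i / 6)) i b := by
    intro i hi b hb hib
    rw [Bool.eq_iff_iff, decide_eq_true_iff, hf.adj_own i hi b hb hib, he _ (by omega)]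
  have hblock : ∀ i < 18, ∀ X < 4, (X = cellX (i / 3) ∨ X = cellY (i / 3)) →
      ((List.range 18).filter fun b => inBlock i X b && decide (G.Adj (f i) (f b))).length =
        blockDegree (classType e₁ e₂ e₃ (i / 6)) i := by
    intro i hi X hX hiX
    have hiS := (mem_sdiff.1 (hf.mem_cell i hi)).2
    have h₁ := card_filter_labelling h hc hf hv (G.neighborFinset (f i) ∩ G.neighborFinset (c X))
    rw [card_common_sdiff h hiS (hc.mem X hX) ((adj_labelling h hc hf hi hX).2 hiX),
      ← card_filter_add_card_filter_not (p := fun b => b / 6 = i / 6), filter_filter,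
      filter_filter] at h₁
    have hmem : ∀ b < 18, f b ∈ G.neighborFinset (f i) ∩ G.neighborFinset (c X) ↔
        G.Adj (f i) (f b) ∧ (X = cellX (b / 3) ∨ X = cellY (b / 3)) := fun b hb => by
      rw [mem_inter, SimpleGraph.mem_neighborFinset, SimpleGraph.mem_neighborFinset,
        adj_labelling h hc hf hb hX]
    have h₂ : ((List.range 18).filter fun b => inBlock i X b && decide (G.Adj (f i) (f b))).length =
        #{b ∈ range 18 | f b ∈ G.neighborFinset (f i) ∩ G.neighborFinset (c X) ∧
          ¬ b / 6 = i / 6} := by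
      rw [← List.toFinset_card_of_nodup (List.nodup_range.filter _)]
      congr 1
      ext b
      simp only [List.mem_toFinset, List.mem_filter, List.mem_range, mem_filter, mem_range]
      refine and_congr_right fun hb => ?_
      rw [hmem b hb]
      simp [inBlock, PackedSearch.incident, beq_eq_decide, eq_comm (a := X)]
      tauto
    have h₃ : #{b ∈ range 18 | f b ∈ G.neighborFinset (f i) ∩ G.neighborFinset (c X) ∧
          b / 6 = i / 6} = #{b ∈ range 18 | b / 6 = i / 6 ∧ (X = cellX (b / 3) ∨ X = cellY (b / 3)) ∧
            ownBit (classType e₁ e₂ e₃ (i / 6)) i b = true} := by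
      congr 1
      refine filter_congr fun b hb => ?_
      rw [mem_range] at hb
      rw [hmem b hb]
      constructor
      · rintro ⟨⟨h₁, h₂⟩, h₃⟩
        exact ⟨h₃, h₂, by rw [← hown i hi b hb h₃, decide_eq_true h₁]⟩
      · rintro ⟨h₁, h₂, h₃⟩
        rw [← hown i hi b hb h₁, decide_eq_true_iff] at h₃
        exact ⟨⟨h₃, h₂⟩, h₁⟩
    have h₄ : ∀ e, ∀ i < 18, ∀ X < 4, (X = cellX (i / 3) ∨ X = cellY (i / 3)) →
      #{b ∈ range 18 | b / 6 = i / 6 ∧ (X = cellX (b / 3) ∨ X = cellY (b / 3)) ∧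
            ownBit e i b = true} + blockDegree e i = 4 := by decide +kernel
    have h₅ := h₄ (classType e₁ e₂ e₃ (i / 6)) i hi X hX hiX
    omega
  constructor
  · refine ⟨fun i _ b _ => by simp only [G.adj_comm], fun i hi j hj hij => ?_⟩
    rw [decide_eq_true_iff] at hij
    have h₁ := card_sdiff_add_card_inter (G.neighborFinset (f i) ∩ G.neighborFinset (f j)) S
    have hmem : ∀ r ∈ range 4, c r ∈ G.neighborFinset (f i) ∩ G.neighborFinset (f j) ↔
        (r = cellX (i / 3) ∨ r = cellY (i / 3)) ∧ (r = cellX (j / 3) ∨ r = cellY (j / 3)) := by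
      intro r hr
      rw [mem_range] at hr
      rw [mem_inter, SimpleGraph.mem_neighborFinset, SimpleGraph.mem_neighborFinset, G.adj_comm,
        adj_labelling h hc hf hi hr, G.adj_comm, adj_labelling h hc hf hj hr]
    rw [h.lam _ _ hij, card_inter_eq_card_filter hc, filter_congr hmem,
      ← card_filter_labelling h hc hf hv, card_filter] at h₁
    have h₂ : ∀ i < 18, ∀ j < 18, PackedSearch.common i j +
        #{r ∈ range 4 | (r = cellX (i / 3) ∨ r = cellY (i / 3)) ∧
          (r = cellX (j / 3) ∨ r = cellY (j / 3))} = 5 := by decide +kernel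
    have h₃ := h₂ i hi j hj
    have h₄ : ∑ b ∈ range 18, (decide (G.Adj (f j) (f b)) && decide (G.Adj (f i) (f b))).toNat =
        ∑ b ∈ range 18, if f b ∈ G.neighborFinset (f i) ∩ G.neighborFinset (f j) then 1 else 0 := by
      refine sum_congr rfl fun b _ => ?_
      by_cases hib : G.Adj (f i) (f b) <;> by_cases hjb : G.Adj (f j) (f b) <;> simp [hib, hjb]
    omega
  · exact hown
  · exact fun i hi => hblock i hi _ (cell_lt _ (by omega)).1 (Or.inl rfl)
  · exact fun i hi => hblock i hi _ (cell_lt _ (by omega)).2.1 (Or.inr rfl)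
  · exact h₂
  · exact h₃

omit hc hf

theorem not_parameters_22_12_5 (hv : Fintype.card V = 22) : False := by
  obtain ⟨c, hc⟩ := exists_enumerates h.card
  have H : ∀ v t, ∃ e p q, t < 3 →
      ClassLabelling G v (cell G S c (2 * t)) (cell G S c (2 * t + 1)) e p q := by
    intro v t
    by_cases ht : t < 3
    · obtain ⟨e, p, q, h⟩ := exists_classLabelling_cell h hc v ht
      exact ⟨e, p, q, fun _ => h⟩
    · exact ⟨true, fun _ => v, fun _ => v, fun h => (ht h).elim⟩
  choose e p q H using H
  let v : ℕ → V := fun t => if t = 0 then c 0 else p (c 0) 0 0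
  have hf := isLabelling_of_classLabelling (e := fun t => e (v t) t) (p := fun t => p (v t) t)
    (q := fun t => q (v t) t) fun t ht => H (v t) t ht
  refine (solution_of_labelling h hc hf hv (e (v 0) 0) (e (v 1) 1) (e (v 2) 2) ?_ ?_ ?_).false
  · intro t ht
    interval_cases t <;> rfl
  · refine PackedSearch.sorted_code (by omega) ?_
    simpa [v] using (H (v 1) 1 (by omega)).sorted
  · refine PackedSearch.sorted_code (by omega) ?_
    simpa [v] using (H (v 2) 2 (by omega)).sorted

end Reduction

section Main

omit [DecidableEq V] in
theorem ncard_neighborSet (u : V) : (G.neighborSet u).ncard = #(G.neighborFinset u) := by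
  rw [← Set.ncard_coe_finset, SimpleGraph.coe_neighborFinset]

theorem ncard_commonNeighbors (u w : V) :
    (G.commonNeighbors u w).ncard = #(G.neighborFinset u ∩ G.neighborFinset w) := by
  rw [← Set.ncard_coe_finset, coe_inter, SimpleGraph.coe_neighborFinset,
    SimpleGraph.coe_neighborFinset, SimpleGraph.commonNeighbors]

theorem regularCliqueIn_of_isEdgeRegular {v k l m : ℕ} {S : Finset V} (h : IsEdgeRegular G v k l)
    (htop : G ≠ ⊤) (hS : 2 ≤ #S) (hclique : G.IsClique S) (hreg : IsRegularClique G S m) :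
    RegularCliqueIn G S k l m #S := by
  have hdeg : ∀ u, #(G.neighborFinset u) = k := fun u => by rw [← ncard_neighborSet, h.2.2.1]
  refine ⟨hdeg, fun x y hxy => ?_, hclique, rfl, fun u hu => ?_, hreg.1, hS, ?_⟩
  · rw [← ncard_commonNeighbors, h.2.2.2 x y hxy]
  · rw [← hreg.2 u hu, ← Set.ncard_coe_finset, coe_inter, SimpleGraph.coe_neighborFinset]
  · obtain ⟨x, y, hxy, hadj⟩ := SimpleGraph.ne_top_iff_exists_not_adj.1 htop
    have h₁ := card_compl_neighborFinset hdeg x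
    have h₂ : 0 < #(Gᶜ.neighborFinset x) := card_pos.2 ⟨y, mem_compl_neighborFinset.2 ⟨hxy, hadj⟩⟩
    omega

theorem isStronglyRegularGraph_of_constMu {v k l : ℕ} (h : IsEdgeRegular G v k l) (htop : G ≠ ⊤)
    (hmu : ConstMu G) : IsStronglyRegularGraph G := by
  obtain ⟨mu, hmu⟩ := hmu
  exact ⟨v, k, l, mu, h.1, h.2.1, htop, h.2.2.1, h.2.2.2, fun u w huw hadj => by
    rw [ncard_commonNeighbors, hmu u w huw hadj]⟩

/-- The parameters of a strictly Neumaier graph on at most 24 vertices. -/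
theorem RegularCliqueIn.parameters_of_not_constMu {S : Finset V} {k l m s : ℕ}
    (h : RegularCliqueIn G S k l m s) (hG : ¬ ConstMu G) (hv : Fintype.card V ≤ 24) :
    (Fintype.card V, k, l, m, s) = (16, 9, 4, 2, 4) ∨
      (Fintype.card V, k, l, m, s) = (24, 8, 2, 1, 4) := by
  rcases h.parameters hG hv with ⟨rfl, hk, hv⟩ | hmem
  · exact (hG (constMu_of_triangles h.deg h.lam hk hv)).elim
  simp only [List.mem_cons, Prod.mk.injEq, List.not_mem_nil, or_false] at hmem
  rcases hmem with h' | h' | h' | h' | h' | h' | h' | h' | h' | h' | h' <;>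
    obtain ⟨hv, rfl, rfl, rfl, rfl⟩ := h'
  · exact (hG (constMu_of_grid h hv)).elim
  · exact (hG (constMu_of_triangular h rfl rfl (by rw [hv]))).elim
  · exact (hG (constMu_of_triangular h rfl rfl (by rw [hv]))).elim
  · exact (not_parameters_21_12_7 h).elim
  · have := three_dvd_card_mul h.deg h.lam
    rw [hv] at this
    omega
  · have := even_card_mul h.deg
    rw [hv] at this
    exact absurd this (by decide)
  · exact (not_parameters_15_10_6 h.deg h.lam hv).elim
  · exact (not_parameters_21_14_9 h.deg h.lam hv).elim
  · exact (not_parameters_22_12_5 h hv).elim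
  · exact Or.inl (by rw [hv])
  · exact Or.inr (by rw [hv])

end Main

end Neumaier

/-- Every strictly Neumaier graph on at most 24 vertices is either edge-regular with
parameters `(16, 9, 4)` containing a 2-regular 4-clique, or edge-regular with
parameters `(24, 8, 2)` containing a 1-regular 4-clique. -/
theorem strictlyNeumaier_le_24 (V : Type) [Fintype V] (G : SimpleGraph V)
    (h : ∃ v k lam m s : ℕ, IsStrictlyNeumaier G v k lam m s)
    (hcard : Fintype.card V ≤ 24) :
    (IsEdgeRegular G 16 9 4 ∧
      ∃ S : Finset V, G.IsClique ↑S ∧ S.card = 4 ∧ IsRegularClique G S 2) ∨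
    (IsEdgeRegular G 24 8 2 ∧
      ∃ S : Finset V, G.IsClique ↑S ∧ S.card = 4 ∧ IsRegularClique G S 1) := by
  classical
  obtain ⟨v, k, l, m, s, ⟨hG, htop, hs, S, hclique, rfl, hreg⟩, hsrg⟩ := h
  have hS := Neumaier.regularCliqueIn_of_isEdgeRegular hG htop hs hclique hreg
  have hv := hG.1
  rcases hS.parameters_of_not_constMu
    (fun hmu => hsrg (Neumaier.isStronglyRegularGraph_of_constMu hG htop hmu)) hcard with h | h
  all_goals
    simp only [Prod.mk.injEq] at h
    obtain ⟨hv', rfl, rfl, rfl, hs'⟩ := h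
    obtain rfl := hv.symm.trans hv'
  · exact Or.inl ⟨hG, S, hclique, hs', hreg⟩
  · exact Or.inr ⟨hG, S, hclique, hs', hreg⟩
end
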